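/- Let g be the finite-dimensional simple Lie algebra of type E₈ over ℂ. Every nilpotent element e of g with dim g_e = 84 satisfies dim [g_e,g_e] = 83, e ∉ [g_e,g_e], and g_e = [g_e,g_e] + ℂ·e. (The unique nilpotent orbit of E₈ with centralizer dimension 84 is A₃+A₁, which is rigid but not strongly reachable, with (dim g_e, dim[g_e,g_e]) = (84,83).) -/

import Mathlib

/-- The centralizer `g_e` of `e`, i.e. the kernel of `ad e`. -/
noncomputable def centralizer (e : LieAlgebra.e₈ ℂ) : Submodule ℂ (LieAlgebra.e₈ ℂ) :=
  LinearMap.ker (LieAlgebra.ad ℂ (LieAlgebra.e₈ ℂ) e)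

/-- The derived subalgebra `[g_e, g_e]` of the centralizer, as the linear span of all
brackets of pairs of elements of `g_e`. -/
noncomputable def derived (e : LieAlgebra.e₈ ℂ) : Submodule ℂ (LieAlgebra.e₈ ℂ) :=
  Submodule.span ℂ
    {z : LieAlgebra.e₈ ℂ | ∃ x ∈ centralizer e, ∃ y ∈ centralizer e, ⁅x, y⁆ = z}

section ExpDerivation

open NormedSpace Filter Topology

variable {E : Type*} [NormedAddCommGroup E] [NormedSpace ℂ E] [CompleteSpace E]

theorem exp_mul_exp_neg (D : E →L[ℂ] E) : exp D * exp (-D) = 1 := by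
  let : NormedAlgebra ℚ (E →L[ℂ] E) := NormedAlgebra.restrictScalars ℚ ℂ _
  rw [← exp_add_of_commute (Commute.neg_right (Commute.refl D)), add_neg_cancel, exp_zero]

/-- The exponential of a derivation of a bilinear operation is multiplicative. -/
theorem exp_apply_bilinear_of_derivation (β : E →L[ℂ] E →L[ℂ] E) (D : E →L[ℂ] E)
    (hD : ∀ x y, D (β x y) = β (D x) y + β x (D y)) (x y : E) :
    exp D (β x y) = β (exp D x) (exp D y) := by
  have hF (t : ℂ) : HasDerivAt (fun u : ℂ ↦ exp (u • D)) (D * exp (t • D)) t :=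
    hasDerivAt_exp_smul_const' D t
  have hG (t : ℂ) : HasDerivAt (fun u : ℂ ↦ exp (u • (-D))) (exp (t • (-D)) * (-D)) t :=
    hasDerivAt_exp_smul_const (-D) t
  have key (t : ℂ) : HasDerivAt
      (fun u : ℂ ↦ exp (u • (-D)) (β (exp (u • D) x) (exp (u • D) y))) 0 t := by
    have hx (x : E) : HasDerivAt (fun u : ℂ ↦ exp (u • D) x) (D (exp (t • D) x)) t := by
      simpa using (hF t).clm_apply (hasDerivAt_const t x)
    have hβx : HasDerivAt (fun u : ℂ ↦ β (exp (u • D) x)) (β (D (exp (t • D) x))) t :=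
      β.hasFDerivAt.comp_hasDerivAt (f := fun u : ℂ ↦ exp (u • D) x) t (hx x)
    have hβ := hβx.clm_apply (hx y)
    have := (hG t).clm_apply hβ
    rw [← hD] at this
    simpa using this
  have hc := is_const_of_deriv_eq_zero (fun t ↦ (key t).differentiableAt)
    (fun t ↦ (key t).deriv) 1 0
  simp only [one_smul, zero_smul, exp_zero, one_apply_eq_self] at hc
  rw [← hc, ← mul_apply_eq_comp, exp_mul_exp_neg, one_apply_eq_self]

theorem exp_apply_of_cube_eq_zero (D : E →L[ℂ] E) (x : E) (h : D (D (D x)) = 0) :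
    exp D x = x + D x + (2⁻¹ : ℂ) • D (D x) := by
  have hs := (exp_series_hasSum_exp' (𝕂 := ℂ) D).mapL (ContinuousLinearMap.apply ℂ E x)
  have hz (n : ℕ) : (D ^ (n + 3)) x = 0 := by
    induction n with
    | zero => simpa [pow_succ] using h
    | succ n ih => rw [show n + 1 + 3 = (n + 3) + 1 by ring, pow_succ', mul_apply_eq_comp,
        ih, map_zero]
  have hs' := hasSum_sum_of_ne_finset_zero (L := .unconditional ℕ)
    (s := Finset.range 3)
    (f := fun n : ℕ ↦ ContinuousLinearMap.apply ℂ E x ((n.factorial⁻¹ : ℂ) • D ^ n)) (by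
      intro n hn
      obtain ⟨m, rfl⟩ := Nat.exists_eq_add_of_le' (not_lt.mp (by simpa using hn))
      simp [hz])
  have := hs.unique hs'
  simp [Finset.sum_range_succ] at this
  exact this

theorem eventually_exists_exp_apply_eq (A : E →L[ℂ] E →L[ℂ] E) (P Z : Submodule ℂ E)
    [CompleteSpace P] [CompleteSpace Z] (x : E)
    (h : ∀ v, ∃ w ∈ P, ∃ u ∈ Z, v = A w x + u) :
    ∀ᶠ z in 𝓝 x, ∃ w ∈ P, ∃ u ∈ Z, exp (A w) (x + u) = z := by
  let f : P × Z → E := fun q ↦ exp (A q.1) (x + q.2)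
  have h1 : HasStrictFDerivAt (fun q : P × Z ↦ exp (A q.1))
      ((1 : (E →L[ℂ] E) →L[ℂ] (E →L[ℂ] E)).comp
        (A.comp (P.subtypeL.comp (ContinuousLinearMap.fst ℂ P Z)))) 0 := by
    refine HasStrictFDerivAt.comp (g := exp) (f := fun q : P × Z ↦ A q.1) 0 ?_ ?_
    · simpa using hasStrictFDerivAt_exp_zero (𝕂 := ℂ) (𝔸 := E →L[ℂ] E)
    · exact (A.comp (P.subtypeL.comp (ContinuousLinearMap.fst ℂ P Z))).hasStrictFDerivAt
  have h2 : HasStrictFDerivAt (fun q : P × Z ↦ x + q.2)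
      (Z.subtypeL.comp (ContinuousLinearMap.snd ℂ P Z)) 0 :=
    (Z.subtypeL.comp (ContinuousLinearMap.snd ℂ P Z)).hasStrictFDerivAt.const_add x
  have h3 := h1.clm_apply h2
  have h4 := h3.map_nhds_eq_of_surj (by
    rw [LinearMap.range_eq_top]
    intro v
    obtain ⟨w, hw, u, hu, rfl⟩ := h v
    refine ⟨(⟨w, hw⟩, ⟨u, hu⟩), ?_⟩
    simp [add_comm])
  have h5 : ∀ᶠ z in map f (𝓝 0), ∃ w ∈ P, ∃ u ∈ Z, exp (A w) (x + u) = z :=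
    Filter.eventually_map.mpr (.of_forall fun q ↦ ⟨q.1, q.1.2, q.2, q.2.2, rfl⟩)
  rw [h4] at h5
  simpa using h5

end ExpDerivation

section ExpAd

open Filter Topology LieAlgebra

variable {L : Type*} [LieRing L] [LieAlgebra ℂ L] [FiniteDimensional ℂ L]

theorem exists_exp_ad : ∃ Φ : L → (L ≃ₗ⁅ℂ⁆ L),
    (∀ w x, ⁅w, ⁅w, ⁅w, x⁆⁆⁆ = 0 → Φ w x = x + ⁅w, x⁆ + (2⁻¹ : ℂ) • ⁅w, ⁅w, x⁆⁆) ∧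
    ∀ (P Z : Submodule ℂ L) (x : L), (∀ v, ∃ w ∈ P, ∃ u ∈ Z, v = ⁅w, x⁆ + u) →
      ∀ v, ∀ᶠ t in 𝓝 (0 : ℂ), ∃ w ∈ P, ∃ u ∈ Z, Φ w (x + u) = x + t • v := by
  let E := Fin (Module.finrank ℂ L) → ℂ
  let c : L ≃ₗ[ℂ] E := (Module.finBasis ℂ L).equivFun
  let A : E →L[ℂ] E →L[ℂ] E := LinearMap.toContinuousLinearMap
    ((LinearMap.toContinuousLinearMap (𝕜 := ℂ) (E := E) (F' := E)).toLinearMap ∘ₗ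
      c.conj.toLinearMap ∘ₗ LinearMap.mk₂ ℂ (fun x y : L ↦ ⁅x, y⁆) add_lie smul_lie lie_add
        (fun c x y ↦ lie_smul c x y) ∘ₗ c.symm.toLinearMap)
  have hA (w x : E) : A w x = c ⁅c.symm w, c.symm x⁆ := by
    simp [A, LinearEquiv.conj_apply]
  have hinv (w x : E) : NormedSpace.exp (A w) (NormedSpace.exp (-A w) x) = x := by
    rw [← mul_apply_eq_comp, exp_mul_exp_neg, one_apply_eq_self]
  have hinv' (w x : E) : NormedSpace.exp (-A w) (NormedSpace.exp (A w) x) = x := by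
    simpa using DFunLike.congr_fun (exp_mul_exp_neg (-A w)) x
  have hmul (w x y : E) := exp_apply_bilinear_of_derivation A (A w) (fun x y ↦ by
    simp only [hA, LinearEquiv.symm_apply_apply, leibniz_lie (c.symm w), map_add]) x y
  let Φ (w : L) : L ≃ₗ⁅ℂ⁆ L :=
    { toFun := fun x ↦ c.symm (NormedSpace.exp (A (c w)) (c x))
      invFun := fun x ↦ c.symm (NormedSpace.exp (-A (c w)) (c x))
      map_add' := by simp
      map_smul' := by simp
      map_lie' := fun {x y} ↦ by
        have := hmul (c w) (c x) (c y)
        simp only [hA, LinearEquiv.symm_apply_apply] at this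
        simp [this]
      left_inv := fun x ↦ by
        simp [hinv']
      right_inv := fun x ↦ by
        simp [hinv] }
  have hΦ (w x : L) : Φ w x = c.symm (NormedSpace.exp (A (c w)) (c x)) := rfl
  refine ⟨Φ, fun w x hx ↦ ?_, fun P Z x h v ↦ ?_⟩
  · rw [hΦ, exp_apply_of_cube_eq_zero]
    · simp [hA]
    · simp [hA, hx]
  · have h1 := eventually_exists_exp_apply_eq A (P.map c.toLinearMap) (Z.map c.toLinearMap) (c x)
      (fun y ↦ by
        obtain ⟨w, hw, u, hu, hv⟩ := h (c.symm y)
        refine ⟨c w, ⟨w, hw, rfl⟩, c u, ⟨u, hu, rfl⟩, ?_⟩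
        rw [hA]
        simp [← map_add, ← hv])
    have h2 : Tendsto (fun t : ℂ ↦ c x + t • c v) (𝓝 0) (𝓝 (c x)) := by
      have : Continuous (fun t : ℂ ↦ c x + t • c v) := by fun_prop
      simpa using this.tendsto 0
    filter_upwards [h2.eventually h1]
    rintro t ⟨_, ⟨w, hw, rfl⟩, _, ⟨u, hu, rfl⟩, he⟩
    refine ⟨w, hw, u, hu, ?_⟩
    rw [hΦ, map_add]
    erw [he]
    simp

end ExpAd

namespace E8

/-- The root lattice of type `E₈`, in coordinates with respect to the simple roots. -/
abbrev Lattice : Type := Fin 8 → ℤ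

/-- A bilinear form on the lattice with `cocycle x y + cocycle y x = form x y`. -/
def cocycle (x y : Lattice) : ℤ :=
  x 0 * y 0 + x 1 * y 1 + x 2 * y 2 + x 3 * y 3 + x 4 * y 4 + x 5 * y 5 + x 6 * y 6 + x 7 * y 7
    - (x 0 * y 2 + x 2 * y 3 + x 1 * y 3 + x 3 * y 4 + x 4 * y 5 + x 5 * y 6 + x 6 * y 7)

/-- The invariant form on the lattice. -/
def form (x y : Lattice) : ℤ := cocycle x y + cocycle y x

theorem cocycle_add_left (x y z : Lattice) : cocycle (x + y) z = cocycle x z + cocycle y z := by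
  simp only [cocycle, Pi.add_apply]; ring

theorem cocycle_add_right (x y z : Lattice) : cocycle x (y + z) = cocycle x y + cocycle x z := by
  simp only [cocycle, Pi.add_apply]; ring

theorem cocycle_neg_left (x y : Lattice) : cocycle (-x) y = -cocycle x y := by
  simp only [cocycle, Pi.neg_apply]; ring

theorem cocycle_neg_right (x y : Lattice) : cocycle x (-y) = -cocycle x y := by
  simp only [cocycle, Pi.neg_apply]; ring

theorem form_comm (x y : Lattice) : form x y = form y x := add_comm _ _

theorem form_add_left (x y z : Lattice) : form (x + y) z = form x z + form y z := by
  simp only [form, cocycle_add_left, cocycle_add_right]; ring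

theorem form_add_right (x y z : Lattice) : form x (y + z) = form x y + form x z := by
  simp only [form, cocycle_add_left, cocycle_add_right]; ring

theorem form_neg_left (x y : Lattice) : form (-x) y = -form x y := by
  simp only [form, cocycle_neg_left, cocycle_neg_right]; ring

theorem form_neg_right (x y : Lattice) : form x (-y) = -form x y := by
  simp only [form, cocycle_neg_left, cocycle_neg_right]; ring

theorem form_sub_left (x y z : Lattice) : form (x - y) z = form x z - form y z := by
  rw [sub_eq_add_neg, form_add_left, form_neg_left, sub_eq_add_neg]

theorem form_sub_right (x y z : Lattice) : form x (y - z) = form x y - form x z := by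
  rw [sub_eq_add_neg, form_add_right, form_neg_right, sub_eq_add_neg]

theorem form_zero_right (x : Lattice) : form x 0 = 0 := by simp [form, cocycle]

theorem form_self (x : Lattice) : form x x = 2 * cocycle x x := by rw [form]; ring

theorem form_self_eq_sum_sq (x : Lattice) :
    60 * form x x = 30 * (2 * x 0 - x 2) ^ 2 + 10 * (3 * x 2 - 2 * x 3) ^ 2
      + 30 * (2 * x 1 - x 3) ^ 2 + 2 * (5 * x 3 - 6 * x 4) ^ 2 + 3 * (4 * x 4 - 5 * x 5) ^ 2
      + 5 * (3 * x 5 - 4 * x 6) ^ 2 + 10 * (2 * x 6 - 3 * x 7) ^ 2 + 30 * x 7 ^ 2 := by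
  simp only [form, cocycle]; ring

theorem form_self_nonneg (x : Lattice) : 0 ≤ form x x := by
  have := form_self_eq_sum_sq x
  have : 0 ≤ 60 * form x x := by rw [this]; positivity
  omega

theorem eq_zero_of_form_self_eq_zero {x : Lattice} (h : form x x = 0) : x = 0 := by
  have H := form_self_eq_sum_sq x
  rw [h] at H
  have h1 := sq_nonneg (2 * x 0 - x 2)
  have h2 := sq_nonneg (3 * x 2 - 2 * x 3)
  have h3 := sq_nonneg (2 * x 1 - x 3)
  have h4 := sq_nonneg (5 * x 3 - 6 * x 4)
  have h5 := sq_nonneg (4 * x 4 - 5 * x 5)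
  have h6 := sq_nonneg (3 * x 5 - 4 * x 6)
  have h7 := sq_nonneg (2 * x 6 - 3 * x 7)
  have h8 := sq_nonneg (x 7)
  have e1 : 2 * x 0 - x 2 = 0 := pow_eq_zero_iff two_ne_zero |>.mp (by linarith)
  have e2 : 3 * x 2 - 2 * x 3 = 0 := pow_eq_zero_iff two_ne_zero |>.mp (by linarith)
  have e3 : 2 * x 1 - x 3 = 0 := pow_eq_zero_iff two_ne_zero |>.mp (by linarith)
  have e4 : 5 * x 3 - 6 * x 4 = 0 := pow_eq_zero_iff two_ne_zero |>.mp (by linarith)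
  have e5 : 4 * x 4 - 5 * x 5 = 0 := pow_eq_zero_iff two_ne_zero |>.mp (by linarith)
  have e6 : 3 * x 5 - 4 * x 6 = 0 := pow_eq_zero_iff two_ne_zero |>.mp (by linarith)
  have e7 : 2 * x 6 - 3 * x 7 = 0 := pow_eq_zero_iff two_ne_zero |>.mp (by linarith)
  have e8 : x 7 = 0 := pow_eq_zero_iff two_ne_zero |>.mp (by linarith)
  funext i
  fin_cases i <;> simp only [Pi.zero_apply] <;> dsimp <;> omega

theorem form_self_pos {x : Lattice} (h : x ≠ 0) : 0 < form x x :=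
  (form_self_nonneg x).lt_of_ne' fun hx ↦ h (eq_zero_of_form_self_eq_zero hx)

/-- A root is a lattice vector of norm `2`. -/
def Root : Type := {v : Lattice // form v v = 2}

instance : DecidableEq Root := inferInstanceAs (DecidableEq {v : Lattice // form v v = 2})

theorem form_le_two (α β : Root) : form α.1 β.1 ≤ 2 := by
  have := form_self_nonneg (α.1 - β.1)
  rw [form_sub_left, form_sub_right, form_sub_right, α.2, β.2, form_comm β.1 α.1] at this
  linarith

theorem eq_of_form_eq_two {α β : Root} (h : form α.1 β.1 = 2) : α.1 = β.1 := by
  refine sub_eq_zero.mp (eq_zero_of_form_self_eq_zero ?_)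
  rw [form_sub_left, form_sub_right, form_sub_right, α.2, β.2, form_comm β.1 α.1, h]; rfl

namespace Root

instance : Neg Root := ⟨fun α ↦ ⟨-α.1, by rw [form_neg_left, form_neg_right, α.2]; rfl⟩⟩

@[simp] theorem neg_val (α : Root) : (-α).1 = -α.1 := rfl

end Root

theorem neg_two_le_form (α β : Root) : -2 ≤ form α.1 β.1 := by
  have := form_le_two (-α) β
  rw [Root.neg_val, form_neg_left] at this
  linarith

theorem add_eq_zero_of_form_eq_neg_two {α β : Root} (h : form α.1 β.1 = -2) : α.1 + β.1 = 0 := by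
  refine eq_zero_of_form_self_eq_zero ?_
  rw [form_add_left, form_add_right, form_add_right, α.2, β.2, form_comm β.1 α.1, h]; rfl

theorem form_add_self_eq_two_iff (α β : Root) :
    form (α.1 + β.1) (α.1 + β.1) = 2 ↔ form α.1 β.1 = -1 := by
  rw [form_add_left, form_add_right, form_add_right, α.2, β.2, form_comm β.1 α.1]
  omega

/-- The sign `(-1) ^ cocycle x y`. -/
def sgn (x y : Lattice) : ℤ := if cocycle x y % 2 = 0 then 1 else -1

theorem sgn_add_right (x y z : Lattice) : sgn x (y + z) = sgn x y * sgn x z := by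
  simp only [sgn, cocycle_add_right]
  split_ifs <;> first | rfl | omega

theorem sgn_neg_left (x y : Lattice) : sgn (-x) y = sgn x y := by
  simp only [sgn, cocycle_neg_left]
  split_ifs <;> first | rfl | omega

theorem sgn_neg_right (x y : Lattice) : sgn x (-y) = sgn x y := by
  simp only [sgn, cocycle_neg_right]
  split_ifs <;> first | rfl | omega

theorem sgn_self (α : Root) : sgn α.1 α.1 = -1 := by
  have := form_self α.1
  rw [α.2] at this
  rw [sgn, if_neg (by omega)]

theorem sgn_mul_self (x y : Lattice) : sgn x y * sgn x y = 1 := by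
  simp only [sgn]; split_ifs <;> rfl

theorem sgn_comm_of_even {x y : Lattice} (h : form x y % 2 = 0) : sgn y x = sgn x y := by
  simp only [sgn]
  rw [form] at h
  split_ifs <;> first | rfl | omega

theorem sgn_comm_of_odd {x y : Lattice} (h : form x y % 2 = 1) : sgn y x = -sgn x y := by
  simp only [sgn]
  rw [form] at h
  split_ifs <;> first | rfl | omega

/-- The index type of the standard basis: simple coroots and roots. -/
abbrev Idx : Type := Fin 8 ⊕ Root

/-- The underlying space of the model of the simple Lie algebra of type `E₈`. -/
def Model : Type := Idx →₀ ℂ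

namespace Model

noncomputable instance : AddCommGroup Model := inferInstanceAs (AddCommGroup (Idx →₀ ℂ))
noncomputable instance : Module ℂ Model := inferInstanceAs (Module ℂ (Idx →₀ ℂ))

/-- The standard basis of the model. -/
noncomputable def basis : Module.Basis Idx ℂ Model := Finsupp.basisSingleOne

/-- The root vector attached to `x`, which is zero if `x` is not a root. -/
noncomputable def vec (x : Lattice) : Model :=
  if h : form x x = 2 then basis (.inr ⟨x, h⟩) else 0

/-- The embedding of the lattice into the Cartan subalgebra. -/
noncomputable def cart (x : Lattice) : Model := ∑ i, (x i : ℂ) • basis (.inl i)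

theorem basis_inr (α : Root) : basis (.inr α) = vec α.1 := by
  rw [vec, dif_pos α.2]; rfl

theorem vec_of_ne {x : Lattice} (h : form x x ≠ 2) : vec x = 0 := dif_neg h

theorem cart_add (x y : Lattice) : cart (x + y) = cart x + cart y := by
  simp [cart, add_smul, Finset.sum_add_distrib]

theorem cart_neg (x : Lattice) : cart (-x) = -cart x := by simp [cart]

theorem cart_zero : cart 0 = 0 := by simp [cart]

theorem cart_single (i : Fin 8) : cart (Pi.single i 1) = basis (.inl i) := by
  simp [cart, Pi.single_apply]

/-- The bracket of two root vectors, zero if one of the arguments is not a root. -/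
noncomputable def vecBracket (x y : Lattice) : Model :=
  (sgn x y : ℂ) • if x + y = 0 then cart x else vec (x + y)

/-- The bracket of two basis vectors. -/
noncomputable def basisBracket : Idx → Idx → Model
  | .inl _, .inl _ => 0
  | .inl i, .inr β => (form (Pi.single i 1) β.1 : ℂ) • vec β.1
  | .inr α, .inl i => -(form (Pi.single i 1) α.1 : ℂ) • vec α.1
  | .inr α, .inr β => vecBracket α.1 β.1

/-- The bilinear bracket. -/
noncomputable def bracketHom : Model →ₗ[ℂ] Model →ₗ[ℂ] Model :=
  basis.constr ℂ fun a ↦ basis.constr ℂ fun b ↦ basisBracket a b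

theorem bracketHom_basis (a b : Idx) : bracketHom (basis a) (basis b) = basisBracket a b := by
  simp [bracketHom]

theorem form_eq_sum (x y : Lattice) : form x y = ∑ i, x i * form (Pi.single i 1) y := by
  simp [Fin.sum_univ_eight, form, cocycle, Pi.single_apply]
  ring

theorem bracketHom_cart_cart (x y : Lattice) : bracketHom (cart x) (cart y) = 0 := by
  simp [cart, bracketHom_basis, basisBracket]

theorem bracketHom_cart_vec (x y : Lattice) :
    bracketHom (cart x) (vec y) = (form x y : ℂ) • vec y := by
  by_cases h : form y y = 2
  · have := basis_inr ⟨y, h⟩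
    simp only at this
    rw [← this, cart, form_eq_sum x y]
    simp only [map_sum, map_smul, LinearMap.sum_apply, LinearMap.smul_apply, bracketHom_basis,
      basisBracket]
    push_cast
    rw [this, Finset.sum_smul]
    simp [mul_smul]
  · simp [vec_of_ne h]

theorem bracketHom_vec_cart (x y : Lattice) :
    bracketHom (vec y) (cart x) = -(form x y : ℂ) • vec y := by
  by_cases h : form y y = 2
  · have := basis_inr ⟨y, h⟩
    simp only at this
    rw [← this, cart, form_eq_sum x y]
    simp only [map_sum, map_smul, bracketHom_basis, basisBracket]
    push_cast
    rw [this, neg_smul, Finset.sum_smul, ← Finset.sum_neg_distrib]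
    simp [mul_smul]
  · simp [vec_of_ne h]

theorem bracketHom_vec_vec (α β : Root) :
    bracketHom (vec α.1) (vec β.1) = vecBracket α.1 β.1 := by
  rw [← basis_inr, ← basis_inr, bracketHom_basis, basisBracket]

theorem vecBracket_neg (α : Root) : bracketHom (vec α.1) (vec (-α.1)) = - cart α.1 := by
  rw [← Root.neg_val, bracketHom_vec_vec, vecBracket, Root.neg_val, if_pos (add_neg_cancel _),
    sgn_neg_right, sgn_self]
  simp

theorem bracketHom_of_form_eq_neg_one {α β : Root} (h : form α.1 β.1 = -1) :
    bracketHom (vec α.1) (vec β.1) = (sgn α.1 β.1 : ℂ) • vec (α.1 + β.1) := by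
  rw [bracketHom_vec_vec, vecBracket, if_neg]
  intro h0
  have := (form_add_self_eq_two_iff α β).mpr h
  rw [h0, form_zero_right] at this
  omega

theorem bracketHom_of_form_nonneg {α β : Root} (h : 0 ≤ form α.1 β.1) :
    bracketHom (vec α.1) (vec β.1) = 0 := by
  rw [bracketHom_vec_vec, vecBracket, if_neg, vec_of_ne, smul_zero]
  · rw [Ne, form_add_self_eq_two_iff]; omega
  · intro h0
    rw [add_eq_zero_iff_eq_neg.mp h0, form_neg_left, β.2] at h
    omega

theorem basis_inl (i : Fin 8) : basis (.inl i) = cart (Pi.single i 1) := (cart_single i).symm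

/-- To prove a property of all vectors of the model closed under linear combinations, it suffices
to check Cartan elements and root vectors. -/
theorem induction {p : Model → Prop} (x : Model) (hc : ∀ v, p (cart v))
    (hv : ∀ α : Root, p (vec α.1)) (h0 : p 0) (hadd : ∀ x y, p x → p y → p (x + y))
    (hsmul : ∀ (c : ℂ) x, p x → p (c • x)) : p x := by
  have : x ∈ Submodule.span ℂ (Set.range basis) := by rw [basis.span_eq]; trivial
  induction this using Submodule.span_induction with
  | mem x hx =>
    obtain ⟨i | α, rfl⟩ := hx
    · rw [basis_inl]; exact hc _
    · rw [basis_inr]; exact hv _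
  | zero => exact h0
  | add x y _ _ hx hy => exact hadd x y hx hy
  | smul c x _ hx => exact hsmul c x hx

theorem bracketHom_skew (x y : Model) : bracketHom x y = -bracketHom y x := by
  refine induction (p := fun x ↦ bracketHom x y = -bracketHom y x) x
    (fun v ↦ ?_) (fun α ↦ ?_) (by simp) (fun x x' h h' ↦ ?_) fun c x h ↦ ?_
  · refine induction (p := fun y ↦ bracketHom (cart v) y = -bracketHom y (cart v)) y
      (fun w ↦ ?_) (fun β ↦ ?_) (by simp) (fun x x' h h' ↦ ?_) fun c x h ↦ ?_
    · simp [bracketHom_cart_cart]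
    · simp [bracketHom_cart_vec, bracketHom_vec_cart]
    · rw [map_add, map_add, LinearMap.add_apply, h, h', neg_add]
    · rw [map_smul, map_smul, LinearMap.smul_apply, h, smul_neg]
  · refine induction (p := fun y ↦ bracketHom (vec α.1) y = -bracketHom y (vec α.1)) y
      (fun w ↦ ?_) (fun β ↦ ?_) (by simp) (fun x x' h h' ↦ ?_) fun c x h ↦ ?_
    · simp [bracketHom_cart_vec, bracketHom_vec_cart]
    · have h1 := neg_two_le_form α β
      obtain h | h | h : form α.1 β.1 = -2 ∨ form α.1 β.1 = -1 ∨ 0 ≤ form α.1 β.1 := by omega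
      · have h' := add_eq_zero_of_form_eq_neg_two h
        have hβ : β.1 = -α.1 := (neg_eq_of_add_eq_zero_right h').symm
        have hα : α.1 = -β.1 := by rw [hβ, neg_neg]
        have e1 := vecBracket_neg α
        have e2 := vecBracket_neg β
        rw [← hβ] at e1
        rw [← hα] at e2
        rw [e1, e2, hβ, cart_neg, neg_neg]
      · rw [bracketHom_of_form_eq_neg_one h,
          bracketHom_of_form_eq_neg_one ((form_comm _ _).trans h),
          sgn_comm_of_odd (x := α.1) (by omega), add_comm β.1]
        simp
      · rw [bracketHom_of_form_nonneg h, bracketHom_of_form_nonneg (h.trans_eq (form_comm _ _)),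
          neg_zero]
    · rw [map_add, map_add, LinearMap.add_apply, h, h', neg_add]
    · rw [map_smul, map_smul, LinearMap.smul_apply, h, smul_neg]
  · rw [map_add, map_add, LinearMap.add_apply, h, h', neg_add]
  · rw [map_smul, map_smul, LinearMap.smul_apply, h, smul_neg]

/-- The cyclic sum whose vanishing is the Jacobi identity. -/
noncomputable def jac (x y z : Model) : Model :=
  bracketHom x (bracketHom y z) + bracketHom y (bracketHom z x) + bracketHom z (bracketHom x y)

theorem jac_cycle (x y z : Model) : jac x y z = jac y z x := by
  simp only [jac]; abel

theorem jac_skew (x y z : Model) : jac x y z = -jac x z y := by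
  simp only [jac]
  rw [bracketHom_skew z y, bracketHom_skew x z, bracketHom_skew y x]
  simp only [map_neg]
  abel

theorem jac_cart_cart_cart (x y z : Lattice) : jac (cart x) (cart y) (cart z) = 0 := by
  simp [jac, bracketHom_cart_cart]

theorem jac_cart_cart_vec (x y z : Lattice) : jac (cart x) (cart y) (vec z) = 0 := by
  simp only [jac, bracketHom_cart_cart, bracketHom_cart_vec, bracketHom_vec_cart, map_smul, map_zero,
    neg_smul, map_neg, smul_smul]
  module

theorem jac_cart_vec_vec (x : Lattice) (α β : Root) : jac (cart x) (vec α.1) (vec β.1) = 0 := by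
  rw [jac, bracketHom_vec_cart, bracketHom_cart_vec, map_smul, map_smul,
    bracketHom_skew (vec β.1), bracketHom_vec_vec, vecBracket, map_smul]
  split_ifs with h
  · rw [bracketHom_cart_cart, eq_neg_of_add_eq_zero_left h, form_neg_right]
    push_cast
    module
  · rw [bracketHom_cart_vec, form_add_right]
    push_cast
    module

theorem jac_vec_of_form_eq_neg_two {α β γ : Root} (h : form β.1 γ.1 = -2) :
    jac (vec α.1) (vec β.1) (vec γ.1) = 0 := by
  have hγ : γ = -β := Subtype.ext (neg_eq_of_add_eq_zero_right (add_eq_zero_of_form_eq_neg_two h)).symm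
  subst hγ
  rw [jac, Root.neg_val, vecBracket_neg, map_neg, bracketHom_vec_cart, form_comm]
  have h1 := neg_two_le_form α β
  have h2 := form_le_two α β
  have h3 : form (-β).1 α.1 = - form α.1 β.1 := by rw [Root.neg_val, form_neg_left, form_comm]
  obtain h | h | h | h | h : form α.1 β.1 = -2 ∨ form α.1 β.1 = -1 ∨ form α.1 β.1 = 0 ∨
    form α.1 β.1 = 1 ∨ form α.1 β.1 = 2 := by omega
  · have hα : β = -α :=
      Subtype.ext (neg_eq_of_add_eq_zero_right (add_eq_zero_of_form_eq_neg_two h)).symm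
    subst hα
    rw [h, Root.neg_val, vecBracket_neg, neg_neg, bracketHom_of_form_nonneg (by rw [α.2]; decide)]
    simp only [map_neg, map_zero, bracketHom_vec_cart, α.2]
    push_cast
    module
  · have h4 : form (α.1 + β.1) (α.1 + β.1) = 2 := (form_add_self_eq_two_iff α β).mpr h
    have h5 : form (-β).1 (α.1 + β.1) = -1 := by
      rw [form_add_right, h3, Root.neg_val, form_neg_left, β.2, h]; rfl
    rw [h, bracketHom_of_form_eq_neg_one h, ← Root.neg_val,
      bracketHom_of_form_nonneg (α := -β) (by rw [h3, h]; decide), map_smul,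
      bracketHom_of_form_eq_neg_one (α := -β) (β := ⟨_, h4⟩) h5]
    have h6 : sgn β.1 α.1 = -sgn α.1 β.1 := sgn_comm_of_odd (by omega)
    have h7 := sgn_mul_self α.1 β.1
    have h8 : sgn α.1 β.1 * sgn (-β).1 (α.1 + β.1) = 1 := by
      rw [Root.neg_val, sgn_neg_left, sgn_add_right, sgn_self, h6]; linarith
    have h8' : (sgn α.1 β.1 : ℂ) * sgn (-β).1 (α.1 + β.1) = 1 := by exact_mod_cast h8
    have h9 : (-β).1 + (α.1 + β.1) = α.1 := by rw [Root.neg_val]; abel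
    simp only [smul_smul, h8', h9, map_zero]
    push_cast
    module
  · rw [h, bracketHom_of_form_nonneg h.ge, ← Root.neg_val,
      bracketHom_of_form_nonneg (α := -β) (by rw [h3, h]; decide)]
    simp
  · have h5 : form (-β).1 α.1 = -1 := by rw [h3, h]
    have h4 : form ((-β).1 + α.1) ((-β).1 + α.1) = 2 := (form_add_self_eq_two_iff (-β) α).mpr h5
    have h10 : form β.1 ((-β).1 + α.1) = -1 := by
      rw [form_add_right, Root.neg_val, form_neg_right, β.2, form_comm, h]; rfl
    rw [h, bracketHom_of_form_nonneg (α := α) (β := β) (by rw [h]; decide), ← Root.neg_val,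
      bracketHom_of_form_eq_neg_one h5, map_smul,
      bracketHom_of_form_eq_neg_one (α := β) (β := ⟨_, h4⟩) h10]
    have h7 := sgn_mul_self β.1 α.1
    have h8 : sgn (-β).1 α.1 * sgn β.1 ((-β).1 + α.1) = -1 := by
      rw [Root.neg_val, sgn_neg_left, sgn_add_right, sgn_neg_right, sgn_self]; linarith
    have h8' : (sgn (-β).1 α.1 : ℂ) * sgn β.1 ((-β).1 + α.1) = -1 := by exact_mod_cast h8
    have h9 : β.1 + ((-β).1 + α.1) = α.1 := by rw [Root.neg_val]; abel
    simp only [smul_smul, h8', h9, map_zero]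
    push_cast
    module
  · have hα : α = β := Subtype.ext (eq_of_form_eq_two h)
    subst hα
    rw [h, bracketHom_skew (vec (-α.1)), vecBracket_neg,
      bracketHom_of_form_nonneg (by rw [α.2]; decide)]
    simp only [map_neg, map_zero, bracketHom_vec_cart, α.2]
    push_cast
    module

/-- The double bracket of root vectors when no two of them are opposite. -/
theorem bracketHom_bracketHom_vec {α β γ : Root} (hbc : -1 ≤ form β.1 γ.1) :
    bracketHom (vec α.1) (bracketHom (vec β.1) (vec γ.1)) =
      if form β.1 γ.1 = -1 then ((sgn α.1 β.1 * sgn α.1 γ.1 * sgn β.1 γ.1 : ℤ) : ℂ) •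
        (if form α.1 β.1 + form α.1 γ.1 = -2 then cart α.1 else vec (α.1 + β.1 + γ.1)) else 0 := by
  split_ifs with h h'
  · have h4 : form (β.1 + γ.1) (β.1 + γ.1) = 2 := (form_add_self_eq_two_iff β γ).mpr h
    have h5 : form α.1 (β.1 + γ.1) = -2 := by rw [form_add_right, h']
    rw [bracketHom_of_form_eq_neg_one h, map_smul, bracketHom_vec_vec α ⟨_, h4⟩, vecBracket,
      if_pos (add_eq_zero_of_form_eq_neg_two (β := ⟨_, h4⟩) h5)]
    simp only [sgn_add_right, smul_smul]
    push_cast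
    module
  · have h4 : form (β.1 + γ.1) (β.1 + γ.1) = 2 := (form_add_self_eq_two_iff β γ).mpr h
    have h5 : α.1 + (β.1 + γ.1) ≠ 0 := fun h0 ↦ h' (by
      rw [← form_add_right, ← neg_eq_of_add_eq_zero_right h0, form_neg_right, α.2])
    rw [bracketHom_of_form_eq_neg_one h, map_smul, bracketHom_vec_vec α ⟨_, h4⟩, vecBracket,
      if_neg h5, add_assoc]
    simp only [sgn_add_right, smul_smul]
    push_cast
    module
  · rw [bracketHom_of_form_nonneg (by omega), map_zero]

theorem jac_vec_vec_vec (α β γ : Root) : jac (vec α.1) (vec β.1) (vec γ.1) = 0 := by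
  by_cases hbc : form β.1 γ.1 = -2
  · exact jac_vec_of_form_eq_neg_two hbc
  by_cases hab : form α.1 β.1 = -2
  · rw [← jac_cycle]; exact jac_vec_of_form_eq_neg_two hab
  by_cases hac : form γ.1 α.1 = -2
  · rw [jac_cycle]; exact jac_vec_of_form_eq_neg_two hac
  have h1 := neg_two_le_form β γ
  have h2 := neg_two_le_form α β
  have h3 := neg_two_le_form γ α
  have eab := form_comm α.1 β.1
  have ebc := form_comm β.1 γ.1
  have eac := form_comm γ.1 α.1
  rw [jac, bracketHom_bracketHom_vec (by omega),
    bracketHom_bracketHom_vec (by omega),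
    bracketHom_bracketHom_vec (by omega),
    ← eab, ← eac, ← ebc]
  have s1 : β.1 + γ.1 + α.1 = α.1 + β.1 + γ.1 := by abel
  have s2 : γ.1 + α.1 + β.1 = α.1 + β.1 + γ.1 := by abel
  have hn : form (α.1 + β.1 + γ.1) (α.1 + β.1 + γ.1) =
      6 + 2 * (form α.1 β.1 + form β.1 γ.1 + form γ.1 α.1) := by
    simp only [form_add_left, form_add_right, α.2, β.2, γ.2, ← eab, ← ebc, ← eac]; ring
  rw [s1, s2]
  by_cases hs : form α.1 β.1 + form β.1 γ.1 + form γ.1 α.1 = -2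
  · obtain ⟨a, b, c⟩ | ⟨a, b, c⟩ | ⟨a, b, c⟩ :
      (form α.1 β.1 = -1 ∧ form β.1 γ.1 = -1 ∧ form γ.1 α.1 = 0) ∨
      (form α.1 β.1 = -1 ∧ form β.1 γ.1 = 0 ∧ form γ.1 α.1 = -1) ∨
      (form α.1 β.1 = 0 ∧ form β.1 γ.1 = -1 ∧ form γ.1 α.1 = -1) := by omega
    · have e1 : sgn β.1 α.1 = - sgn α.1 β.1 := sgn_comm_of_odd (by omega)
      have e2 : sgn γ.1 β.1 = - sgn β.1 γ.1 := sgn_comm_of_odd (by omega)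
      have e3 : sgn α.1 γ.1 = sgn γ.1 α.1 := sgn_comm_of_even (by omega)
      simp only [a, b, c, e1, e2, e3]
      norm_num
      module
    · have e1 : sgn β.1 α.1 = - sgn α.1 β.1 := sgn_comm_of_odd (by omega)
      have e2 : sgn γ.1 β.1 = sgn β.1 γ.1 := sgn_comm_of_even (by omega)
      have e3 : sgn α.1 γ.1 = - sgn γ.1 α.1 := sgn_comm_of_odd (by omega)
      simp only [a, b, c, e1, e2, e3]
      norm_num
      module
    · have e1 : sgn β.1 α.1 = sgn α.1 β.1 := sgn_comm_of_even (by omega)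
      have e2 : sgn γ.1 β.1 = - sgn β.1 γ.1 := sgn_comm_of_odd (by omega)
      have e3 : sgn α.1 γ.1 = - sgn γ.1 α.1 := sgn_comm_of_odd (by omega)
      simp only [a, b, c, e1, e2, e3]
      norm_num
      module
  by_cases hs' : form α.1 β.1 + form β.1 γ.1 + form γ.1 α.1 = -3
  · obtain ⟨a, b, c⟩ : form α.1 β.1 = -1 ∧ form β.1 γ.1 = -1 ∧ form γ.1 α.1 = -1 := by omega
    have e1 : sgn β.1 α.1 = - sgn α.1 β.1 := sgn_comm_of_odd (by omega)
    have e2 : sgn γ.1 β.1 = - sgn β.1 γ.1 := sgn_comm_of_odd (by omega)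
    have e3 : sgn α.1 γ.1 = - sgn γ.1 α.1 := sgn_comm_of_odd (by omega)
    have h0 : cart (α.1 + β.1 + γ.1) = 0 := by
      rw [eq_zero_of_form_self_eq_zero (x := α.1 + β.1 + γ.1) (by omega), cart_zero]
    rw [cart_add, cart_add] at h0
    have h0' : cart γ.1 = -(cart α.1 + cart β.1) := (neg_eq_of_add_eq_zero_right h0).symm
    simp only [a, b, c, e1, e2, e3, h0']
    norm_num
    module
  · rw [vec_of_ne (by omega)]
    have : ∀ (p q : Prop) [Decidable p] [Decidable q] (r : ℂ) (x : Model), ¬(p ∧ q) →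
        (if p then r • (if q then x else 0) else 0) = 0 := by
      intro p q _ _ r x h; split_ifs <;> simp_all
    rw [this _ _ _ _ (by omega), this _ _ _ _ (by omega), this _ _ _ _ (by omega)]
    simp

theorem jac_add (x x' y z : Model) : jac (x + x') y z = jac x y z + jac x' y z := by
  simp only [jac, map_add, LinearMap.add_apply]; abel

theorem jac_smul (c : ℂ) (x y z : Model) : jac (c • x) y z = c • jac x y z := by
  simp only [jac, map_smul, LinearMap.smul_apply, smul_add]

theorem jac_zero (y z : Model) : jac 0 y z = 0 := by
  simp [jac]

theorem jac_eq_zero (x y z : Model) : jac x y z = 0 := by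
  have key (x y z : Model) (hc : ∀ v, jac (cart v) y z = 0)
      (hv : ∀ α : Root, jac (vec α.1) y z = 0) :
      jac x y z = 0 :=
    induction (p := fun x ↦ jac x y z = 0) x hc hv (jac_zero y z)
      (fun _ _ h h' ↦ by rw [jac_add, h, h', add_zero])
      fun c _ h ↦ by rw [jac_smul, h, smul_zero]
  have cc (x y z) : jac (cart x) (cart y) z = 0 := by
    rw [← jac_cycle]
    refine key z _ _ (fun v ↦ jac_cart_cart_cart ..) fun α ↦ ?_
    rw [jac_cycle]; exact jac_cart_cart_vec ..
  have cv (x α y) : jac (cart x) (vec (α : Root).1) y = 0 := by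
    rw [← jac_cycle]
    refine key y _ _ (fun v ↦ ?_) fun β ↦ ?_
    · rw [jac_cycle, jac_skew, ← jac_cycle, ← jac_cycle, jac_cycle, jac_cycle, cc, neg_zero] 
    · rw [jac_cycle]; exact jac_cart_vec_vec ..
  have c (x y z) : jac (cart x) y z = 0 := by
    rw [jac_cycle]
    refine key y _ _ (fun v ↦ ?_) fun β ↦ ?_
    · rw [← jac_cycle]; exact cc ..
    · rw [← jac_cycle]; exact cv ..
  refine key x _ _ (fun v ↦ c ..) fun α ↦ ?_
  rw [jac_cycle]
  refine key y _ _ (fun v ↦ c ..) fun β ↦ ?_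
  rw [jac_cycle]
  refine key z _ _ (fun v ↦ c ..) fun γ ↦ ?_
  exact jac_vec_vec_vec γ α β

noncomputable instance : LieRing Model where
  bracket x y := bracketHom x y
  add_lie x y z := by
    change bracketHom _ _ = bracketHom _ _ + bracketHom _ _
    rw [map_add, LinearMap.add_apply]
  lie_add x y z := map_add (bracketHom x) y z
  lie_self x := by
    change bracketHom x x = 0
    have h : (2 : ℂ) • bracketHom x x = 0 := by
      rw [two_smul, eq_neg_iff_add_eq_zero.mp (bracketHom_skew x x)]
    exact (smul_eq_zero.mp h).resolve_left two_ne_zero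
  leibniz_lie x y z := by
    change bracketHom _ (bracketHom _ _) = bracketHom (bracketHom _ _) _ + bracketHom _ (bracketHom _ _)
    have := jac_eq_zero x y z
    rw [jac, bracketHom_skew z x, bracketHom_skew z, map_neg, add_assoc, ← neg_add] at this
    rw [add_neg_eq_zero.mp this, add_comm]

noncomputable instance : LieAlgebra ℂ Model where
  lie_smul c x y := map_smul (bracketHom x) c y

end Model

end E8

namespace E8

/-- The simple roots. -/
def simple (i : Fin 8) : Root := ⟨Pi.single i 1, by revert i; decide +kernel⟩

theorem simple_val (i : Fin 8) : (simple i).1 = Pi.single i 1 := rfl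

theorem form_self_eq_sum (x : Lattice) : form x x = ∑ i, x i * form (simple i).1 x :=
  Model.form_eq_sum x x

theorem nonneg_or_nonpos (α : Root) : 0 ≤ α.1 ∨ 0 ≤ -α.1 := by
  by_contra! H
  have hx (x : Lattice) (h : ¬ 0 ≤ x) : 2 ≤ form (-x ⊔ 0) (-x ⊔ 0) := by
    have h0 : -x ⊔ 0 ≠ 0 := fun h0 ↦ h (by simpa using (h0 ▸ le_sup_left : -x ≤ 0))
    have := form_self_pos h0
    have := form_self (-x ⊔ 0)
    omega
  have h1 := hx _ H.1
  have h2 := hx _ H.2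
  rw [neg_neg] at h2
  have h3 : form (α.1 ⊔ 0) (-α.1 ⊔ 0) ≤ 0 := by
    have hp (i) : 0 ≤ (α.1 ⊔ 0) i := by simp
    have hn (i) : 0 ≤ (-α.1 ⊔ 0) i := by simp
    have hz (i) : (α.1 ⊔ 0) i * (-α.1 ⊔ 0) i = 0 := by
      rcases le_total (α.1 i) 0 with h | h <;> simp [h]
    generalize α.1 ⊔ 0 = p at *
    generalize -α.1 ⊔ 0 = n at *
    have hm (i j) : 0 ≤ p i * n j := mul_nonneg (hp i) (hn j)
    simp only [form, cocycle]
    linarith [hz 0, hz 1, hz 2, hz 3, hz 4, hz 5, hz 6, hz 7, hm 0 2, hm 2 0, hm 2 3, hm 3 2, hm 1 3,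
      hm 3 1, hm 3 4, hm 4 3, hm 4 5, hm 5 4, hm 5 6, hm 6 5, hm 6 7, hm 7 6]
  have h4 : α.1 = (α.1 ⊔ 0) - (-α.1 ⊔ 0) := by
    funext i
    rcases le_total (α.1 i) 0 with h | h <;> simp [h]
  have h5 := α.2
  rw [h4, form_sub_left, form_sub_right, form_sub_right, form_comm (-α.1 ⊔ 0) (α.1 ⊔ 0)] at h5
  omega

theorem exists_add_simple {α : Root} (h : 0 ≤ α.1) (hs : ∀ i, α ≠ simple i) :
    ∃ (β : Root) (i : Fin 8), 0 ≤ β.1 ∧ form β.1 (simple i).1 = -1 ∧ α.1 = β.1 + (simple i).1 := by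
  obtain ⟨i, hi⟩ : ∃ i, 0 < form (simple i).1 α.1 := by
    by_contra! H
    have := form_self_eq_sum α.1
    have h0 : ∑ i, α.1 i * form (simple i).1 α.1 ≤ 0 :=
      Finset.sum_nonpos fun i _ ↦ mul_nonpos_of_nonneg_of_nonpos (h i) (H i)
    rw [α.2] at this
    omega
  have h1 := form_le_two (simple i) α
  have h2 : form (simple i).1 α.1 = 1 := by
    by_contra h3
    exact hs i (Subtype.ext (eq_of_form_eq_two (α := simple i) (β := α) (by omega)).symm)
  have h3 : form (α.1 - (simple i).1) (α.1 - (simple i).1) = 2 := by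
    rw [form_sub_left, form_sub_right, form_sub_right, α.2, (simple i).2, form_comm α.1, h2]; rfl
  refine ⟨⟨_, h3⟩, i, ?_, ?_, (sub_add_cancel _ _).symm⟩
  · refine (nonneg_or_nonpos ⟨_, h3⟩).resolve_right fun h4 ↦ ?_
    have h5 (j) (hj : j ≠ i) : α.1 j = 0 := by
      have e1 := h4 j
      have e2 := h j
      simp only [Pi.zero_apply, Pi.neg_apply, Pi.sub_apply, simple_val, Pi.single_apply, if_neg hj]
        at e1 e2
      omega
    have e3 := h4 i
    have e4 := h i
    simp only [Pi.zero_apply, Pi.neg_apply, Pi.sub_apply, simple_val, Pi.single_apply, if_true]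
      at e3 e4
    have h6 : α.1 = Pi.single i (α.1 i) := by
      funext j
      by_cases hj : j = i
      · subst hj; simp
      · rw [h5 j hj]; simp [hj]
    obtain h7 | h7 : α.1 i = 0 ∨ α.1 i = 1 := by omega
    · have := α.2
      rw [h6, h7, Pi.single_zero, form_zero_right] at this
      omega
    · exact hs i (Subtype.ext (by rw [h6, h7, simple_val]))
  · change form (α.1 - (simple i).1) (simple i).1 = -1
    rw [form_sub_left, form_comm, h2, (simple i).2]; rfl

theorem sum_add_simple (x : Lattice) (i : Fin 8) : ∑ j, (x + (simple i).1) j = ∑ j, x j + 1 := by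
  simp [simple_val, Finset.sum_add_distrib]

/-- Induction on positive roots along simple roots. -/
theorem positive_induction {p : Root → Prop} (hs : ∀ i, p (simple i))
    (hadd : ∀ (α β : Root) (i : Fin 8), 0 ≤ β.1 → form β.1 (simple i).1 = -1 →
      α.1 = β.1 + (simple i).1 → p β → p α) (α : Root) (h : 0 ≤ α.1) : p α := by
  obtain ⟨n, hn⟩ : ∃ n : ℕ, ∑ j, α.1 j = n :=
    Int.eq_ofNat_of_zero_le (Finset.sum_nonneg fun j _ ↦ h j)
  induction n generalizing α with
  | zero =>
    by_cases H : ∃ i, α = simple i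
    · obtain ⟨i, rfl⟩ := H; exact hs i
    obtain ⟨β, i, hβ, hf, e⟩ := exists_add_simple h (by simpa using H)
    rw [e, sum_add_simple] at hn
    have : 0 ≤ ∑ j, β.1 j := Finset.sum_nonneg fun j _ ↦ hβ j
    omega
  | succ n ih =>
    by_cases H : ∃ i, α = simple i
    · obtain ⟨i, rfl⟩ := H; exact hs i
    obtain ⟨β, i, hβ, hf, e⟩ := exists_add_simple h (by simpa using H)
    rw [e, sum_add_simple] at hn
    exact hadd α β i hβ hf e (ih β hβ (by push_cast at hn; omega))

/-- The coordinates of the positive roots. -/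
def posTable : List (List ℕ) := [
  [0, 0, 0, 0, 0, 0, 0, 1], [0, 0, 0, 0, 0, 0, 1, 0], [0, 0, 0, 0, 0, 1, 0, 0],
  [0, 0, 0, 0, 1, 0, 0, 0], [0, 0, 0, 1, 0, 0, 0, 0], [0, 0, 1, 0, 0, 0, 0, 0],
  [0, 1, 0, 0, 0, 0, 0, 0], [1, 0, 0, 0, 0, 0, 0, 0], [0, 0, 0, 0, 0, 0, 1, 1],
  [0, 0, 0, 0, 0, 1, 1, 0], [0, 0, 0, 0, 1, 1, 0, 0], [0, 0, 0, 1, 1, 0, 0, 0],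
  [0, 0, 1, 1, 0, 0, 0, 0], [0, 1, 0, 1, 0, 0, 0, 0], [1, 0, 1, 0, 0, 0, 0, 0],
  [0, 0, 0, 0, 0, 1, 1, 1], [0, 0, 0, 0, 1, 1, 1, 0], [0, 0, 0, 1, 1, 1, 0, 0],
  [0, 0, 1, 1, 1, 0, 0, 0], [0, 1, 0, 1, 1, 0, 0, 0], [0, 1, 1, 1, 0, 0, 0, 0],
  [1, 0, 1, 1, 0, 0, 0, 0], [0, 0, 0, 0, 1, 1, 1, 1], [0, 0, 0, 1, 1, 1, 1, 0],
  [0, 0, 1, 1, 1, 1, 0, 0], [0, 1, 0, 1, 1, 1, 0, 0], [0, 1, 1, 1, 1, 0, 0, 0],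
  [1, 0, 1, 1, 1, 0, 0, 0], [1, 1, 1, 1, 0, 0, 0, 0], [0, 0, 0, 1, 1, 1, 1, 1],
  [0, 0, 1, 1, 1, 1, 1, 0], [0, 1, 0, 1, 1, 1, 1, 0], [0, 1, 1, 1, 1, 1, 0, 0],
  [0, 1, 1, 2, 1, 0, 0, 0], [1, 0, 1, 1, 1, 1, 0, 0], [1, 1, 1, 1, 1, 0, 0, 0],
  [0, 0, 1, 1, 1, 1, 1, 1], [0, 1, 0, 1, 1, 1, 1, 1], [0, 1, 1, 1, 1, 1, 1, 0],
  [0, 1, 1, 2, 1, 1, 0, 0], [1, 0, 1, 1, 1, 1, 1, 0], [1, 1, 1, 1, 1, 1, 0, 0],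
  [1, 1, 1, 2, 1, 0, 0, 0], [0, 1, 1, 1, 1, 1, 1, 1], [0, 1, 1, 2, 1, 1, 1, 0],
  [0, 1, 1, 2, 2, 1, 0, 0], [1, 0, 1, 1, 1, 1, 1, 1], [1, 1, 1, 1, 1, 1, 1, 0],
  [1, 1, 1, 2, 1, 1, 0, 0], [1, 1, 2, 2, 1, 0, 0, 0], [0, 1, 1, 2, 1, 1, 1, 1],
  [0, 1, 1, 2, 2, 1, 1, 0], [1, 1, 1, 1, 1, 1, 1, 1], [1, 1, 1, 2, 1, 1, 1, 0],
  [1, 1, 1, 2, 2, 1, 0, 0], [1, 1, 2, 2, 1, 1, 0, 0], [0, 1, 1, 2, 2, 1, 1, 1],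
  [0, 1, 1, 2, 2, 2, 1, 0], [1, 1, 1, 2, 1, 1, 1, 1], [1, 1, 1, 2, 2, 1, 1, 0],
  [1, 1, 2, 2, 1, 1, 1, 0], [1, 1, 2, 2, 2, 1, 0, 0], [0, 1, 1, 2, 2, 2, 1, 1],
  [1, 1, 1, 2, 2, 1, 1, 1], [1, 1, 1, 2, 2, 2, 1, 0], [1, 1, 2, 2, 1, 1, 1, 1],
  [1, 1, 2, 2, 2, 1, 1, 0], [1, 1, 2, 3, 2, 1, 0, 0], [0, 1, 1, 2, 2, 2, 2, 1],
  [1, 1, 1, 2, 2, 2, 1, 1], [1, 1, 2, 2, 2, 1, 1, 1], [1, 1, 2, 2, 2, 2, 1, 0],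
  [1, 1, 2, 3, 2, 1, 1, 0], [1, 2, 2, 3, 2, 1, 0, 0], [1, 1, 1, 2, 2, 2, 2, 1],
  [1, 1, 2, 2, 2, 2, 1, 1], [1, 1, 2, 3, 2, 1, 1, 1], [1, 1, 2, 3, 2, 2, 1, 0],
  [1, 2, 2, 3, 2, 1, 1, 0], [1, 1, 2, 2, 2, 2, 2, 1], [1, 1, 2, 3, 2, 2, 1, 1],
  [1, 1, 2, 3, 3, 2, 1, 0], [1, 2, 2, 3, 2, 1, 1, 1], [1, 2, 2, 3, 2, 2, 1, 0],
  [1, 1, 2, 3, 2, 2, 2, 1], [1, 1, 2, 3, 3, 2, 1, 1], [1, 2, 2, 3, 2, 2, 1, 1],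
  [1, 2, 2, 3, 3, 2, 1, 0], [1, 1, 2, 3, 3, 2, 2, 1], [1, 2, 2, 3, 2, 2, 2, 1],
  [1, 2, 2, 3, 3, 2, 1, 1], [1, 2, 2, 4, 3, 2, 1, 0], [1, 1, 2, 3, 3, 3, 2, 1],
  [1, 2, 2, 3, 3, 2, 2, 1], [1, 2, 2, 4, 3, 2, 1, 1], [1, 2, 3, 4, 3, 2, 1, 0],
  [1, 2, 2, 3, 3, 3, 2, 1], [1, 2, 2, 4, 3, 2, 2, 1], [1, 2, 3, 4, 3, 2, 1, 1],
  [2, 2, 3, 4, 3, 2, 1, 0], [1, 2, 2, 4, 3, 3, 2, 1], [1, 2, 3, 4, 3, 2, 2, 1],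
  [2, 2, 3, 4, 3, 2, 1, 1], [1, 2, 2, 4, 4, 3, 2, 1], [1, 2, 3, 4, 3, 3, 2, 1],
  [2, 2, 3, 4, 3, 2, 2, 1], [1, 2, 3, 4, 4, 3, 2, 1], [2, 2, 3, 4, 3, 3, 2, 1],
  [1, 2, 3, 5, 4, 3, 2, 1], [2, 2, 3, 4, 4, 3, 2, 1], [1, 3, 3, 5, 4, 3, 2, 1],
  [2, 2, 3, 5, 4, 3, 2, 1], [2, 2, 4, 5, 4, 3, 2, 1], [2, 3, 3, 5, 4, 3, 2, 1],
  [2, 3, 4, 5, 4, 3, 2, 1], [2, 3, 4, 6, 4, 3, 2, 1], [2, 3, 4, 6, 5, 3, 2, 1],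
  [2, 3, 4, 6, 5, 4, 2, 1], [2, 3, 4, 6, 5, 4, 3, 1], [2, 3, 4, 6, 5, 4, 3, 2]]

/-- The lattice vector with the given coordinates. -/
def ofCoords (l : List ℤ) : Lattice := fun i ↦ l.getD i 0

/-- The positive roots as lattice vectors. -/
def posList : List Lattice := posTable.map fun l ↦ ofCoords (l.map (Nat.cast : ℕ → ℤ))

theorem posTable_nodup : posTable.Nodup := by decide +kernel

theorem posTable_spec : ∀ l ∈ posTable, l.length = 8 ∧
    form (ofCoords (l.map (Nat.cast : ℕ → ℤ))) (ofCoords (l.map (Nat.cast : ℕ → ℤ))) = 2 := by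
  decide +kernel

theorem posTable_closed : ∀ l ∈ posTable, ∀ i : Fin 8,
    form (ofCoords (l.map (Nat.cast : ℕ → ℤ))) (simple i).1 = -1 →
      l.set i (l.getD i 0 + 1) ∈ posTable := by
  decide +kernel

theorem posTable_simple : ∀ i : Fin 8, (List.replicate 8 0).set i 1 ∈ posTable := by
  decide +kernel

theorem ofCoords_set (l : List ℕ) (h : l.length = 8) (i : Fin 8) :
    ofCoords ((l.set i (l.getD i 0 + 1)).map (Nat.cast : ℕ → ℤ)) =
      ofCoords (l.map (Nat.cast : ℕ → ℤ)) + (simple i).1 := by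
  obtain ⟨a, b, c, d, e, f, g, k, rfl⟩ : ∃ a b c d e f g k, l = [a, b, c, d, e, f, g, k] := by
    match l, h with
    | [a, b, c, d, e, f, g, k], _ => exact ⟨a, b, c, d, e, f, g, k, rfl⟩
  funext j
  fin_cases i <;> fin_cases j <;> simp [ofCoords, simple_val]

theorem mem_posList {α : Root} (h : 0 ≤ α.1) : α.1 ∈ posList := by
  refine positive_induction (p := fun α ↦ α.1 ∈ posList) (fun i ↦ ?_) (fun α β i _ hf e ih ↦ ?_) α h
  · refine List.mem_map.mpr ⟨_, posTable_simple i, ?_⟩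
    have := ofCoords_set (List.replicate 8 0) rfl i
    rw [show (List.replicate 8 0).getD i 0 + 1 = 1 by fin_cases i <;> rfl] at this
    rw [this]
    funext j
    fin_cases j <;> simp [ofCoords]
  · obtain ⟨l, hl, hβ⟩ := List.mem_map.mp ih
    refine List.mem_map.mpr ⟨_, posTable_closed l hl i (by rw [hβ]; exact hf), ?_⟩
    rw [ofCoords_set _ (posTable_spec l hl).1, hβ, e]

theorem posList_nodup : posList.Nodup := by
  refine List.Nodup.map_on (fun l hl m hm h ↦ ?_) posTable_nodup
  have h1 := (posTable_spec l hl).1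
  have h2 := (posTable_spec m hm).1
  refine List.ext_getElem (h1.trans h2.symm) fun n hn hn' ↦ ?_
  have := congrFun h ⟨n, by omega⟩
  simpa [ofCoords, List.getElem?_map, hn, hn'] using this

theorem form_self_of_mem_posList {x : Lattice} (h : x ∈ posList) : form x x = 2 := by
  obtain ⟨l, hl, rfl⟩ := List.mem_map.mp h
  exact (posTable_spec l hl).2

theorem nonneg_of_mem_posList {x : Lattice} (h : x ∈ posList) : 0 ≤ x := by
  obtain ⟨l, hl, rfl⟩ := List.mem_map.mp h
  intro i
  simp only [Pi.zero_apply, ofCoords]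
  rcases lt_or_ge i.1 l.length with h | h <;> simp [h]

instance : Finite Root := by
  have : Finite {x : Lattice // x ∈ posList ++ posList.map (-·)} :=
    (posList ++ posList.map (-·)).finite_toSet
  refine Finite.of_injective (β := {x : Lattice // x ∈ posList ++ posList.map (-·)})
    (fun α ↦ ⟨α.1, ?_⟩) fun α β h ↦ Subtype.ext (Subtype.ext_iff.mp h :)
  rw [List.mem_append]
  refine (nonneg_or_nonpos α).imp mem_posList fun h ↦ ?_
  exact List.mem_map.mpr ⟨-α.1, mem_posList (α := -α) h, neg_neg _⟩

instance : Module.Finite ℂ Model := Module.Finite.of_basis Model.basis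

end E8

namespace E8

open LieAlgebra

/-- A family of elements of a Lie algebra satisfying the Serre relations of type `E₈`. -/
structure IsSerreFamily {S : Type*} [LieRing S] [LieAlgebra ℂ S] (H E F : Fin 8 → S) : Prop where
  lie_h_h : ∀ i j, ⁅H i, H j⁆ = 0
  lie_e_f_same : ∀ i, ⁅E i, F i⁆ = H i
  lie_e_f_ne : ∀ i j, i ≠ j → ⁅E i, F j⁆ = 0
  lie_h_e : ∀ i j, ⁅H i, E j⁆ = (form (simple i).1 (simple j).1 : ℂ) • E j
  lie_h_f : ∀ i j, ⁅H i, F j⁆ = -(form (simple i).1 (simple j).1 : ℂ) • F j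
  ad_e_nilpotent : ∀ i j, ∃ n, (ad ℂ S (E i) ^ n) (E j) = 0
  ad_f_nilpotent : ∀ i j, ∃ n, (ad ℂ S (F i) ^ n) (F j) = 0

/-- The right-normed brackets of the given generators, with their weights. -/
inductive IsWord {S : Type*} [LieRing S] (E : Fin 8 → S) : Lattice → S → Prop
  | of (i : Fin 8) : IsWord E (simple i).1 (E i)
  | lie (i : Fin 8) {μ : Lattice} {x : S} : IsWord E μ x → IsWord E (μ + (simple i).1) ⁅E i, x⁆

variable {S : Type*} [LieRing S] {H E F : Fin 8 → S}

namespace IsWord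

theorem nonneg {μ : Lattice} {x : S} (hx : IsWord E μ x) : 0 ≤ μ := by
  have hs (i : Fin 8) : 0 ≤ (simple i).1 := fun j ↦ by
    simp only [simple_val, Pi.single_apply]; split_ifs <;> simp
  induction hx with
  | of i => exact hs i
  | lie i _ ih => exact add_nonneg ih (hs i)

theorem one_le_sum {μ : Lattice} {x : S} (hx : IsWord E μ x) : 1 ≤ ∑ j, μ j := by
  induction hx with
  | of i => simp [simple_val]
  | lie i _ ih => rw [sum_add_simple]; omega

theorem ne_zero {μ : Lattice} {x : S} (hx : IsWord E μ x) : μ ≠ 0 := by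
  rintro rfl
  simpa using hx.one_le_sum

theorem eq_of_sum_eq_one {μ : Lattice} {x : S} (hx : IsWord E μ x) (h : ∑ j, μ j = 1) :
    ∃ k, μ = (simple k).1 ∧ x = E k := by
  cases hx with
  | of i => exact ⟨i, rfl, rfl⟩
  | lie i hx => rw [sum_add_simple] at h; have := hx.one_le_sum; omega

end IsWord

variable [LieAlgebra ℂ S]

/-- The span of the words of a given weight. -/
def wordSpan (E : Fin 8 → S) (μ : Lattice) : Submodule ℂ S := Submodule.span ℂ {x | IsWord E μ x}

theorem lie_mem_wordSpan (i : Fin 8) {μ : Lattice} {x : S} (hx : x ∈ wordSpan E μ) :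
    ⁅E i, x⁆ ∈ wordSpan E (μ + (simple i).1) := by
  induction hx using Submodule.span_induction with
  | mem x hx => exact Submodule.subset_span (.lie i hx)
  | zero => simp
  | add x y _ _ h h' => rw [lie_add]; exact add_mem h h'
  | smul c x _ h => rw [lie_smul]; exact Submodule.smul_mem _ _ h

namespace IsSerreFamily

theorem symm (h : IsSerreFamily H E F) : IsSerreFamily (-H) F E where
  lie_h_h i j := by simp [h.lie_h_h]
  lie_e_f_same i := by rw [← lie_skew, h.lie_e_f_same]; rfl
  lie_e_f_ne i j hij := by rw [← lie_skew, h.lie_e_f_ne j i hij.symm, neg_zero]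
  lie_h_e i j := by simp [h.lie_h_f]
  lie_h_f i j := by simp [h.lie_h_e]
  ad_e_nilpotent := h.ad_f_nilpotent
  ad_f_nilpotent := h.ad_e_nilpotent

theorem lie_h_word (h : IsSerreFamily H E F) (i : Fin 8) {μ : Lattice} {x : S}
    (hx : IsWord E μ x) : ⁅H i, x⁆ = (form (simple i).1 μ : ℂ) • x := by
  induction hx with
  | of j => exact h.lie_h_e i j
  | lie j _ ih =>
    rw [leibniz_lie, ih, h.lie_h_e, form_add_right, smul_lie, lie_smul]
    push_cast
    module

theorem lie_h_wordSpan (h : IsSerreFamily H E F) (i : Fin 8) {μ : Lattice} {x : S}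
    (hx : x ∈ wordSpan E μ) : ⁅H i, x⁆ = (form (simple i).1 μ : ℂ) • x := by
  induction hx using Submodule.span_induction with
  | mem x hx => exact h.lie_h_word i hx
  | zero => simp
  | add x y _ _ h h' => rw [lie_add, h, h', smul_add]
  | smul c x _ h => rw [lie_smul, h, smul_comm]

theorem lie_f_e (h : IsSerreFamily H E F) (i j : Fin 8) :
    ⁅F j, E i⁆ = if i = j then -H i else 0 := by
  rw [← lie_skew]
  split_ifs with hij
  · rw [hij, h.lie_e_f_same]
  · rw [h.lie_e_f_ne i j hij, neg_zero]

theorem lie_f_word (h : IsSerreFamily H E F) (j : Fin 8) {μ : Lattice} {x : S}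
    (hx : IsWord E μ x) :
    (∃ k, x = E k ∧ μ = (simple k).1) ∨ ⁅F j, x⁆ ∈ wordSpan E (μ - (simple j).1) := by
  induction hx with
  | of i => exact .inl ⟨i, rfl, rfl⟩
  | @lie i μ x hx ih =>
    right
    rw [leibniz_lie, h.lie_f_e]
    refine add_mem ?_ ?_
    · split_ifs with hij
      · rw [neg_lie, h.lie_h_word i hx, ← hij, add_sub_cancel_right]
        exact neg_mem (Submodule.smul_mem _ _ (Submodule.subset_span hx))
      · simp
    · obtain ⟨k, rfl, rfl⟩ | ih := ih
      · rw [h.lie_f_e]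
        split_ifs with hkj
        · rw [lie_neg, ← lie_skew, neg_neg, h.lie_h_e, ← hkj, add_sub_cancel_left]
          exact Submodule.smul_mem _ _ (Submodule.subset_span (.of i))
        · simp
      · rw [add_sub_right_comm]
        exact lie_mem_wordSpan i ih

theorem lie_f_wordSpan (h : IsSerreFamily H E F) (j : Fin 8) {μ : Lattice} {x : S}
    (hμ : ∑ k, μ k ≠ 1) (hx : x ∈ wordSpan E μ) : ⁅F j, x⁆ ∈ wordSpan E (μ - (simple j).1) := by
  induction hx using Submodule.span_induction with
  | mem x hx =>
    refine (h.lie_f_word j hx).resolve_left ?_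
    rintro ⟨k, -, rfl⟩
    exact hμ (by simp [simple_val])
  | zero => simp
  | add x y _ _ h h' => rw [lie_add]; exact add_mem h h'
  | smul c x _ h => rw [lie_smul]; exact Submodule.smul_mem _ _ h

/-- The generators span, under brackets, the whole algebra. -/
def Generates (H E F : Fin 8 → S) : Prop :=
  LieSubalgebra.lieSpan ℂ S (Set.range H ∪ Set.range E ∪ Set.range F) = ⊤

theorem Generates.symm (h : Generates H E F) : Generates (-H) F E := by
  rw [Generates, eq_top_iff, ← h, LieSubalgebra.lieSpan_le]
  rintro _ ((⟨i, rfl⟩ | ⟨i, rfl⟩) | ⟨i, rfl⟩)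
  · rw [← neg_neg (H i)]
    exact neg_mem (LieSubalgebra.subset_lieSpan (.inl (.inl ⟨i, rfl⟩)))
  · exact LieSubalgebra.subset_lieSpan (.inr ⟨i, rfl⟩)
  · exact LieSubalgebra.subset_lieSpan (.inl (.inr ⟨i, rfl⟩))

theorem exists_ad_e_pow_eq_zero (h : IsSerreFamily H E F) (hg : Generates H E F) (i : Fin 8)
    (x : S) :
    ∃ n, (ad ℂ S (E i) ^ n) x = 0 := by
  have hx : x ∈ LieSubalgebra.engel ℂ (E i) := by
    have : LieSubalgebra.engel ℂ (E i) = ⊤ := by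
      rw [eq_top_iff, ← hg, LieSubalgebra.lieSpan_le]
      have hH (j) : (ad ℂ S (E i) ^ 2) (H j) = 0 := by
        rw [pow_two, Module.End.mul_apply, ad_apply, ad_apply, ← lie_skew (E i) (H j), h.lie_h_e]
        simp
      rintro _ ((⟨j, rfl⟩ | ⟨j, rfl⟩) | ⟨j, rfl⟩) <;>
        rw [SetLike.mem_coe, LieSubalgebra.mem_engel_iff]
      · exact ⟨2, hH j⟩
      · exact h.ad_e_nilpotent i j
      · refine ⟨3, ?_⟩
        rw [pow_succ, Module.End.mul_apply, ad_apply]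
        by_cases hij : i = j
        · rw [← hij, h.lie_e_f_same, hH]
        · rw [h.lie_e_f_ne i j hij, map_zero]
    rw [this]; trivial
  exact (LieSubalgebra.mem_engel_iff _ _ _).mp hx

theorem eq_zero_of_lie_f_eq_zero (h : IsSerreFamily H E F) (hg : Generates H E F) (i : Fin 8)
    {x : S} {m : ℤ} (hm : 0 < m) (hx : ⁅H i, x⁆ = (m : ℂ) • x) (hf : ⁅F i, x⁆ = 0) : x = 0 := by
  by_contra hx0
  have hE : ⁅H i, E i⁆ = (2 : ℂ) • E i := by rw [h.lie_h_e, (simple i).2]; norm_num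
  have hF : ⁅H i, F i⁆ = -((2 : ℂ) • F i) := by rw [h.lie_h_f, (simple i).2]; norm_num
  have hH : H i ≠ 0 := fun h0 ↦ hx0 (by
    rw [h0, zero_lie] at hx
    exact (smul_eq_zero.mp hx.symm).resolve_left (by exact_mod_cast hm.ne'))
  have t : IsSl2Triple (-H i) (F i) (E i) :=
    IsSl2Triple.symm ⟨hH, h.lie_e_f_same i, by rw [hE, two_smul, two_smul],
      by rw [hF, two_smul, two_smul]⟩
  have P : t.HasPrimitiveVectorWith x (-m : ℂ) := ⟨hx0, by rw [neg_lie, hx, neg_smul], hf⟩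
  obtain ⟨n, hn⟩ := h.exists_ad_e_pow_eq_zero hg i x
  induction n with
  | zero => exact hx0 (by simpa using hn)
  | succ n ih =>
    have := P.lie_e_pow_succ_toEnd_f n
    change ⁅F i, (ad ℂ S (E i) ^ (n + 1)) x⁆ = _ • (ad ℂ S (E i) ^ n) x at this
    rw [hn, lie_zero] at this
    refine ih ((smul_eq_zero.mp this.symm).resolve_left ?_)
    have h1 : ((n : ℤ) + 1) * (-m - n) ≠ 0 := mul_ne_zero (by omega) (by omega)
    exact_mod_cast h1

theorem eq_zero_of_mem_wordSpan (h : IsSerreFamily H E F) (hg : Generates H E F)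
    {T : Type*} [LieRing T] [LieAlgebra ℂ T] (φ : S →ₗ⁅ℂ⁆ T) (hφ : ∀ i, φ (E i) ≠ 0)
    {μ : Lattice} {x : S} (hx : x ∈ wordSpan E μ) (hφx : φ x = 0) : x = 0 := by
  by_cases hw : ∃ y, IsWord E μ y
  swap
  · have : {y | IsWord E μ y} = ∅ := by
      ext y; simpa using fun hy ↦ hw ⟨y, hy⟩
    rw [wordSpan, this, Submodule.span_empty] at hx
    exact hx
  obtain ⟨y, hy⟩ := hw
  have hnn := hy.nonneg
  have hne := hy.ne_zero
  obtain ⟨n, hn⟩ : ∃ n : ℕ, ∑ j, μ j = n + 1 :=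
    ⟨(∑ j, μ j - 1).toNat, by have := hy.one_le_sum; omega⟩
  clear hy
  induction n generalizing μ x y with
  | zero =>
    have hn : ∑ j, μ j = 1 := by simpa using hn
    by_cases hk : ∃ k, μ = (simple k).1
    · obtain ⟨k, rfl⟩ := hk
      have hx' : x ∈ Submodule.span ℂ {E k} := by
        refine Submodule.span_mono ?_ hx
        intro z hz
        obtain ⟨j, hj, rfl⟩ := IsWord.eq_of_sum_eq_one hz hn
        have : k = j := by
          by_contra hkj
          have := congrFun hj k
          simp [simple_val, hkj] at this
        rw [this]; rfl
      obtain ⟨c, rfl⟩ := Submodule.mem_span_singleton.mp hx'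
      rw [map_smul] at hφx
      rw [(smul_eq_zero.mp hφx).resolve_right (hφ k), zero_smul]
    · have : {y | IsWord E μ y} = ∅ := by
        ext y
        simp only [Set.mem_ofPred_eq, Set.mem_empty_iff_false, iff_false]
        intro hy
        obtain ⟨k, hk', -⟩ := hy.eq_of_sum_eq_one hn
        exact hk ⟨k, hk'⟩
      rw [wordSpan, this, Submodule.span_empty] at hx
      exact hx
  | succ n ih =>
    have hF (j) : ⁅F j, x⁆ = 0 := by
      have hm := h.lie_f_wordSpan j (by omega) hx
      by_cases hw : ∃ y, IsWord E (μ - (simple j).1) y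
      · obtain ⟨z, hz⟩ := hw
        have e := sum_add_simple (μ - (simple j).1) j
        rw [sub_add_cancel] at e
        exact ih hm (by rw [LieHom.map_lie, hφx, lie_zero]) z hz.nonneg hz.ne_zero (by
          push_cast at hn; omega)
      · have : {y | IsWord E (μ - (simple j).1) y} = ∅ := by
          ext y; simpa using fun hy ↦ hw ⟨y, hy⟩
        rw [wordSpan, this, Submodule.span_empty] at hm
        exact hm
    obtain ⟨i, hi⟩ : ∃ i, 0 < form (simple i).1 μ := by
      by_contra! H
      have := form_self_eq_sum μ
      have h0 : ∑ i, μ i * form (simple i).1 μ ≤ 0 :=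
        Finset.sum_nonpos fun i _ ↦ mul_nonpos_of_nonneg_of_nonpos (hnn i) (H i)
      have := form_self_pos hne
      omega
    exact h.eq_zero_of_lie_f_eq_zero hg i hi (h.lie_h_wordSpan i hx) (hF i)

/-- The weight spaces of the algebra as spans of words. -/
def homogeneous (H E F : Fin 8 → S) (μ : Lattice) : Submodule ℂ S :=
  Submodule.span ℂ {x | (μ = 0 ∧ x ∈ Set.range H) ∨ IsWord E μ x ∨ IsWord F (-μ) x}

theorem homogeneous_symm (μ : Lattice) :
    homogeneous (-H) F E (-μ) = homogeneous H E F μ := by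
  have key (H E F : Fin 8 → S) (μ : Lattice) :
      homogeneous (-H) F E (-μ) ≤ homogeneous H E F μ := by
    refine Submodule.span_le.mpr ?_
    rintro x (⟨h0, i, rfl⟩ | hx | hx)
    · exact neg_mem (Submodule.subset_span (.inl ⟨neg_eq_zero.mp h0, i, rfl⟩))
    · exact Submodule.subset_span (.inr (.inr hx))
    · exact Submodule.subset_span (.inr (.inl (by simpa using hx)))
  refine le_antisymm (key ..) ?_
  have := key (-H) F E (-μ)
  simpa using this

theorem lie_e_homogeneous (h : IsSerreFamily H E F) (i : Fin 8) {μ : Lattice} {x : S}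
    (hx : x ∈ homogeneous H E F μ) : ⁅E i, x⁆ ∈ ⨆ ν, homogeneous H E F ν := by
  induction hx using Submodule.span_induction with
  | mem x hx =>
    obtain ⟨-, j, rfl⟩ | hx | hx := hx
    · rw [← lie_skew, h.lie_h_e]
      exact neg_mem (Submodule.smul_mem _ _ (Submodule.mem_iSup_of_mem (simple i).1
        (Submodule.subset_span (.inr (.inl (.of i))))))
    · exact Submodule.mem_iSup_of_mem _ (Submodule.subset_span (.inr (.inl (.lie i hx))))
    · obtain ⟨k, rfl, -⟩ | hx := h.symm.lie_f_word i hx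
      · by_cases hik : i = k
        · rw [hik, h.lie_e_f_same]
          exact Submodule.mem_iSup_of_mem 0 (Submodule.subset_span (.inl ⟨rfl, k, rfl⟩))
        · rw [h.lie_e_f_ne i k hik]
          exact zero_mem _
      · refine Submodule.mem_iSup_of_mem (μ + (simple i).1) (Submodule.span_mono ?_ hx)
        intro y hy
        refine .inr (.inr ?_)
        rwa [neg_add, ← sub_eq_add_neg]
  | zero => simp
  | add x y _ _ h h' => rw [lie_add]; exact add_mem h h'
  | smul c x _ h => rw [lie_smul]; exact Submodule.smul_mem _ _ h

theorem lie_h_homogeneous (h : IsSerreFamily H E F) (i : Fin 8) {μ : Lattice} {x : S}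
    (hx : x ∈ homogeneous H E F μ) : ⁅H i, x⁆ ∈ ⨆ ν, homogeneous H E F ν := by
  induction hx using Submodule.span_induction with
  | mem x hx =>
    obtain ⟨-, j, rfl⟩ | hx' | hx' := hx
    · rw [h.lie_h_h]; exact zero_mem _
    · rw [h.lie_h_word i hx']
      exact Submodule.smul_mem _ _ (Submodule.mem_iSup_of_mem μ
        (Submodule.subset_span (.inr (.inl hx'))))
    · have := h.symm.lie_h_word i hx'
      rw [Pi.neg_apply, neg_lie, neg_eq_iff_eq_neg] at this
      rw [this]
      exact neg_mem (Submodule.smul_mem _ _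
        (Submodule.mem_iSup_of_mem μ (Submodule.subset_span (.inr (.inr hx')))))
  | zero => simp
  | add x y _ _ h h' => rw [lie_add]; exact add_mem h h'
  | smul c x _ h => rw [lie_smul]; exact Submodule.smul_mem _ _ h

theorem iSup_homogeneous_symm :
    ⨆ ν, homogeneous (-H) F E ν = ⨆ ν, homogeneous H E F ν := by
  simp only [← homogeneous_symm (H := H) (E := E) (F := F)]
  exact ((Equiv.neg Lattice).iSup_comp (g := fun ν ↦ homogeneous (-H) F E ν)).symm

theorem lie_mem_iSup {ι : Type*} {p : ι → Submodule ℂ S} {y : S}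
    (h : ∀ i, ∀ x ∈ p i, ⁅y, x⁆ ∈ ⨆ j, p j) : ∀ x ∈ ⨆ j, p j, ⁅y, x⁆ ∈ ⨆ j, p j :=
  fun _ hx ↦ (iSup_le h : _ ≤ (⨆ j, p j).comap (ad ℂ S y)) hx

theorem iSup_homogeneous (h : IsSerreFamily H E F) (hg : Generates H E F) :
    ⨆ ν, homogeneous H E F ν = ⊤ := by
  have hE (i : Fin 8) : ∀ x ∈ ⨆ ν, homogeneous H E F ν, ⁅E i, x⁆ ∈ ⨆ ν, homogeneous H E F ν := by
    exact lie_mem_iSup fun ν x hx ↦ h.lie_e_homogeneous i hx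
  have hH (i : Fin 8) : ∀ x ∈ ⨆ ν, homogeneous H E F ν, ⁅H i, x⁆ ∈ ⨆ ν, homogeneous H E F ν := by
    exact lie_mem_iSup fun ν x hx ↦ h.lie_h_homogeneous i hx
  have hF (i : Fin 8) : ∀ x ∈ ⨆ ν, homogeneous H E F ν, ⁅F i, x⁆ ∈ ⨆ ν, homogeneous H E F ν := by
    rw [← iSup_homogeneous_symm]
    exact lie_mem_iSup fun ν x hx ↦ h.symm.lie_e_homogeneous i hx
  have hall (y : S) : ∀ x ∈ ⨆ ν, homogeneous H E F ν, ⁅y, x⁆ ∈ ⨆ ν, homogeneous H E F ν := by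
    have hy : y ∈ LieSubalgebra.lieSpan ℂ S (Set.range H ∪ Set.range E ∪ Set.range F) := by
      rw [hg]; trivial
    induction hy using LieSubalgebra.lieSpan_induction with
    | mem y hy =>
      obtain (⟨i, rfl⟩ | ⟨i, rfl⟩) | ⟨i, rfl⟩ := hy
      exacts [hH i, hE i, hF i]
    | zero => intro x _; rw [zero_lie]; exact zero_mem _
    | add y z _ _ h h' => intro x hx; rw [add_lie]; exact add_mem (h x hx) (h' x hx)
    | smul c y _ h => intro x hx; rw [smul_lie]; exact Submodule.smul_mem _ _ (h x hx)
    | lie y z _ _ h h' => intro x hx; rw [lie_lie]; exact sub_mem (h _ (h' x hx)) (h' _ (h x hx))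
  rw [eq_top_iff]
  intro y _
  have hy : y ∈ LieSubalgebra.lieSpan ℂ S (Set.range H ∪ Set.range E ∪ Set.range F) := by
    rw [hg]; trivial
  induction hy using LieSubalgebra.lieSpan_induction with
  | mem y hy =>
    obtain (⟨i, rfl⟩ | ⟨i, rfl⟩) | ⟨i, rfl⟩ := hy
    · exact Submodule.mem_iSup_of_mem 0 (Submodule.subset_span (.inl ⟨rfl, i, rfl⟩))
    · exact Submodule.mem_iSup_of_mem (simple i).1 (Submodule.subset_span (.inr (.inl (.of i))))
    · refine Submodule.mem_iSup_of_mem (-(simple i).1) (Submodule.subset_span (.inr (.inr ?_)))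
      rw [neg_neg]
      exact .of i
  | zero => exact zero_mem _
  | add y z _ _ h h' => exact add_mem (h trivial) (h' trivial)
  | smul c y _ h => exact Submodule.smul_mem _ _ (h trivial)
  | lie y z _ _ h h' => exact hall y z (h' trivial)

end IsSerreFamily

end E8

namespace E8

open LieAlgebra

namespace IsSerreFamily

variable {S : Type*} [LieRing S] [LieAlgebra ℂ S] {H E F : Fin 8 → S}

theorem lie_h_of_mem_homogeneous (h : IsSerreFamily H E F) (i : Fin 8) {μ : Lattice} {x : S}
    (hx : x ∈ homogeneous H E F μ) : ⁅H i, x⁆ = (form (simple i).1 μ : ℂ) • x := by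
  induction hx using Submodule.span_induction with
  | mem x hx =>
    obtain ⟨rfl, j, rfl⟩ | hx | hx := hx
    · rw [h.lie_h_h, form_zero_right]; simp
    · exact h.lie_h_word i hx
    · have := h.symm.lie_h_word i hx
      rwa [Pi.neg_apply, neg_lie, form_neg_right, Int.cast_neg, neg_smul, neg_inj] at this
  | zero => simp
  | add x y _ _ h h' => rw [lie_add, h, h', smul_add]
  | smul c x _ h => rw [lie_smul, h, smul_comm]

theorem homogeneous_le_wordSpan {μ : Lattice} (hμ : μ ≠ 0) (h : 0 ≤ μ) :
    homogeneous H E F μ ≤ wordSpan E μ := by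
  refine Submodule.span_mono ?_
  rintro x (⟨h0, -⟩ | hx | hx)
  · exact absurd h0 hμ
  · exact hx
  · exact absurd (le_antisymm (neg_nonneg.mp hx.nonneg) h) hμ

theorem homogeneous_le_wordSpan_neg {μ : Lattice} (h : ¬ 0 ≤ μ) :
    homogeneous H E F μ ≤ wordSpan F (-μ) := by
  refine Submodule.span_mono ?_
  rintro x (⟨rfl, -⟩ | hx | hx)
  · exact absurd le_rfl h
  · exact absurd hx.nonneg h
  · exact hx

theorem homogeneous_zero_le : homogeneous H E F 0 ≤ Submodule.span ℂ (Set.range H) := by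
  refine Submodule.span_mono ?_
  rintro x (⟨-, hx⟩ | hx | hx)
  · exact hx
  · exact absurd rfl hx.ne_zero
  · exact absurd neg_zero hx.ne_zero

end IsSerreFamily

theorem eq_of_form_simple_eq {μ ν : Lattice}
    (h : ∀ i, form (simple i).1 μ = form (simple i).1 ν) : μ = ν := by
  rw [← sub_eq_zero]
  apply eq_zero_of_form_self_eq_zero
  rw [form_self_eq_sum]
  exact Finset.sum_eq_zero fun i _ ↦ by rw [form_sub_right, h, sub_self, mul_zero]

open IsSerreFamily in
/-- A Lie algebra generated by a Serre family embeds in every Lie algebra in which the images of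
the `H i` are linearly independent. -/
theorem IsSerreFamily.injective {S T : Type*} [LieRing S] [LieAlgebra ℂ S]
    [LieRing T] [LieAlgebra ℂ T] {H E F : Fin 8 → S} (h : IsSerreFamily H E F)
    (hg : Generates H E F) (φ : S →ₗ⁅ℂ⁆ T) (hH : LinearIndependent ℂ fun i ↦ φ (H i))
    (hE : ∀ i, φ (E i) ≠ 0) (hF : ∀ i, φ (F i) ≠ 0) : Function.Injective φ := by
  rw [injective_iff_map_eq_zero]
  intro x hx
  obtain ⟨f, rfl⟩ : ∃ f : Π₀ ν, homogeneous H E F ν,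
      DFinsupp.lsum ℕ (fun ν ↦ (homogeneous H E F ν).subtype) f = x := by
    have : x ∈ ⨆ ν, homogeneous H E F ν := by rw [iSup_homogeneous h hg]; trivial
    exact (Submodule.mem_iSup_iff_exists_dfinsupp _ _).mp this
  let χ (μ : Lattice) (i : Fin 8) : ℂ := (form (simple i).1 μ : ℂ)
  let W (μ : Lattice) : Submodule ℂ T :=
    ⨅ i, Module.End.maxGenEigenspace (ad ℂ T (φ (H i))) (χ μ i)
  have hcomm (i j : Fin 8) : Commute (ad ℂ T (φ (H i))) (ad ℂ T (φ (H j))) := by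
    refine LinearMap.ext fun x ↦ ?_
    simp only [Module.End.mul_apply, ad_apply]
    rw [leibniz_lie, ← LieHom.map_lie, h.lie_h_h, map_zero, zero_lie, zero_add]
  have hind : iSupIndep W := by
    have := Module.End.independent_iInf_maxGenEigenspace_of_forall_mapsTo
      (fun i ↦ ad ℂ T (φ (H i)))
      (fun i j c ↦ Module.End.mapsTo_maxGenEigenspace_of_comm (hcomm j i) c)
    refine this.comp (f := χ) fun μ ν hμν ↦ eq_of_form_simple_eq fun i ↦ ?_
    exact Int.cast_injective (α := ℂ) (congrFun hμν i)
  have hW (μ : Lattice) (y : homogeneous H E F μ) : φ y ∈ W μ := by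
    refine Submodule.mem_iInf _ |>.mpr fun i ↦ ?_
    refine Module.End.eigenspace_le_maxGenEigenspace ?_
    rw [Module.End.mem_eigenspace_iff, ad_apply, ← LieHom.map_lie,
      h.lie_h_of_mem_homogeneous i y.2, map_smul]
  let g : Π₀ ν, W ν := f.mapRange (fun ν (y : homogeneous H E F ν) ↦ (⟨φ y.1, hW ν y⟩ : W ν))
    (fun ν ↦ by ext; simp)
  have hg0 : g = 0 := by
    apply hind.dfinsupp_lsum_injective
    rw [map_zero, ← hx]
    classical
    rw [DFinsupp.lsum_apply_apply, DFinsupp.lsum_apply_apply, DFinsupp.sumAddHom_apply,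
      DFinsupp.sumAddHom_apply, DFinsupp.sum_mapRange_index (fun ν ↦ map_zero _), DFinsupp.sum,
      DFinsupp.sum, map_sum]
    rfl
  have hf0 : f = 0 := by
    ext ν
    have hφ : φ (f ν) = 0 := congrArg Subtype.val (DFunLike.congr_fun hg0 ν)
    by_cases h0 : ν = 0
    · subst h0
      have hm := homogeneous_zero_le (f 0).2
      obtain ⟨c, hc⟩ := (Submodule.mem_span_range_iff_exists_fun ℂ).mp hm
      rw [← hc] at hφ ⊢
      rw [map_sum] at hφ
      simp only [map_smul] at hφ
      have := Fintype.linearIndependent_iff.mp hH c hφ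
      simp [this]
    by_cases hν : 0 ≤ ν
    · exact h.eq_zero_of_mem_wordSpan hg φ hE (homogeneous_le_wordSpan h0 hν (f ν).2) hφ
    · exact h.symm.eq_zero_of_mem_wordSpan hg.symm φ hF (homogeneous_le_wordSpan_neg hν (f ν).2) hφ
  rw [hf0, map_zero]

namespace Model

theorem vec_ne_zero (α : Root) : vec α.1 ≠ 0 := by rw [← basis_inr]; exact basis.ne_zero _

theorem lie_cart_cart (x y : Lattice) : ⁅cart x, cart y⁆ = 0 := bracketHom_cart_cart x y

theorem lie_cart_vec (x y : Lattice) : ⁅cart x, vec y⁆ = (form x y : ℂ) • vec y :=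
  bracketHom_cart_vec x y

theorem lie_vec_neg (α : Root) : ⁅vec α.1, vec (-α.1)⁆ = -cart α.1 := vecBracket_neg α

theorem lie_of_form_eq_neg_one {α β : Root} (h : form α.1 β.1 = -1) :
    ⁅vec α.1, vec β.1⁆ = (sgn α.1 β.1 : ℂ) • vec (α.1 + β.1) := bracketHom_of_form_eq_neg_one h

theorem lie_of_form_nonneg {α β : Root} (h : 0 ≤ form α.1 β.1) : ⁅vec α.1, vec β.1⁆ = 0 :=
  bracketHom_of_form_nonneg h

/-- `(ad e_α) ^ (1 - (α, β)) e_β = 0` for roots `α`, `β` with `(α, β) ≥ -1`. -/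
theorem ad_pow_lie {α β : Root} (h : -1 ≤ form α.1 β.1) :
    (ad ℂ Model (vec α.1) ^ (-form α.1 β.1).toNat) ⁅vec α.1, vec β.1⁆ = 0 := by
  by_cases h' : 0 ≤ form α.1 β.1
  · rw [lie_of_form_nonneg h', map_zero]
  have h1 : form α.1 β.1 = -1 := by omega
  have h2 := (form_add_self_eq_two_iff α β).mpr h1
  rw [lie_of_form_eq_neg_one h1, h1, map_smul]
  have := lie_of_form_nonneg (α := α) (β := ⟨α.1 + β.1, h2⟩)
    (by rw [form_add_right, α.2, h1]; norm_num)
  simp [this]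

theorem form_simple (i j : Fin 8) : form (simple i).1 (simple j).1 = CartanMatrix.E₈ i j := by
  revert i j
  have : ∀ i j : Fin 8, form (Pi.single i 1) (Pi.single j 1) =
      ![![2,  0, -1,  0,  0,  0,  0,  0], ![0,  2,  0, -1,  0,  0,  0,  0],
        ![-1,  0,  2, -1,  0,  0,  0,  0], ![0, -1, -1,  2, -1,  0,  0,  0],
        ![0,  0,  0, -1,  2, -1,  0,  0], ![0,  0,  0,  0, -1,  2, -1,  0],
        ![0,  0,  0,  0,  0, -1,  2, -1], ![0,  0,  0,  0,  0,  0, -1,  2]] i j := by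
    decide +kernel
  exact this

theorem neg_one_le_form_simple {i j : Fin 8} (h : i ≠ j) :
    form (simple i).1 (simple j).1 ≤ 0 ∧ -1 ≤ form (simple i).1 (simple j).1 := by
  revert i j; decide +kernel

theorem ad_pow_lie_simple (i j : Fin 8) :
    (ad ℂ Model (vec (simple i).1) ^ (-form (simple i).1 (simple j).1).toNat)
      ⁅vec (simple i).1, vec (simple j).1⁆ = 0 := by
  apply ad_pow_lie
  by_cases h : i = j
  · rw [h, (simple j).2]; norm_num
  · exact (neg_one_le_form_simple h).2

theorem ad_pow_lie_neg_simple (i j : Fin 8) :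
    (ad ℂ Model (-vec (-(simple i).1)) ^ (-form (simple i).1 (simple j).1).toNat)
      ⁅-vec (-(simple i).1), -vec (-(simple j).1)⁆ = 0 := by
  have := ad_pow_lie (α := -simple i) (β := -simple j) (by
    simp only [Root.neg_val, form_neg_left, form_neg_right, neg_neg]
    by_cases h : i = j
    · rw [h, (simple j).2]; norm_num
    · exact (neg_one_le_form_simple h).2)
  simp only [Root.neg_val, form_neg_left, form_neg_right, neg_neg] at this
  rw [neg_lie, lie_neg, neg_neg, map_neg, neg_pow]
  obtain h | h := neg_one_pow_eq_or (Module.End ℂ Model)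
    (-form (simple i).1 (simple j).1).toNat <;> rw [h] <;> simp [this]

theorem lie_simple_neg_simple {i j : Fin 8} (h : i ≠ j) :
    ⁅vec (simple i).1, vec (-(simple j).1)⁆ = 0 := by
  rw [← Root.neg_val]
  apply lie_of_form_nonneg
  rw [Root.neg_val, form_neg_right]
  have := neg_one_le_form_simple h
  omega

theorem generates {K : LieSubalgebra ℂ Model} (hE : ∀ i, vec (simple i).1 ∈ K)
    (hF : ∀ i, vec (-(simple i).1) ∈ K) : K = ⊤ := by
  have hpos (α : Root) (hα : 0 ≤ α.1) : vec α.1 ∈ K ∧ vec (-α.1) ∈ K := by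
    refine positive_induction (p := fun α ↦ vec α.1 ∈ K ∧ vec (-α.1) ∈ K)
      (fun i ↦ ⟨hE i, hF i⟩) ?_ α hα
    rintro α β i - hf e ⟨h1, h2⟩
    have hs : ∀ {x : Model} {n : ℤ} {y z}, y ∈ K → z ∈ K → n * n = 1 → ⁅y, z⁆ = (n : ℂ) • x →
        x ∈ K := by
      intro x n y z hy hz hn hyz
      have hn' : (n : ℂ) * n = 1 := by exact_mod_cast hn
      rw [show x = (n : ℂ) • ⁅y, z⁆ by rw [hyz, smul_smul, hn', one_smul]]
      exact K.smul_mem _ (K.lie_mem hy hz)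
    constructor
    · rw [e]
      exact hs h1 (hE i) (sgn_mul_self _ _) (lie_of_form_eq_neg_one hf)
    · have := lie_of_form_eq_neg_one (α := -β) (β := -simple i)
        (by simpa only [Root.neg_val, form_neg_left, form_neg_right, neg_neg] using hf)
      simp only [Root.neg_val] at this
      rw [e, neg_add]
      exact hs h2 (hF i) (sgn_mul_self _ _) this
  have hvec (α : Root) : vec α.1 ∈ K := by
    obtain h | h := nonneg_or_nonpos α
    · exact (hpos α h).1
    · simpa using (hpos (-α) h).2
  have hcart (i : Fin 8) : cart (simple i).1 ∈ K := by
    rw [← neg_neg (cart _), ← lie_vec_neg]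
    exact neg_mem (K.lie_mem (hE i) (hF i))
  rw [eq_top_iff]
  intro x _
  refine induction (p := (· ∈ K)) x ?_ hvec (zero_mem _) (fun _ _ ↦ add_mem)
    (fun c _ hx ↦ K.smul_mem c hx)
  intro v
  exact sum_mem fun i _ ↦ K.smul_mem _ (by rw [basis_inl]; exact hcart i)

end Model

open CartanMatrix CartanMatrix.Relations

/-- The image of a generator in the Lie algebra of type `E₈`. -/
noncomputable def gen (x : Generators (Fin 8)) : e₈ ℂ :=
  LieSubmodule.Quotient.mk (N := toIdeal ℂ CartanMatrix.E₈) (FreeLieAlgebra.of ℂ x)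

/-- The quotient map from the free Lie algebra. -/
noncomputable def proj : FreeLieAlgebra ℂ (Generators (Fin 8)) →ₗ⁅ℂ⁆ e₈ ℂ :=
  { toFun x := LieSubmodule.Quotient.mk (N := toIdeal ℂ CartanMatrix.E₈) x
    map_add' _ _ := rfl
    map_smul' _ _ := rfl
    map_lie' := rfl }

theorem proj_of (x : Generators (Fin 8)) : proj (FreeLieAlgebra.of ℂ x) = gen x := rfl

theorem proj_surjective : Function.Surjective proj := LieSubmodule.Quotient.surjective_mk' _

theorem proj_eq_zero {x : FreeLieAlgebra ℂ (Generators (Fin 8))}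
    (h : x ∈ toSet ℂ CartanMatrix.E₈) : proj x = 0 :=
  (LieSubmodule.Quotient.mk_eq_zero' (N := toIdeal ℂ CartanMatrix.E₈)).mpr (LieSubmodule.subset_lieSpan h)

theorem proj_ad_pow (n : ℕ) (x y : FreeLieAlgebra ℂ (Generators (Fin 8))) :
    proj ((ad ℂ _ x ^ n) y) = (ad ℂ _ (proj x) ^ n) (proj y) := by
  induction n with
  | zero => rfl
  | succ n ih =>
    rw [pow_succ', pow_succ', Module.End.mul_apply, Module.End.mul_apply, ad_apply, ad_apply,
      LieHom.map_lie, ih]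

theorem isSerreFamily_gen : IsSerreFamily (fun i ↦ gen (.H i)) (fun i ↦ gen (.E i))
    (fun i ↦ gen (.F i)) where
  lie_h_h i j := by
    have := proj_eq_zero (x := HH ℂ (i, j)) (by simp [toSet])
    exact this
  lie_e_f_same i := by
    have := proj_eq_zero (x := EF ℂ (i, i)) (by simp [toSet])
    simp only [EF, Function.uncurry_apply_pair, if_true] at this
    rw [map_sub, sub_eq_zero] at this
    exact this
  lie_e_f_ne i j hij := by
    have := proj_eq_zero (x := EF ℂ (i, j)) (by simp [toSet])
    simp only [EF, Function.uncurry_apply_pair, if_neg hij] at this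
    exact this
  lie_h_e i j := by
    have := proj_eq_zero (x := HE ℂ CartanMatrix.E₈ (i, j)) (by simp [toSet])
    simp only [HE, Function.uncurry_apply_pair] at this
    rw [map_sub, sub_eq_zero, map_zsmul] at this
    rw [Model.form_simple, Int.cast_smul_eq_zsmul]
    exact this
  lie_h_f i j := by
    have := proj_eq_zero (x := HF ℂ CartanMatrix.E₈ (i, j)) (by simp [toSet])
    simp only [HF, Function.uncurry_apply_pair] at this
    rw [map_add, add_eq_zero_iff_eq_neg, map_zsmul] at this
    rw [Model.form_simple, neg_smul, Int.cast_smul_eq_zsmul]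
    exact this
  ad_e_nilpotent i j := by
    have := proj_eq_zero (x := adE ℂ CartanMatrix.E₈ (i, j)) (by simp [toSet])
    simp only [adE, Function.uncurry_apply_pair] at this
    rw [proj_ad_pow, LieHom.map_lie] at this
    refine ⟨(-CartanMatrix.E₈ i j).toNat + 1, ?_⟩
    rw [pow_succ, Module.End.mul_apply]
    exact this
  ad_f_nilpotent i j := by
    have := proj_eq_zero (x := adF ℂ CartanMatrix.E₈ (i, j)) (by simp [toSet])
    simp only [adF, Function.uncurry_apply_pair] at this
    rw [proj_ad_pow, LieHom.map_lie] at this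
    refine ⟨(-CartanMatrix.E₈ i j).toNat + 1, ?_⟩
    rw [pow_succ, Module.End.mul_apply]
    exact this

theorem generates_gen : IsSerreFamily.Generates (fun i ↦ gen (.H i)) (fun i ↦ gen (.E i))
    (fun i ↦ gen (.F i)) := by
  rw [IsSerreFamily.Generates]
  set K := LieSubalgebra.lieSpan ℂ (e₈ ℂ) _ with hK
  have hgen (x) : gen x ∈ K := by
    rw [hK]
    apply LieSubalgebra.subset_lieSpan
    cases x with
    | H i => exact .inl (.inl ⟨i, rfl⟩)
    | E i => exact .inl (.inr ⟨i, rfl⟩)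
    | F i => exact .inr ⟨i, rfl⟩
  have : K.incl.comp (FreeLieAlgebra.lift ℂ fun x ↦ (⟨gen x, hgen x⟩ : K)) = proj := by
    ext x
    simp [proj_of]
  rw [eq_top_iff]
  intro y _
  obtain ⟨x, rfl⟩ := proj_surjective y
  rw [← this]
  exact SetLike.coe_mem _

/-- The images of the generators in the model. -/
noncomputable def modelGen : Generators (Fin 8) → Model
  | .H i => Model.cart (simple i).1
  | .E i => Model.vec (simple i).1
  | .F i => -Model.vec (-(simple i).1)

/-- The homomorphism from the free Lie algebra to the model. -/
noncomputable def freeHom : FreeLieAlgebra ℂ (Generators (Fin 8)) →ₗ⁅ℂ⁆ Model :=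
  FreeLieAlgebra.lift ℂ modelGen

theorem freeHom_of (x : Generators (Fin 8)) : freeHom (FreeLieAlgebra.of ℂ x) = modelGen x :=
  FreeLieAlgebra.lift_of_apply ..

theorem freeHom_ad_pow (n : ℕ) (x y : FreeLieAlgebra ℂ (Generators (Fin 8))) :
    freeHom ((ad ℂ _ x ^ n) y) = (ad ℂ _ (freeHom x) ^ n) (freeHom y) := by
  induction n with
  | zero => rfl
  | succ n ih =>
    rw [pow_succ', pow_succ', Module.End.mul_apply, Module.End.mul_apply, ad_apply, ad_apply,
      LieHom.map_lie, ih]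

theorem toIdeal_le_ker : toIdeal ℂ CartanMatrix.E₈ ≤ freeHom.ker := by
  refine LieSubmodule.lieSpan_le.mpr ?_
  have hH (i) : freeHom ((FreeLieAlgebra.of ℂ ∘ Generators.H) i) = Model.cart (simple i).1 :=
    freeHom_of _
  have hE (i) : freeHom ((FreeLieAlgebra.of ℂ ∘ Generators.E) i) = Model.vec (simple i).1 :=
    freeHom_of _
  have hF (i) : freeHom ((FreeLieAlgebra.of ℂ ∘ Generators.F) i) = -Model.vec (-(simple i).1) :=
    freeHom_of _
  rintro x (((((⟨⟨i, j⟩, rfl⟩ | ⟨⟨i, j⟩, rfl⟩) | ⟨⟨i, j⟩, rfl⟩) | ⟨⟨i, j⟩, rfl⟩) | ⟨⟨i, j⟩, rfl⟩) |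
    ⟨⟨i, j⟩, rfl⟩)
  all_goals
    simp only [HH, EF, HE, HF, adE, adF, Function.uncurry_apply_pair, SetLike.mem_coe,
      LieHom.mem_ker]
  · rw [LieHom.map_lie, hH, hH, Model.lie_cart_cart]
  · split_ifs with hij
    · subst hij
      rw [map_sub, LieHom.map_lie, hE, hF, hH, lie_neg, Model.lie_vec_neg, neg_neg, sub_self]
    · rw [LieHom.map_lie, hE, hF, lie_neg, Model.lie_simple_neg_simple hij, neg_zero]
  · rw [map_sub, map_zsmul, LieHom.map_lie, hE, hH, Model.lie_cart_vec, Model.form_simple,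
      Int.cast_smul_eq_zsmul, sub_self]
  · rw [map_add, map_zsmul, LieHom.map_lie, hF, hH, lie_neg, Model.lie_cart_vec, form_neg_right,
      Model.form_simple, Int.cast_neg, neg_smul, neg_neg, Int.cast_smul_eq_zsmul, smul_neg,
      add_neg_cancel]
  · rw [freeHom_ad_pow, LieHom.map_lie, hE, hE, ← Model.form_simple, Model.ad_pow_lie_simple]
  · rw [freeHom_ad_pow, LieHom.map_lie, hF, hF, ← Model.form_simple, Model.ad_pow_lie_neg_simple]

/-- The homomorphism from the Lie algebra of type `E₈` to its model. -/
noncomputable def toModel : e₈ ℂ →ₗ⁅ℂ⁆ Model :=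
  { toLinearMap := Submodule.liftQ (toIdeal ℂ CartanMatrix.E₈).toSubmodule
      (freeHom : FreeLieAlgebra ℂ (Generators (Fin 8)) →ₗ[ℂ] Model) (fun _ hx ↦ toIdeal_le_ker hx)
    map_lie' := by
      intro x y
      obtain ⟨x, rfl⟩ := proj_surjective x
      obtain ⟨y, rfl⟩ := proj_surjective y
      exact freeHom.map_lie x y }

theorem toModel_gen (x : Generators (Fin 8)) : toModel (gen x) = modelGen x := freeHom_of x

theorem toModel_injective : Function.Injective toModel := by
  refine isSerreFamily_gen.injective generates_gen toModel ?_ (fun i ↦ ?_) (fun i ↦ ?_)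
  · have : (fun i ↦ toModel (gen (.H i))) = Model.basis ∘ Sum.inl := by
      ext1 i
      rw [toModel_gen, Function.comp, Model.basis_inl]
      rfl
    rw [this]
    exact Model.basis.linearIndependent.comp _ Sum.inl_injective
  · rw [toModel_gen]; exact Model.vec_ne_zero _
  · rw [toModel_gen]; exact neg_ne_zero.mpr (Model.vec_ne_zero (-simple i))

theorem toModel_surjective : Function.Surjective toModel := by
  rw [← LieHom.range_eq_top]
  refine Model.generates (fun i ↦ ?_) (fun i ↦ ?_)
  · exact ⟨gen (.E i), toModel_gen _⟩
  · rw [← neg_neg (Model.vec _)]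
    exact neg_mem ⟨gen (.F i), toModel_gen _⟩

/-- The Lie algebra of type `E₈` is isomorphic to its model. -/
noncomputable def equivModel : e₈ ℂ ≃ₗ⁅ℂ⁆ Model :=
  LieEquiv.ofBijective toModel ⟨toModel_injective, toModel_surjective⟩

end E8

namespace E8

open LieAlgebra

/-- The basis dual to the simple roots. -/
def fundamental (k : Fin 8) : Lattice :=
  ![![4, 5, 7, 10, 8, 6, 4, 2], ![5, 8, 10, 15, 12, 9, 6, 3], ![7, 10, 14, 20, 16, 12, 8, 4],
    ![10, 15, 20, 30, 24, 18, 12, 6], ![8, 12, 16, 24, 20, 15, 10, 5],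
    ![6, 9, 12, 18, 15, 12, 8, 4], ![4, 6, 8, 12, 10, 8, 6, 3], ![2, 3, 4, 6, 5, 4, 3, 2]] k

theorem form_fundamental (i k : Fin 8) :
    form (simple i).1 (fundamental k) = if i = k then 1 else 0 := by
  revert i k; decide +kernel

/-- The complex-linear extension of `form` in the first variable, in coordinates. -/
noncomputable def pairing (c : Fin 8 → ℂ) (x : Lattice) : ℂ :=
  ∑ i, c i * (form (simple i).1 x : ℂ)

theorem pairing_add (c : Fin 8 → ℂ) (x y : Lattice) :
    pairing c (x + y) = pairing c x + pairing c y := by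
  simp [pairing, form_add_right, mul_add, Finset.sum_add_distrib]

theorem pairing_eq_sum (c : Fin 8 → ℂ) (x : Lattice) :
    pairing c x = ∑ i, (x i : ℂ) * pairing c (simple i).1 := by
  simp only [pairing, Finset.mul_sum]
  rw [Finset.sum_comm]
  refine Finset.sum_congr rfl fun i _ ↦ ?_
  rw [form_comm, Model.form_eq_sum, Int.cast_sum, Finset.mul_sum]
  refine Finset.sum_congr rfl fun j _ ↦ ?_
  rw [form_comm, ← simple_val]
  push_cast
  ring

theorem pairing_fundamental (c : Fin 8 → ℂ) (k : Fin 8) : pairing c (fundamental k) = c k := by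
  simp [pairing, form_fundamental]

theorem pairing_intCast (x y : Lattice) : pairing (fun i ↦ (x i : ℂ)) y = (form x y : ℂ) := by
  rw [pairing, Model.form_eq_sum x y]
  push_cast
  rfl

theorem eq_zero_of_pairing_eq_zero {c : Fin 8 → ℂ} (h : ∀ α : Root, pairing c α.1 = 0) : c = 0 := by
  ext k
  rw [← pairing_fundamental c k, pairing_eq_sum]
  simp [h]

namespace Model

/-- The elements of the Cartan subalgebra. -/
noncomputable def torus : (Fin 8 → ℂ) →ₗ[ℂ] Model :=
  Fintype.linearCombination ℂ fun i ↦ basis (.inl i)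

theorem torus_apply (c : Fin 8 → ℂ) : torus c = ∑ i, c i • basis (.inl i) := rfl

theorem torus_intCast (x : Lattice) : torus (fun i ↦ (x i : ℂ)) = cart x := rfl

theorem lie_torus_cart (c : Fin 8 → ℂ) (x : Lattice) : ⁅torus c, cart x⁆ = 0 := by
  rw [torus_apply, sum_lie]
  exact Finset.sum_eq_zero fun i _ ↦ by rw [smul_lie, basis_inl, lie_cart_cart, smul_zero]

theorem lie_torus_vec (c : Fin 8 → ℂ) (x : Lattice) :
    ⁅torus c, vec x⁆ = pairing c x • vec x := by
  rw [torus_apply, sum_lie, pairing, Finset.sum_smul]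
  refine Finset.sum_congr rfl fun i _ ↦ ?_
  rw [smul_lie, basis_inl, lie_cart_vec, smul_smul, simple_val]

/-- The weight of a basis vector. -/
def weight : Idx → Lattice
  | .inl _ => 0
  | .inr α => α.1

theorem pairing_zero (c : Fin 8 → ℂ) : pairing c 0 = 0 := by simp [pairing, form_zero_right]

theorem lie_torus_basis (c : Fin 8 → ℂ) (a : Idx) :
    ⁅torus c, basis a⁆ = pairing c (weight a) • basis a := by
  cases a with
  | inl i => rw [basis_inl, lie_torus_cart, weight, pairing_zero, zero_smul]
  | inr α => rw [basis_inr, lie_torus_vec, weight]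

noncomputable instance : Fintype Root := Fintype.ofFinite Root

theorem killingForm_torus (c d : Fin 8 → ℂ) :
    killingForm ℂ Model (torus c) (torus d) = ∑ α : Root, pairing c α.1 * pairing d α.1 := by
  rw [killingForm_apply_apply, LinearMap.trace_eq_matrix_trace ℂ basis, Matrix.trace,
    Fintype.sum_sum_type]
  have (a : Idx) : (LinearMap.toMatrix basis basis (ad ℂ Model (torus c) ∘ₗ ad ℂ Model (torus d))).diag a
      = pairing c (weight a) * pairing d (weight a) := by
    rw [Matrix.diag_apply, LinearMap.toMatrix_apply, LinearMap.comp_apply, ad_apply, ad_apply,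
      lie_torus_basis, lie_smul, lie_torus_basis]
    simp [mul_comm]
  simp only [this, weight, pairing_zero]
  simp

theorem killingForm_lie (h x y : Model) :
    killingForm ℂ Model ⁅h, x⁆ y = -killingForm ℂ Model x ⁅h, y⁆ := by
  rw [← lie_skew, map_neg, LinearMap.neg_apply, LieModule.traceForm_apply_lie_apply]

theorem killingForm_basis_eq_zero {a b : Idx} (h : weight a + weight b ≠ 0) :
    killingForm ℂ Model (basis a) (basis b) = 0 := by
  by_contra hne
  apply h
  apply eq_of_form_simple_eq
  intro i
  have := killingForm_lie (torus (Pi.single i 1)) (basis a) (basis b)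
  rw [lie_torus_basis, lie_torus_basis, map_smul, map_smul, LinearMap.smul_apply, ← sub_eq_zero,
    sub_neg_eq_add, smul_eq_mul, smul_eq_mul, ← add_mul, ← pairing_add] at this
  have := (mul_eq_zero.mp this).resolve_right hne
  simpa [pairing, Pi.single_apply, form_zero_right] using this

theorem killingForm_vec_neg_ne_zero (α : Root) :
    killingForm ℂ Model (vec α.1) (vec (-α.1)) ≠ 0 := by
  have h := LieModule.traceForm_apply_lie_apply ℂ Model Model (cart α.1) (vec α.1) (vec (-α.1))
  intro h0
  rw [lie_cart_vec, lie_vec_neg, α.2, map_smul, LinearMap.smul_apply, map_neg,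
    ← torus_intCast] at h
  erw [h0, killingForm_torus] at h
  rw [smul_zero, eq_comm, neg_eq_zero] at h
  simp only [pairing_intCast] at h
  have h' : ∑ β : Root, form α.1 β.1 * form α.1 β.1 = 0 := by exact_mod_cast h
  have := (Finset.sum_eq_zero_iff_of_nonneg (fun β _ ↦ mul_self_nonneg _)).mp h' α (Finset.mem_univ _)
  rw [α.2] at this
  omega

theorem killingForm_apply_vec_neg (x : Model) (α : Root) :
    killingForm ℂ Model x (vec (-α.1)) =
      basis.repr x (.inr α) * killingForm ℂ Model (vec α.1) (vec (-α.1)) := by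
  have : killingForm ℂ Model (vec (-α.1)) =
      killingForm ℂ Model (vec α.1) (vec (-α.1)) • basis.coord (.inr α) := by
    refine basis.ext fun a ↦ ?_
    rw [LieModule.traceForm_comm, LinearMap.smul_apply, Module.Basis.coord_apply,
      Module.Basis.repr_self]
    by_cases ha : a = .inr α
    · subst ha; rw [basis_inr]; simp
    · rw [Finsupp.single_eq_of_ne (Ne.symm ha), smul_zero, ← Root.neg_val, ← basis_inr]
      apply killingForm_basis_eq_zero
      intro h0
      cases a with
      | inl i =>
        rw [weight, weight, zero_add] at h0
        have := (-α).2
        rw [h0, form_zero_right] at this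
        omega
      | inr β =>
        rw [weight, weight, Root.neg_val, ← sub_eq_add_neg, sub_eq_zero] at h0
        exact ha (congrArg _ (Subtype.ext h0))
  have := LinearMap.congr_fun this x
  rw [LieModule.traceForm_comm, LinearMap.smul_apply, Module.Basis.coord_apply, smul_eq_mul] at this
  rw [this, mul_comm]

theorem eq_torus_add_sum (x : Model) : x = torus (fun i ↦ basis.repr x (.inl i)) +
    ∑ α : Root, basis.repr x (.inr α) • vec α.1 := by
  conv_lhs => rw [← basis.sum_repr x, Fintype.sum_sum_type]
  simp only [basis_inr, torus_apply]

instance : LieAlgebra.IsKilling ℂ Model where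
  killingCompl_top_eq_bot := by
    rw [eq_bot_iff]
    intro x hx
    rw [LieIdeal.mem_killingCompl] at hx
    have hx' (y : Model) : killingForm ℂ Model x y = 0 := by
      rw [LieModule.traceForm_comm]; exact hx y trivial
    have h0 (α : Root) : basis.repr x (.inr α) = 0 := by
      have := hx' (vec (-α.1))
      rw [killingForm_apply_vec_neg] at this
      exact (mul_eq_zero.mp this).resolve_right (killingForm_vec_neg_ne_zero α)
    have h1 := eq_torus_add_sum x
    simp only [h0, zero_smul, Finset.sum_const_zero, add_zero] at h1
    set c : Fin 8 → ℂ := fun i ↦ basis.repr x (.inl i)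
    have hp : ∑ α : Root, pairing c α.1 * pairing (star c) α.1 = 0 := by
      rw [← killingForm_torus, ← h1]; exact hx' _
    have hstar (y : Lattice) : pairing (star c) y = starRingEnd ℂ (pairing c y) := by
      simp [pairing]
    simp only [hstar, Complex.mul_conj] at hp
    have hp' : ∑ α : Root, Complex.normSq (pairing c α.1) = 0 := by exact_mod_cast hp
    have : c = 0 := eq_zero_of_pairing_eq_zero fun α ↦ Complex.normSq_eq_zero.mp
      ((Finset.sum_eq_zero_iff_of_nonneg fun β _ ↦ Complex.normSq_nonneg _).mp hp' α
        (Finset.mem_univ _))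
    rw [h1, this, map_zero]
    exact zero_mem _

end Model

end E8

namespace JacobsonMorozov

open Module LieAlgebra

section Ring

variable {R : Type*} [Ring R] {T X C : R}

theorem pow_succ_mul_of_commutator (h : T * X = X * T + C) (hC : Commute T C) (n : ℕ) :
    T ^ (n + 1) * X = X * T ^ (n + 1) + (n + 1) • (T ^ n * C) := by
  induction n with
  | zero => simp [h]
  | succ n ih =>
    rw [pow_succ' T (n + 1), mul_assoc, ih, mul_add, ← mul_assoc, h, mul_smul_comm, ← mul_assoc T,
      ← pow_succ', add_mul, mul_assoc X, ← pow_succ', ← (hC.pow_left (n + 1)).eq,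
      add_assoc, succ_nsmul (T ^ (n + 1) * C) (n + 1), add_comm (_ • _)]

/-- Kleinecke–Shirokov for a nilpotent element. -/
theorem isNilpotent_commutator [Algebra ℂ R] (h : T * X = X * T + C) (hC : Commute T C)
    (hT : IsNilpotent T) : IsNilpotent C := by
  obtain ⟨N, hN⟩ := hT
  suffices H : ∀ k j, T ^ k * C ^ j = 0 → ∃ m, C ^ m = 0 from H N 0 (by simp [hN])
  intro k
  induction k with
  | zero => exact fun j hj ↦ ⟨j, by simpa using hj⟩
  | succ k ih =>
    intro j hj
    refine ih (2 * j + 1) ?_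
    have h1 := congrArg (fun z ↦ C ^ j * z * C ^ j) (pow_succ_mul_of_commutator h hC k)
    have hcomm : C ^ j * T ^ (k + 1) = 0 := by rw [((hC.pow_pow _ _).symm).eq, hj]
    have hc2 : C ^ j * T ^ k = T ^ k * C ^ j := ((hC.pow_pow _ _).symm).eq
    simp only [mul_add, add_mul] at h1
    rw [← mul_assoc, hcomm, zero_mul, zero_mul, mul_assoc, mul_assoc X, hj, mul_zero, mul_zero,
      zero_add, mul_smul_comm, smul_mul_assoc, ← mul_assoc, hc2] at h1
    have h2 : T ^ k * C ^ (2 * j + 1) = T ^ k * C ^ j * C * C ^ j := by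
      rw [mul_assoc, mul_assoc, ← pow_succ', ← pow_add]
      congr 2; omega
    rw [h2]
    have h3 : ((k + 1 : ℕ) : ℂ) • (T ^ k * C ^ j * C * C ^ j) = 0 := by
      rw [Nat.cast_smul_eq_nsmul, ← h1]
    exact (smul_eq_zero.mp h3).resolve_left (Nat.cast_ne_zero.mpr k.succ_ne_zero)

end Ring

section Module

variable {V : Type*} [AddCommGroup V] [Module ℂ V] {T X C : End ℂ V}

theorem isNilpotent_mul_of_commutator (h : T * X = X * T + C) (hC : Commute T C)
    (hT : IsNilpotent T) : IsNilpotent (T * X) := by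
  obtain ⟨m, hm⟩ := isNilpotent_commutator h hC hT
  have key : ∀ i n v, (T ^ (i + 1)) v = 0 → (T ^ (i + 1)) (((T * X) ^ n) v) = 0 ∧
      (T ^ i) (((T * X) ^ n) v) = ((i + 1 : ℕ) ^ n) • (C ^ n) ((T ^ i) v) := by
    intro i n v hv
    induction n with
    | zero => simpa using hv
    | succ n ih =>
      obtain ⟨h1, h2⟩ := ih
      set u := ((T * X) ^ n) v with hu
      have e1 := LinearMap.congr_fun (pow_succ_mul_of_commutator h hC i) u
      have e2 := LinearMap.congr_fun (pow_succ_mul_of_commutator h hC (i + 1)) u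
      have e3 : (T ^ (i + 1 + 1)) u = 0 := by
        rw [pow_succ']; simp [h1]
      have e4 : (T ^ (i + 1)) (C u) = 0 := by
        have := LinearMap.congr_fun ((hC.pow_left (i + 1)).eq) u
        simp only [End.mul_apply] at this
        rw [this, h1, map_zero]
      have e5 : (T ^ i) (C u) = C ((T ^ i) u) := LinearMap.congr_fun ((hC.pow_left i).eq) u
      rw [pow_succ' (T * X), End.mul_apply, ← hu]
      rw [pow_succ T (i + 1)] at e2 e3
      rw [pow_succ T i] at e1 h1
      simp only [End.mul_apply, LinearMap.add_apply, LinearMap.smul_apply, pow_succ T i] at *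
      constructor
      · rw [e2, e3, e4]; simp
      · rw [e1, h1, e5, h2, map_zero, zero_add, map_nsmul, pow_succ' C, End.mul_apply, ← mul_smul,
          ← pow_succ']
  have key2 : ∀ i v, (T ^ i) v = 0 → ((T * X) ^ (m * i)) v = 0 := by
    intro i
    induction i with
    | zero => intro v hv; simpa using hv
    | succ i ih =>
      intro v hv
      rw [mul_add, mul_one, pow_add, End.mul_apply]
      apply ih
      rw [(key i m v hv).2, hm]; simp
  obtain ⟨N, hN⟩ := hT
  exact ⟨m * N, LinearMap.ext fun v ↦ key2 N v (by simp [hN])⟩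

end Module

end JacobsonMorozov

namespace JacobsonMorozov

open Module LieAlgebra

/-- `T` is nilpotent and raises the eigenvalues of a semisimple `S` by `2`, and the commutator of
`T` and `Y` has semisimple part `S`. -/
structure IsGrading {V : Type*} [AddCommGroup V] [Module ℂ V] (T D Y S : End ℂ V) : Prop where
  commutator : T * Y = Y * T + D
  lie_right : D * T = T * D + (2 : ℂ) • T
  isNilpotent : IsNilpotent T
  commute : Commute D S
  isSemisimple : S.IsSemisimple
  isNilpotent_sub : IsNilpotent (D - S)
  semisimple_lie_right : S * T = T * S + (2 : ℂ) • T

namespace IsGrading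

variable {V : Type*} [AddCommGroup V] [Module ℂ V] {T D Y S : End ℂ V}

theorem mul_pow (h : IsGrading T D Y S) (i : ℕ) :
    D * T ^ i = T ^ i * D + (2 * i : ℂ) • T ^ i := by
  induction i with
  | zero => simp
  | succ i ih =>
    rw [pow_succ, ← mul_assoc, ih, add_mul, mul_assoc, h.lie_right, smul_mul_assoc, mul_add,
      mul_assoc, mul_smul_comm]
    push_cast
    module

theorem pow_succ_mul (h : IsGrading T D Y S) (i : ℕ) :
    T ^ (i + 1) * Y = Y * T ^ (i + 1) + (i + 1 : ℂ) • (T ^ i * D + (i : ℂ) • T ^ i) := by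
  induction i with
  | zero => simp [h.commutator]
  | succ i ih =>
    have h1 := h.mul_pow (i + 1)
    rw [pow_succ' T (i + 1), mul_assoc, ih, mul_add, ← mul_assoc, h.commutator, add_mul, h1,
      mul_smul_comm, mul_add, ← mul_assoc, mul_smul_comm, ← pow_succ', mul_assoc]
    push_cast
    module

theorem pow_succ_apply (h : IsGrading T D Y S) (i : ℕ) (v : V) :
    (T ^ (i + 1)) (Y v) = Y ((T ^ (i + 1)) v) +
      (i + 1 : ℂ) • ((T ^ i) (D v) + (i : ℂ) • (T ^ i) v) := by
  simpa using LinearMap.congr_fun (h.pow_succ_mul i) v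

theorem pow_succ_apply' (h : IsGrading T D Y S) (i : ℕ) (v : V) :
    (T ^ (i + 1)) (Y v) = Y ((T ^ (i + 1)) v) +
      (i + 1 : ℂ) • (D ((T ^ i) v) - (i : ℂ) • (T ^ i) v) := by
  have h1 : D ((T ^ i) v) = (T ^ i) (D v) + (2 * i : ℂ) • (T ^ i) v := by
    simpa using LinearMap.congr_fun (h.mul_pow i) v
  rw [h.pow_succ_apply, h1]
  congr 2
  module

theorem apply_raise (h : IsGrading T D Y S) (v : V) : D (T v) = T (D v) + (2 : ℂ) • T v := by
  simpa using LinearMap.congr_fun h.lie_right v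

theorem semisimple_apply_raise (h : IsGrading T D Y S) (v : V) :
    S (T v) = T (S v) + (2 : ℂ) • T v := by
  simpa using LinearMap.congr_fun h.semisimple_lie_right v

theorem semisimple_apply (h : IsGrading T D Y S) (v : V) : S (D v) = D (S v) :=
  (LinearMap.congr_fun h.commute.eq v).symm

theorem eq_zero_of_apply_eq_smul (h : IsGrading T D Y S) {lam μ : ℂ} (hne : lam ≠ μ) {v : V}
    (hS : S v = lam • v) (hD : D v = μ • v) : v = 0 := by
  by_contra hv
  obtain ⟨n, hn⟩ := h.isNilpotent_sub
  have key : ∀ n, ((D - S) ^ n) v = (μ - lam) ^ n • v := by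
    intro n
    induction n with
    | zero => simp
    | succ n ih =>
      rw [pow_succ', End.mul_apply, ih, map_smul, LinearMap.sub_apply, hS, hD, ← sub_smul,
        smul_smul, ← pow_succ]
  have h1 := key n
  rw [hn, LinearMap.zero_apply, eq_comm, smul_eq_zero] at h1
  exact h1.elim (pow_ne_zero _ (sub_ne_zero.mpr hne.symm)) hv

/-- An eigenvector of `S` annihilated by `T` has a natural number as eigenvalue. -/
theorem exists_nat_of_mem_ker (h : IsGrading T D Y S) {lam : ℂ} {v : V} (hS : S v = lam • v)
    (hT : T v = 0) (hv : v ≠ 0) : ∃ n : ℕ, lam = n := by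
  by_contra! hlam
  have key : ∀ i : ℕ, ∃ w, (T ^ i) w ≠ 0 ∧ T ((T ^ i) w) = 0 ∧
      S ((T ^ i) w) = lam • (T ^ i) w := by
    intro i
    induction i with
    | zero => exact ⟨v, by simpa using hv, by simpa using hT, by simpa using hS⟩
    | succ i ih =>
      obtain ⟨w, h1, h2, h3⟩ := ih
      have hi : (i + 1 : ℂ) ≠ 0 := by exact_mod_cast i.succ_ne_zero
      have h4 : (T ^ (i + 1)) (Y w) = (i + 1 : ℂ) • (D ((T ^ i) w) - (i : ℂ) • (T ^ i) w) := by
        rw [h.pow_succ_apply', pow_succ', End.mul_apply, h2, map_zero, zero_add]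
      refine ⟨Y w, ?_, ?_, ?_⟩
      · rw [h4]
        intro h5
        have h6 := (smul_eq_zero.mp h5).resolve_left hi
        exact h1 (h.eq_zero_of_apply_eq_smul (hlam i) h3 (sub_eq_zero.mp h6))
      · have h5 := h.apply_raise ((T ^ i) w)
        rw [h2] at h5
        rw [h4, map_smul, map_sub, map_smul, h2]
        rw [map_zero, smul_zero, add_zero] at h5
        simp [← h5]
      · rw [h4, map_smul, map_sub, map_smul, h.semisimple_apply, h3, map_smul]
        module
  obtain ⟨N, hN⟩ := h.isNilpotent
  obtain ⟨w, h1, -⟩ := key N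
  exact h1 (by simp [hN])

variable [FiniteDimensional ℂ V]

theorem exists_eq_add (hS : S.IsSemisimple) (μ : ℂ) (w : V) :
    ∃ a c, S a = μ • a ∧ w = a + (S c - μ • c) := by
  have hdisj : Disjoint (LinearMap.ker (S - algebraMap ℂ (End ℂ V) μ))
      (LinearMap.range (S - algebraMap ℂ (End ℂ V) μ)) := by
    rw [Submodule.disjoint_def]
    rintro x hx ⟨c, rfl⟩
    have h1 : c ∈ S.genEigenspace μ (2 : ℕ) := by
      rw [End.mem_genEigenspace_nat, LinearMap.mem_ker, pow_two]
      exact hx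
    rw [hS.isFinitelySemisimple.genEigenspace_eq_eigenspace μ (by norm_num),
      End.mem_eigenspace_iff] at h1
    simp [h1]
  have htop := Submodule.eq_top_of_disjoint _ _
    (by rw [add_comm, LinearMap.finrank_range_add_finrank_ker]) hdisj
  obtain ⟨a, ha, b, ⟨c, hc⟩, rfl⟩ := Submodule.mem_sup.mp (htop ▸ Submodule.mem_top (x := w))
  refine ⟨a, c, ?_, ?_⟩
  · simpa [sub_eq_zero] using ha
  · rw [← hc]; simp

/-- `T` maps eigenspaces of `S` onto eigenspaces. -/
theorem exists_apply_eq_of_mem_range (h : IsGrading T D Y S) {lam : ℂ} {w : V}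
    (hw : S (T w) = lam • T w) : ∃ a, S a = (lam - 2) • a ∧ T a = T w := by
  obtain ⟨a, c, ha, hac⟩ := exists_eq_add h.isSemisimple (lam - 2) w
  refine ⟨a, ha, ?_⟩
  have h1 : T w = T a + (S (T c) - lam • T c) := by
    rw [hac, map_add, map_sub, map_smul, h.semisimple_apply_raise]
    module
  have h2 : S (T a) = lam • T a := by
    rw [h.semisimple_apply_raise, ha, map_smul]; module
  have h3 : T c ∈ S.genEigenspace lam (2 : ℕ) := by
    rw [End.mem_genEigenspace_nat, LinearMap.mem_ker, pow_two]
    have h4 : S (T c) - lam • T c = T w - T a := by rw [h1]; abel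
    simp [h4, hw, h2, smul_sub]
  rw [h.isSemisimple.isFinitelySemisimple.genEigenspace_eq_eigenspace lam (by norm_num),
    End.mem_eigenspace_iff] at h3
  rw [h1, h3]; simp

theorem exists_apply_add_smul_eq (h : IsGrading T D Y S) {lam μ : ℂ} (hne : lam ≠ μ) {z : V}
    (hz : S z = lam • z) : ∃ x, S x = lam • x ∧ D x - μ • x = z := by
  have hmaps : ∀ x ∈ S.eigenspace lam, (D - algebraMap ℂ (End ℂ V) μ) x ∈ S.eigenspace lam := by
    intro x hx
    rw [End.mem_eigenspace_iff] at hx ⊢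
    rw [LinearMap.sub_apply, algebraMap_end_apply, map_sub, map_smul, h.semisimple_apply, hx,
      map_smul, smul_sub, smul_comm μ]
  have hinj : Function.Injective ((D - algebraMap ℂ (End ℂ V) μ).restrict hmaps) := by
    rw [injective_iff_map_eq_zero]
    rintro ⟨x, hx⟩ hx'
    have h1 := congrArg Subtype.val hx'
    simp only [LinearMap.restrict_apply, LinearMap.sub_apply, algebraMap_end_apply,
      ZeroMemClass.coe_zero, sub_eq_zero] at h1
    exact Subtype.ext (h.eq_zero_of_apply_eq_smul hne (End.mem_eigenspace_iff.mp hx) h1)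
  obtain ⟨⟨x, hx⟩, hxz⟩ := LinearMap.surjective_of_injective hinj
    ⟨z, End.mem_eigenspace_iff.mpr hz⟩
  exact ⟨x, End.mem_eigenspace_iff.mp hx, by simpa using congrArg Subtype.val hxz⟩

/-- An eigenvector of `S` whose eigenvalue is not a nonpositive integer is in the image of `T`. -/
theorem exists_apply_eq (h : IsGrading T D Y S) {lam : ℂ} (hlam : ∀ n : ℕ, lam ≠ -n) {z : V}
    (hz : S z = lam • z) : ∃ w, S w = (lam - 2) • w ∧ T w = z := by
  obtain ⟨N, hN⟩ := h.isNilpotent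
  have key : ∀ i, (∀ z, S z = lam • z → ∃ w, (T ^ i) (z - T w) = 0) →
      ∀ z, S z = lam • z → ∃ w, T w = z := by
    intro i
    induction i with
    | zero =>
      intro h1 z hz
      obtain ⟨w, hw⟩ := h1 z hz
      exact ⟨w, (sub_eq_zero.mp (by simpa using hw)).symm⟩
    | succ i ih =>
      intro h1
      refine ih fun z hz ↦ ?_
      obtain ⟨x, hx, rfl⟩ := h.exists_apply_add_smul_eq (hlam i) hz
      obtain ⟨w, hw⟩ := h1 x hx
      have hi : (i + 1 : ℂ) ≠ 0 := by exact_mod_cast i.succ_ne_zero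
      have h2 := h.pow_succ_apply i (x - T w)
      rw [hw, map_zero, zero_add, pow_succ, End.mul_apply] at h2
      refine ⟨(i + 1 : ℂ)⁻¹ • Y (x - T w) + D w + (2 + i : ℂ) • w, ?_⟩
      rw [map_add, map_add, map_smul, map_smul, map_sub _ (D x - _), map_add, map_add, map_smul,
        h2, inv_smul_smul₀ hi, map_sub, map_sub, map_sub, h.apply_raise, map_add, map_smul,
        map_smul, map_smul, map_sub]
      module
  obtain ⟨w, rfl⟩ := key N (fun z _ ↦ ⟨0, by simp [hN]⟩) z hz
  exact h.exists_apply_eq_of_mem_range hz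

/-- `dim ker T = dim V₀ + dim V₋₁`. -/
theorem finrank_ker (h : IsGrading T D Y S) :
    finrank ℂ (LinearMap.ker T) = finrank ℂ (S.eigenspace 0) + finrank ℂ (S.eigenspace (-1)) := by
  have hind := S.eigenspaces_iSupIndep
  have htop := h.isSemisimple.iSup_eigenspace_eq_top
  set A : Submodule ℂ V := ⨆ n : ℕ, S.eigenspace (n + 1 : ℂ) with hA
  set E : Submodule ℂ V := S.eigenspace 0 ⊔ S.eigenspace (-1) with hE
  have hker : LinearMap.ker T ≤ E ⊔ A := by
    have h1 := Submodule.eq_iSup_inf_genEigenspace (f := S) (p := LinearMap.ker T) 1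
      (fun x hx ↦ by
        have h2 := h.semisimple_apply_raise x
        rw [LinearMap.mem_ker] at hx ⊢
        simpa [hx] using h2.symm) htop
    rw [h1, iSup_le_iff]
    rintro μ x ⟨hx, hx'⟩
    by_cases hx0 : x = 0
    · simp [hx0]
    obtain ⟨n, rfl⟩ := h.exists_nat_of_mem_ker (End.mem_eigenspace_iff.mp hx') hx hx0
    rcases n with - | n
    · exact Submodule.mem_sup_left (Submodule.mem_sup_left (by simpa using hx'))
    · exact Submodule.mem_sup_right (Submodule.mem_iSup_of_mem n (by simpa using hx'))
  have hmap : Submodule.map T (E ⊔ A) = A := by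
    apply le_antisymm
    · rw [Submodule.map_sup, hE, Submodule.map_sup, hA, Submodule.map_iSup]
      refine sup_le (sup_le ?_ ?_) (iSup_le fun n ↦ ?_)
      · rintro _ ⟨x, hx, rfl⟩
        refine Submodule.mem_iSup_of_mem 1 ?_
        have hx := End.mem_eigenspace_iff.mp hx
        rw [End.mem_eigenspace_iff, h.semisimple_apply_raise, hx, map_smul]; push_cast; module
      · rintro _ ⟨x, hx, rfl⟩
        refine Submodule.mem_iSup_of_mem 0 ?_
        have hx := End.mem_eigenspace_iff.mp hx
        rw [End.mem_eigenspace_iff, h.semisimple_apply_raise, hx, map_smul]; push_cast; module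
      · rintro _ ⟨x, hx, rfl⟩
        refine Submodule.mem_iSup_of_mem (n + 2) ?_
        have hx := End.mem_eigenspace_iff.mp hx
        rw [End.mem_eigenspace_iff, h.semisimple_apply_raise, hx, map_smul]; push_cast; module
    · refine iSup_le fun n z hz ↦ ?_
      obtain ⟨w, hw, rfl⟩ := h.exists_apply_eq (lam := n + 1) (fun m hm ↦ by
        have : (n + 1 + m : ℂ) = 0 := by rw [hm]; ring
        exact absurd this (by exact_mod_cast (by omega : n + 1 + m ≠ 0)))
        (End.mem_eigenspace_iff.mp hz)
      refine Submodule.mem_map_of_mem ?_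
      rcases n with - | - | n
      · refine Submodule.mem_sup_left (Submodule.mem_sup_right ?_)
        rw [End.mem_eigenspace_iff, hw]; push_cast; module
      · refine Submodule.mem_sup_left (Submodule.mem_sup_left ?_)
        rw [End.mem_eigenspace_iff, hw]; push_cast; module
      · refine Submodule.mem_sup_right (Submodule.mem_iSup_of_mem n ?_)
        rw [End.mem_eigenspace_iff, hw]; push_cast; module
  have hrk := LinearMap.finrank_range_add_finrank_ker (T.domRestrict (E ⊔ A))
  have hr : LinearMap.range (T.domRestrict (E ⊔ A)) = A := by
    rw [LinearMap.range_domRestrict, hmap]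
  have hk : finrank ℂ (LinearMap.ker (T.domRestrict (E ⊔ A))) = finrank ℂ (LinearMap.ker T) := by
    rw [LinearMap.ker_domRestrict]
    exact (Submodule.submoduleOfEquivOfLe hker).finrank_eq
  have hdisjA : Disjoint E A := by
    have := hind.disjoint_biSup_biSup (s := {0, -1}) (t := Set.range fun n : ℕ ↦ (n + 1 : ℂ)) ?_
    · rwa [iSup_pair, iSup_range] at this
    · rw [Set.disjoint_left]
      rintro _ (rfl | rfl) ⟨n, hn⟩
      · have : (n + 1 : ℂ) = 0 := hn
        exact absurd this (by exact_mod_cast n.succ_ne_zero)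
      · have : (n + 2 : ℂ) = 0 := by linear_combination hn
        exact absurd this (by exact_mod_cast (by omega : n + 2 ≠ 0))
  have hdisj : Disjoint (S.eigenspace 0) (S.eigenspace (-1)) :=
    hind.pairwiseDisjoint (by norm_num)
  have f1 := Submodule.finrank_sup_add_finrank_inf_eq E A
  have f2 := Submodule.finrank_sup_add_finrank_inf_eq (S.eigenspace 0) (S.eigenspace (-1))
  rw [hdisjA.eq_bot, finrank_bot] at f1
  rw [hdisj.eq_bot, finrank_bot, ← hE] at f2
  rw [hr, hk] at hrk
  omega

end IsGrading

end JacobsonMorozov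

namespace JacobsonMorozov

open Module LieAlgebra

variable {L : Type*} [LieRing L] [LieAlgebra ℂ L]

theorem ad_mul_ad (x y : L) : ad ℂ L x * ad ℂ L y = ad ℂ L y * ad ℂ L x + ad ℂ L ⁅x, y⁆ := by
  ext z
  simp [add_comm]

variable [FiniteDimensional ℂ L]

/-- The semisimple part of an inner derivation of a Lie algebra with nondegenerate Killing form is
inner. -/
theorem exists_ad_eq_semisimple [IsKilling ℂ L] (h : L) :
    ∃ s : L, (ad ℂ L s).IsSemisimple ∧ Commute (ad ℂ L h) (ad ℂ L s) ∧
      IsNilpotent (ad ℂ L h - ad ℂ L s) ∧ ∀ (μ : ℂ) (x : L), ⁅h, x⁆ = μ • x → ⁅s, x⁆ = μ • x := by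
  obtain ⟨N, -, S, hS₀, hN, hS, hSN⟩ := (ad ℂ L h).exists_isNilpotent_isSemisimple
  replace hS₀ : Commute (ad ℂ L h) S := Algebra.commute_of_mem_adjoin_self hS₀
  rw [eq_sub_of_add_eq hSN.symm] at hN
  have aux {μ : ℂ} {y : L} (hy : y ∈ (ad ℂ L h).maxGenEigenspace μ) : S y = μ • y := by
    rw [End.maxGenEigenspace_eq] at hy
    exact End.apply_eq_of_mem_of_comm_of_isFinitelySemisimple_of_isNil hy hS₀
      hS.isFinitelySemisimple hN
  have htop := End.iSup_maxGenEigenspace_eq_top (ad ℂ L h)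
  have h_der (y z : L) : S ⁅y, z⁆ = ⁅S y, z⁆ + ⁅y, S z⁆ := by
    have hy : y ∈ ⨆ μ, (ad ℂ L h).maxGenEigenspace μ := htop ▸ Submodule.mem_top
    have hz : z ∈ ⨆ μ, (ad ℂ L h).maxGenEigenspace μ := htop ▸ Submodule.mem_top
    induction hy using Submodule.iSup_induction' with
    | mem α y hy =>
      induction hz using Submodule.iSup_induction' with
      | mem β z hz =>
        rw [aux hy, aux hz, aux (LieModule.lie_mem_maxGenEigenspace_toEnd hy hz), smul_lie,
          lie_smul, ← add_smul]
      | zero => simp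
      | add _ _ _ _ h h' => simp only [lie_add, map_add, h, h']; abel
    | zero => simp
    | add _ _ _ _ h h' => simp only [add_lie, map_add, h, h']; abel
  let S' : LieDerivation ℂ L L := ⟨S, fun y z ↦ by
    rw [h_der, ← lie_skew (S y), add_comm, ← sub_eq_add_neg]⟩
  obtain ⟨s, hs⟩ := LieDerivation.IsKilling.exists_eq_ad S'
  have hs' : ad ℂ L s = S := by
    rw [← LieDerivation.coe_ad_apply_eq_ad_apply, hs]
  refine ⟨s, hs' ▸ hS, hs' ▸ hS₀, hs' ▸ hN, fun μ x hx ↦ ?_⟩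
  rw [← ad_apply (R := ℂ), hs']
  refine aux (End.mem_maxGenEigenspace _ _ _ |>.mpr ⟨1, ?_⟩)
  simp [hx]

theorem exists_lie_lie_eq_self [IsKilling ℂ L] {e : L} (he : IsNilpotent (ad ℂ L e)) :
    ∃ y, ⁅e, ⁅e, y⁆⁆ = e := by
  suffices H : e ∈ LinearMap.range (ad ℂ L e ^ 2) by
    obtain ⟨y, hy⟩ := H
    exact ⟨y, by simpa [pow_two] using hy⟩
  have hsymm := LieModule.traceForm_isSymm ℂ L L
  have hnd := IsKilling.killingForm_nondegenerate ℂ L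
  have hswap : ∀ x y, killingForm ℂ L ⁅e, x⁆ y = - killingForm ℂ L x ⁅e, y⁆ := fun x y ↦ by
    rw [← lie_skew, map_neg, LinearMap.neg_apply]
    exact congrArg _ (LieModule.traceForm_apply_lie_apply ℂ L L x e y)
  rw [← LinearMap.BilinForm.orthogonal_orthogonal hnd hsymm.isRefl
    (LinearMap.range (ad ℂ L e ^ 2))]
  rw [LinearMap.BilinForm.mem_orthogonal_iff]
  intro z hz
  rw [LinearMap.BilinForm.mem_orthogonal_iff] at hz
  have hz' : ⁅e, ⁅e, z⁆⁆ = 0 := by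
    refine hnd.2 _ fun x ↦ ?_
    have h1 : killingForm ℂ L ⁅e, ⁅e, x⁆⁆ z = 0 := hz _ ⟨x, by simp [pow_two]⟩
    rwa [hswap, hswap, neg_neg] at h1
  have hC : Commute (ad ℂ L e) (ad ℂ L ⁅e, z⁆) := by
    rw [commute_iff_eq, ad_mul_ad, hz', map_zero, add_zero]
  have h1 := LinearMap.isNilpotent_trace_of_isNilpotent
    (isNilpotent_mul_of_commutator (ad_mul_ad e z) hC he)
  rw [isNilpotent_iff_eq_zero] at h1
  change killingForm ℂ L z e = 0
  rw [LieModule.traceForm_comm, LieModule.traceForm_apply_apply]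
  exact h1

/-- A nilpotent element has degree `2` for the grading by the eigenvalues of a suitable semisimple
element. -/
theorem exists_isGrading [IsKilling ℂ L] {e : L} (he : IsNilpotent (ad ℂ L e)) :
    ∃ s h y : L, ⁅s, e⁆ = (2 : ℂ) • e ∧
      IsGrading (ad ℂ L e) (ad ℂ L h) (ad ℂ L y) (ad ℂ L s) := by
  obtain ⟨y, hy⟩ := exists_lie_lie_eq_self he
  obtain ⟨s, h1, h2, h3, h4⟩ := exists_ad_eq_semisimple ⁅e, (-2 : ℂ) • y⁆
  have h5 : ⁅⁅e, (-2 : ℂ) • y⁆, e⁆ = (2 : ℂ) • e := by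
    rw [← lie_skew, lie_smul, lie_smul, hy, neg_smul, neg_neg]
  have h6 := h4 2 e h5
  have key : ∀ d : L, ⁅d, e⁆ = (2 : ℂ) • e →
      ad ℂ L d * ad ℂ L e = ad ℂ L e * ad ℂ L d + (2 : ℂ) • ad ℂ L e := by
    intro d hd
    rw [← map_smul, ← hd, ad_mul_ad]
  exact ⟨s, _, (-2 : ℂ) • y, h6, ad_mul_ad _ _, key _ h5, he, h2, h1, h3, key _ h6⟩

end JacobsonMorozov

open Filter Topology Module

theorem exists_notMem_of_eventually {B : Set ℂ} (hB : B.Finite) {p : ℂ → Prop}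
    (hp : ∀ᶠ t in 𝓝 0, p t) : ∃ t, t ∉ B ∧ p t := by
  obtain ⟨t, h1, h2⟩ := ((infinite_of_mem_nhds (0 : ℂ) hp).sdiff hB).nonempty
  exact ⟨t, h2, h1⟩

theorem rel_of_eventually_rel {B : Set ℂ} (hB : B.Finite) (P : ℂ → ℂ → Prop)
    (hsymm : ∀ x y, P x y → P y x) (htrans : ∀ x y z, P x y → P y z → P x z)
    (hloc : ∀ x, x ∉ B → ∀ᶠ y in 𝓝 x, y ∉ B → P x y) {x y : ℂ} (hx : x ∉ B) (hy : y ∉ B) :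
    P x y := by
  refine IsPreconnected.induction₂ (s := Bᶜ)
    (hB.countable.isConnected_compl_of_one_lt_rank (by simp)).isPreconnected P
    (fun x hx ↦ ?_) (fun x y z _ _ _ ↦ htrans x y z) (fun x y _ _ ↦ hsymm x y) hx hy
  exact eventually_nhdsWithin_iff.mpr (hloc x hx)

theorem MvPolynomial.finite_eval_line_eq_zero {ι : Type*} (P : MvPolynomial ι ℂ) (a v : ι → ℂ)
    {t₀ : ℂ} (h : MvPolynomial.eval (a + t₀ • v) P ≠ 0) :
    {t : ℂ | MvPolynomial.eval (a + t • v) P = 0}.Finite := by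
  let q : Polynomial ℂ := MvPolynomial.aeval
    (fun i ↦ Polynomial.C (a i) + Polynomial.X * Polynomial.C (v i)) P
  have hq (t : ℂ) : q.eval t = MvPolynomial.eval (a + t • v) P := by
    have h1 : (Polynomial.aeval t).comp (MvPolynomial.aeval
        (fun i ↦ Polynomial.C (a i) + Polynomial.X * Polynomial.C (v i))) =
        MvPolynomial.aeval (R := ℂ) (a + t • v) := MvPolynomial.algHom_ext fun i ↦ by simp [mul_comm t]
    exact DFunLike.congr_fun h1 P
  have hq0 : q ≠ 0 := fun h0 ↦ h (by rw [← hq, h0, Polynomial.eval_zero])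
  refine (Polynomial.finite_setOfPred_isRoot hq0).subset fun t ht ↦ ?_
  rw [Set.mem_ofPred_eq] at ht ⊢
  rw [Polynomial.IsRoot.def, hq, ht]

namespace LieAlgebra

open LieSubalgebra

variable {L : Type*} [LieRing L] [LieAlgebra ℂ L]

theorem map_mem_engel_iff (φ : L ≃ₗ⁅ℂ⁆ L) (x y : L) :
    φ y ∈ engel ℂ (φ x) ↔ y ∈ engel ℂ x := by
  have key (n : ℕ) : ((ad ℂ L (φ x)) ^ n) (φ y) = φ (((ad ℂ L x) ^ n) y) := by
    induction n with
    | zero => simp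
    | succ n ih =>
      rw [pow_succ', pow_succ', End.mul_apply, End.mul_apply, ih, ad_apply, ad_apply,
        LieEquiv.map_lie]
  simp [mem_engel_iff, key]

theorem lie_eq_zero_of_mem_engel {s : L} (hs : (ad ℂ L s).IsSemisimple) :
    ∀ u ∈ engel ℂ s, ⁅s, u⁆ = 0 := by
  intro u hu
  replace hu : u ∈ (ad ℂ L s).maxGenEigenspace 0 := hu
  rw [hs.isFinitelySemisimple.maxGenEigenspace_eq_eigenspace, End.mem_eigenspace_iff] at hu
  simpa using hu

variable [FiniteDimensional ℂ L]

theorem engel_le_engel_of_isRegular {x y : L} (hx : IsRegular ℂ x) (hy : y ∈ engel ℂ x) :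
    engel ℂ x ≤ engel ℂ y := by
  set Ex : {engel ℂ z | z ∈ engel ℂ x} := ⟨engel ℂ x, x, self_mem_engel _ _, rfl⟩
  suffices IsBot Ex from @this ⟨engel ℂ y, y, hy, rfl⟩
  apply engel_isBot_of_isMin ((Cardinal.natCast_lt_aleph0).le.trans (Cardinal.aleph0_le_mk ℂ))
    (engel ℂ x) Ex le_rfl
  rintro ⟨_, y, hy, rfl⟩ hyx
  suffices finrank ℂ (engel ℂ x) ≤ finrank ℂ (engel ℂ y) by
    suffices engel ℂ y = engel ℂ x from this.ge
    apply LieSubalgebra.toSubmodule_injective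
    exact Submodule.eq_of_le_of_finrank_le hyx this
  rw [(isRegular_iff_finrank_engel_eq_rank ℂ x).mp hx]
  apply rank_le_finrank_engel

theorem engel_eq_engel_of_isRegular {x y : L} (hx : IsRegular ℂ x) (hy : IsRegular ℂ y)
    (hxy : y ∈ engel ℂ x) : engel ℂ x = engel ℂ y := by
  apply LieSubalgebra.toSubmodule_injective
  refine Submodule.eq_of_le_of_finrank_le (engel_le_engel_of_isRegular hx hxy) (le_of_eq ?_)
  rw [isRegular_iff_finrank_engel_eq_rank] at hx hy
  exact hy.trans hx.symm

theorem isRegular_map_iff (φ : L ≃ₗ⁅ℂ⁆ L) (x : L) : IsRegular ℂ (φ x) ↔ IsRegular ℂ x := by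
  rw [isRegular_iff_finrank_engel_eq_rank, isRegular_iff_finrank_engel_eq_rank]
  have : (engel ℂ (φ x)).toSubmodule = (engel ℂ x).toSubmodule.map φ.toLinearEquiv.toLinearMap := by
    ext y
    obtain ⟨y, rfl⟩ := φ.surjective y
    constructor
    · intro h
      exact ⟨y, (map_mem_engel_iff φ x y).mp h, rfl⟩
    · rintro ⟨z, hz, h⟩
      rw [← h]
      exact (map_mem_engel_iff φ x z).mpr hz
  have h2 := congrArg (fun W : Submodule ℂ L ↦ finrank ℂ W) this
  simp only [LinearEquiv.finrank_map_eq] at h2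
  exact ⟨fun h ↦ h2.symm.trans h, fun h ↦ h2.trans h⟩

theorem finite_not_isRegular_line (x v : L) {t₀ : ℂ} (h : IsRegular ℂ (x + t₀ • v)) :
    {t : ℂ | ¬ IsRegular ℂ (x + t • v)}.Finite := by
  classical
  let b := finBasis ℂ L
  simp only [isRegular_iff_coeff_polyCharpoly_rank_ne_zero ℂ b, not_not, map_add, map_smul,
    Finsupp.coe_add, Finsupp.coe_smul] at h ⊢
  exact MvPolynomial.finite_eval_line_eq_zero _ _ _ h

theorem exists_eq_lie_add_engel (x v : L) : ∃ w : L, ∃ u ∈ engel ℂ x, v = ⁅w, x⁆ + u := by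
  obtain ⟨n, h1, h2⟩ := ((LinearMap.eventually_isCompl_ker_pow_range_pow (ad ℂ L x)).and
    (eventually_ge_atTop 1)).exists
  obtain ⟨u, hu, w, ⟨z, rfl⟩, rfl⟩ :=
    Submodule.mem_sup.mp (h1.sup_eq_top ▸ Submodule.mem_top (x := v))
  obtain ⟨n, rfl⟩ := Nat.exists_eq_add_of_le h2
  refine ⟨-((ad ℂ L x ^ n) z), u, (mem_engel_iff ℂ x u).mpr ⟨_, hu⟩, ?_⟩
  rw [pow_add, pow_one, End.mul_apply, ad_apply, neg_lie, lie_skew, add_comm]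

/-- The Engel subalgebras of regular elements are conjugate. -/
theorem exists_engel_equiv {x y : L} (hx : IsRegular ℂ x) (hy : IsRegular ℂ y) :
    ∃ φ : L ≃ₗ⁅ℂ⁆ L, ∀ z, φ z ∈ engel ℂ y ↔ z ∈ engel ℂ x := by
  obtain ⟨Φ, -, hΦ⟩ := exists_exp_ad (L := L)
  have h0 : x + (0 : ℂ) • (y - x) = x := by simp
  have h1 : x + (1 : ℂ) • (y - x) = y := by simp
  have key := rel_of_eventually_rel
    (finite_not_isRegular_line x (y - x) (t₀ := 0) (by rwa [h0]))
    (fun s t ↦ ∃ φ : L ≃ₗ⁅ℂ⁆ L, ∀ z,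
      φ z ∈ engel ℂ (x + t • (y - x)) ↔ z ∈ engel ℂ (x + s • (y - x)))
    (fun s t ⟨φ, hφ⟩ ↦ ⟨φ.symm, fun z ↦ by rw [← hφ, LieEquiv.apply_symm_apply]⟩)
    (fun s t u ⟨φ, hφ⟩ ⟨ψ, hψ⟩ ↦ ⟨φ.trans ψ, fun z ↦ by rw [← hφ, ← hψ]; rfl⟩)
    (fun s hs ↦ ?_) (x := 0) (y := 1) (by simpa [h0] using hx) (by simpa [h1] using hy)
  · simpa only [h0, h1] using key
  · simp only [Set.mem_ofPred_eq, not_not] at hs ⊢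
    have h2 := hΦ ⊤ (engel ℂ (x + s • (y - x))).toSubmodule (x + s • (y - x))
      (fun v ↦ (exists_eq_lie_add_engel _ v).imp fun _ h ↦ ⟨trivial, h⟩) (y - x)
    have h3 : Tendsto (fun t : ℂ ↦ t - s) (𝓝 s) (𝓝 0) := by
      have : Continuous (fun t : ℂ ↦ t - s) := by fun_prop
      simpa using this.tendsto s
    filter_upwards [h3.eventually h2]
    rintro t ⟨w, -, u, hu, he⟩ ht
    have h4 : Φ w (x + s • (y - x) + u) = x + t • (y - x) := by rw [he]; module
    rw [← h4, isRegular_map_iff] at ht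
    refine ⟨Φ w, fun z ↦ ?_⟩
    rw [← h4, map_mem_engel_iff, ← engel_eq_engel_of_isRegular hs ht
      (add_mem (self_mem_engel ℂ _) hu)]

theorem exists_isRegular_lie_eq_zero {s : L} (hs : ∀ u ∈ engel ℂ s, ⁅s, u⁆ = 0) :
    ∃ y : L, IsRegular ℂ y ∧ ⁅s, y⁆ = 0 := by
  obtain ⟨Φ, -, hΦ⟩ := exists_exp_ad (L := L)
  obtain ⟨y, hy⟩ := exists_isRegular ℂ L
  have hfin := finite_not_isRegular_line s (y - s) (t₀ := 1) (by simpa using hy)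
  have h1 := hΦ ⊤ (engel ℂ s).toSubmodule s
    (fun v ↦ (exists_eq_lie_add_engel _ v).imp fun _ h ↦ ⟨trivial, h⟩) (y - s)
  obtain ⟨t, ht, w, -, u, hu, he⟩ := exists_notMem_of_eventually hfin h1
  simp only [Set.mem_ofPred_eq, not_not] at ht
  rw [← he, isRegular_map_iff] at ht
  exact ⟨_, ht, by rw [lie_add, lie_self, hs u hu, add_zero]⟩

end LieAlgebra

namespace E8

open LieAlgebra LieSubalgebra Module

/-- The half-sum of the positive roots. -/
def weylVector : Lattice := ![46, 68, 91, 135, 110, 84, 57, 29]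

theorem form_simple_weylVector (i : Fin 8) : form (simple i).1 weylVector = 1 := by
  revert i; decide +kernel

theorem form_weylVector_ne_zero (α : Root) : form weylVector α.1 ≠ 0 := by
  have h : ∀ x : Lattice, form weylVector x = ∑ i, x i := fun x ↦ by
    rw [form_comm, Model.form_eq_sum]
    simp [← simple_val, form_simple_weylVector]
  have h2 : ∀ x : Lattice, 0 ≤ x → ∑ i, x i = 0 → x = 0 := fun x hx h ↦ by
    ext i
    exact (Finset.sum_eq_zero_iff_of_nonneg fun i _ ↦ hx i).mp h i (Finset.mem_univ i)
  have h3 : α.1 ≠ 0 := fun h ↦ by have := α.2; simp [h, form_zero_right] at this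
  intro h0
  rcases nonneg_or_nonpos α with h1 | h1
  · exact h3 (h2 _ h1 (by rw [← h, h0]))
  · exact h3 (neg_eq_zero.mp (h2 _ h1 (by rw [← h, form_neg_right, h0, neg_zero])))

namespace Model

theorem repr_lie_torus (c : Fin 8 → ℂ) (x : Model) (a : Idx) :
    basis.repr ⁅torus c, x⁆ a = pairing c (weight a) * basis.repr x a := by
  have h : (basis.coord a) ∘ₗ ad ℂ Model (torus c) =
      pairing c (weight a) • basis.coord a := by
    refine basis.ext fun b ↦ ?_
    simp only [LinearMap.comp_apply, ad_apply, lie_torus_basis, LinearMap.smul_apply, map_smul,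
      Basis.coord_apply, Basis.repr_self, smul_eq_mul]
    rcases eq_or_ne b a with rfl | hab
    · rfl
    · simp [Finsupp.single_eq_of_ne hab.symm]
  exact LinearMap.congr_fun h x

theorem lie_torus_eq_smul_iff (c : Fin 8 → ℂ) (x : Model) (μ : ℂ) :
    ⁅torus c, x⁆ = μ • x ↔ ∀ a, pairing c (weight a) = μ ∨ basis.repr x a = 0 := by
  rw [← basis.repr.injective.eq_iff, Finsupp.ext_iff]
  refine forall_congr' fun a ↦ ?_
  rw [repr_lie_torus, map_smul, Finsupp.smul_apply, smul_eq_mul, mul_eq_mul_right_iff]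

theorem lie_torus_of_mem_engel (c : Fin 8 → ℂ) : ∀ x ∈ engel ℂ (torus c), ⁅torus c, x⁆ = 0 := by
  intro x hx
  obtain ⟨n, hn⟩ := (mem_engel_iff ℂ _ _).mp hx
  have h (m : ℕ) (a : Idx) : basis.repr ((ad ℂ Model (torus c) ^ m) x) a =
      pairing c (weight a) ^ m * basis.repr x a := by
    induction m with
    | zero => simp
    | succ m ih => rw [pow_succ', End.mul_apply, ad_apply, repr_lie_torus, ih]; ring
  rw [← zero_smul ℂ x, lie_torus_eq_smul_iff]
  intro a
  have h1 := h n a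
  rw [hn, map_zero, Finsupp.zero_apply, eq_comm, mul_eq_zero] at h1
  exact h1.imp_left eq_zero_of_pow_eq_zero

theorem exists_eq_torus_of_lie_eq_zero {x : Model} (h : ⁅cart weylVector, x⁆ = 0) :
    ∃ c, x = torus c := by
  rw [← torus_intCast, ← zero_smul ℂ x, lie_torus_eq_smul_iff] at h
  refine ⟨fun i ↦ basis.repr x (.inl i), ?_⟩
  conv_lhs => rw [eq_torus_add_sum x]
  rw [Finset.sum_eq_zero, add_zero]
  intro α _
  rcases h (.inr α) with h1 | h1
  · rw [pairing_intCast] at h1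
    exact absurd (by exact_mod_cast h1) (form_weylVector_ne_zero α)
  · rw [h1, zero_smul]

/-- Every element with semisimple adjoint action is conjugate to an element of the Cartan
subalgebra. -/
theorem exists_equiv_eq_torus {s : Model} (hs : (ad ℂ Model s).IsSemisimple) :
    ∃ (φ : Model ≃ₗ⁅ℂ⁆ Model) (c : Fin 8 → ℂ), φ s = torus c := by
  obtain ⟨y, hy, hsy⟩ := exists_isRegular_lie_eq_zero (lie_eq_zero_of_mem_engel hs)
  obtain ⟨z, hz, hxz⟩ := exists_isRegular_lie_eq_zero (lie_torus_of_mem_engel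
    (fun i ↦ (weylVector i : ℂ)))
  have mem {u v : Model} (h : ⁅u, v⁆ = 0) : u ∈ engel ℂ v :=
    (mem_engel_iff ℂ _ _).mpr ⟨1, by rw [pow_one, ad_apply, ← lie_skew, h, neg_zero]⟩
  obtain ⟨φ, hφ⟩ := exists_engel_equiv hy hz
  obtain ⟨c, hc⟩ := exists_eq_torus_of_lie_eq_zero (lie_torus_of_mem_engel _ _
    (engel_le_engel_of_isRegular hz (mem hxz) ((hφ s).mpr (mem hsy))))
  exact ⟨φ, c, hc⟩

end Model

end E8

namespace E8.Model

open LieAlgebra Module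

theorem form_smul_left (m : ℤ) (x y : Lattice) : form (m • x) y = m * form x y := by
  rw [form_eq_sum, form_eq_sum x, Finset.mul_sum]
  simp [mul_assoc]

theorem exists_reflection (α : Root) (x : Lattice) :
    ∃ φ : Model ≃ₗ⁅ℂ⁆ Model, φ (cart x) = cart (x - form x α.1 • α.1) := by
  obtain ⟨Φ, hΦ, -⟩ := exists_exp_ad (L := Model)
  have h0 : ⁅vec α.1, vec (-α.1)⁆ = -cart α.1 := lie_vec_neg α
  have h0' : ⁅vec (-α.1), vec α.1⁆ = cart α.1 := by rw [← lie_skew, h0, neg_neg]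
  have hα : form α.1 α.1 = 2 := α.2
  have ha (y : Lattice) : Φ (vec α.1) (cart y) = cart y - (form y α.1 : ℂ) • vec α.1 := by
    have h1 : ⁅vec α.1, cart y⁆ = -(form y α.1 : ℂ) • vec α.1 := by
      rw [← lie_skew, lie_cart_vec, neg_smul]
    have h2 : ⁅vec α.1, ⁅vec α.1, cart y⁆⁆ = 0 := by rw [h1, lie_smul, lie_self, smul_zero]
    rw [hΦ _ _ (by rw [h2, lie_zero]), h2, h1, smul_zero, add_zero, neg_smul, sub_eq_add_neg]
  have hb (y : Lattice) : Φ (vec (-α.1)) (cart y) =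
      cart y + (form y α.1 : ℂ) • vec (-α.1) := by
    have h1 : ⁅vec (-α.1), cart y⁆ = (form y α.1 : ℂ) • vec (-α.1) := by
      rw [← lie_skew, lie_cart_vec, form_neg_right, Int.cast_neg, neg_smul, neg_neg]
    have h2 : ⁅vec (-α.1), ⁅vec (-α.1), cart y⁆⁆ = 0 := by
      rw [h1, lie_smul, lie_self, smul_zero]
    rw [hΦ _ _ (by rw [h2, lie_zero]), h2, h1, smul_zero, add_zero]
  have haa : Φ (vec α.1) (vec α.1) = vec α.1 := by
    rw [hΦ _ _ (by simp)]; simp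
  have hba : Φ (vec (-α.1)) (vec α.1) = vec α.1 + cart α.1 + vec (-α.1) := by
    have h2 : ⁅vec (-α.1), ⁅vec (-α.1), vec α.1⁆⁆ = (2 : ℂ) • vec (-α.1) := by
      rw [h0', ← lie_skew, lie_cart_vec, form_neg_right, hα]
      simp
    rw [hΦ _ _ (by rw [h2, lie_smul, lie_self, smul_zero]), h2, h0', smul_smul]
    norm_num
  refine ⟨(Φ (vec α.1)).trans ((Φ (vec (-α.1))).trans (Φ (vec α.1))), ?_⟩
  simp only [LieEquiv.trans_apply, ha, hb, map_sub, map_add, map_smul, hba, haa]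
  have h3 : cart (x - form x α.1 • α.1) = cart x - (form x α.1 : ℂ) • cart α.1 := by
    simp only [cart, Pi.sub_apply, Pi.smul_apply, smul_eq_mul, Int.cast_sub, Int.cast_mul,
      sub_smul, Finset.sum_sub_distrib, mul_smul, Finset.smul_sum]
  rw [h3, hα]
  push_cast
  module

theorem exists_equiv_dominant (x : Lattice) : ∃ (φ : Model ≃ₗ⁅ℂ⁆ Model) (y : Lattice),
    φ (cart x) = cart y ∧ ∀ i, 0 ≤ form y (simple i).1 := by
  induction h : (form (x - weylVector) (x - weylVector)).toNat using Nat.strong_induction_on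
    generalizing x with
  | _ n ih =>
  by_cases hx : ∀ i, 0 ≤ form x (simple i).1
  · exact ⟨LieEquiv.refl, x, rfl, hx⟩
  · push Not at hx
    obtain ⟨i, hi⟩ := hx
    obtain ⟨φ, hφ⟩ := exists_reflection (simple i) x
    set m := form x (simple i).1 with hm
    have h1 := form_simple_weylVector i
    have h2 := (simple i).2
    have h3 : form (x - m • (simple i).1 - weylVector) (x - m • (simple i).1 - weylVector) =
        form (x - weylVector) (x - weylVector) + 2 * m := by
      simp only [form_sub_left, form_sub_right, form_smul_left, form_comm x (_ • _),
        form_comm weylVector (_ • _), form_comm (simple i).1 x, h1, h2, ← hm,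
        form_comm (simple i).1 (_ • _)]
      ring
    obtain ⟨ψ, y, hy, hy'⟩ := ih ((form (x - m • (simple i).1 - weylVector)
        (x - m • (simple i).1 - weylVector)).toNat) (by
      have := form_self_nonneg (x - m • (simple i).1 - weylVector); omega) _ rfl
    exact ⟨φ.trans ψ, y, by rw [LieEquiv.trans_apply, hφ, hy], hy'⟩

end E8.Model

namespace JacobsonMorozov

open Module LieAlgebra

/-- The properties of a characteristic `s` of a nilpotent element `e` used below. -/
structure IsGood {L : Type*} [LieRing L] [LieAlgebra ℂ L] (s e : L) : Prop where
  lie_eq : ⁅s, e⁆ = (2 : ℂ) • e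
  isNilpotent : IsNilpotent (ad ℂ L e)
  exists_nat : ∀ (μ : ℂ) (x : L), ⁅s, x⁆ = μ • x → ⁅e, x⁆ = 0 → x ≠ 0 → ∃ n : ℕ, μ = n
  exists_lie_eq : ∀ z : L, ⁅s, z⁆ = (2 : ℂ) • z → ∃ w : L, ⁅s, w⁆ = 0 ∧ ⁅e, w⁆ = z
  finrank_eq : finrank ℂ ((ad ℂ L s).eigenspace 0) + finrank ℂ ((ad ℂ L s).eigenspace (-1)) =
    finrank ℂ (LinearMap.ker (ad ℂ L e))

variable {L : Type*} [LieRing L] [LieAlgebra ℂ L]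

theorem exists_isGood [FiniteDimensional ℂ L] [IsKilling ℂ L] {e : L}
    (he : IsNilpotent (ad ℂ L e)) : ∃ s : L, (ad ℂ L s).IsSemisimple ∧ IsGood s e := by
  obtain ⟨s, h, y, hs, hg⟩ := exists_isGrading he
  refine ⟨s, hg.isSemisimple, hs, he, fun μ x h1 h2 h3 ↦ hg.exists_nat_of_mem_ker h1 h2 h3,
    fun z hz ↦ ?_, hg.finrank_ker.symm⟩
  obtain ⟨w, h1, h2⟩ := hg.exists_apply_eq (lam := 2) (fun n hn ↦ by
    have : ((2 + n : ℕ) : ℂ) = 0 := by push_cast; rw [hn]; ring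
    rw [Nat.cast_eq_zero] at this; omega) hz
  exact ⟨w, by simpa using h1, h2⟩

section

variable {L' : Type*} [LieRing L'] [LieAlgebra ℂ L']

theorem map_eq_of_equiv (φ : L ≃ₗ⁅ℂ⁆ L') (V : Submodule ℂ L) (W : Submodule ℂ L')
    (h : ∀ x, φ x ∈ W ↔ x ∈ V) : V.map φ.toLinearEquiv.toLinearMap = W := by
  ext y
  obtain ⟨y, rfl⟩ := EquivLike.surjective φ y
  rw [h]
  refine ⟨?_, fun hy ↦ ⟨y, hy, rfl⟩⟩
  rintro ⟨z, hz, h1⟩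
  rwa [← EquivLike.injective φ h1]

theorem finrank_map_eq_of_equiv (φ : L ≃ₗ⁅ℂ⁆ L') (V : Submodule ℂ L) (W : Submodule ℂ L')
    (h : ∀ x, φ x ∈ W ↔ x ∈ V) : finrank ℂ W = finrank ℂ V := by
  rw [← map_eq_of_equiv φ V W h, LinearEquiv.finrank_map_eq]

end

theorem IsGood.map [FiniteDimensional ℂ L] {s e : L} (h : IsGood s e) (φ : L ≃ₗ⁅ℂ⁆ L) :
    IsGood (φ s) (φ e) := by
  have key (u x : L) (μ : ℂ) : ⁅φ u, φ x⁆ = μ • φ x ↔ ⁅u, x⁆ = μ • x := by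
    rw [← LieEquiv.map_lie, ← map_smul, (EquivLike.injective φ).eq_iff]
  have key0 (u x y : L) : ⁅φ u, φ x⁆ = φ y ↔ ⁅u, x⁆ = y := by
    rw [← LieEquiv.map_lie, (EquivLike.injective φ).eq_iff]
  have keyz (u x : L) : ⁅φ u, φ x⁆ = 0 ↔ ⁅u, x⁆ = 0 := by
    rw [← key0 u x 0, map_zero]
  constructor
  · rw [key, h.lie_eq]
  · obtain ⟨n, hn⟩ := h.isNilpotent
    refine ⟨n, LinearMap.ext fun y ↦ ?_⟩
    obtain ⟨y, rfl⟩ := EquivLike.surjective φ y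
    have (n : ℕ) : ((ad ℂ L (φ e)) ^ n) (φ y) = φ (((ad ℂ L e) ^ n) y) := by
      induction n with
      | zero => simp
      | succ n ih =>
        rw [pow_succ', pow_succ', End.mul_apply, End.mul_apply, ih, ad_apply, ad_apply,
          LieEquiv.map_lie]
    rw [this, hn]
    simp
  · intro μ x
    obtain ⟨x, rfl⟩ := EquivLike.surjective φ x
    rw [key, keyz, map_ne_zero_iff _ (EquivLike.injective φ)]
    exact h.exists_nat μ x
  · intro z
    obtain ⟨z, rfl⟩ := EquivLike.surjective φ z
    rw [key]
    intro hz
    obtain ⟨w, h1, h2⟩ := h.exists_lie_eq z hz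
    exact ⟨φ w, (keyz _ _).mpr h1, (key0 _ _ _).mpr h2⟩
  · have h1 (μ : ℂ) := finrank_map_eq_of_equiv φ ((ad ℂ L s).eigenspace μ)
      ((ad ℂ L (φ s)).eigenspace μ) fun x ↦ by
        rw [End.mem_eigenspace_iff, End.mem_eigenspace_iff]; exact key s x _
    have h2 := finrank_map_eq_of_equiv φ (LinearMap.ker (ad ℂ L e))
      (LinearMap.ker (ad ℂ L (φ e))) fun x ↦ by
        rw [LinearMap.mem_ker, LinearMap.mem_ker]; exact keyz e x
    rw [h1, h1, h2, h.finrank_eq]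

theorem IsGood.exists_int {s e : L} (h : IsGood s e) {μ : ℂ} {x : L} (hx : ⁅s, x⁆ = μ • x)
    (hx0 : x ≠ 0) : ∃ m : ℤ, μ = m := by
  obtain ⟨N, hN⟩ := h.isNilpotent
  have key (k : ℕ) : ∀ (μ : ℂ) (x : L), ⁅s, x⁆ = μ • x → x ≠ 0 → (ad ℂ L e ^ k) x = 0 →
      ∃ m : ℤ, μ = m := by
    induction k with
    | zero => exact fun μ x _ h0 h1 ↦ absurd (by simpa using h1) h0
    | succ k ih =>
      intro μ x h1 h2 h3
      by_cases h4 : ⁅e, x⁆ = 0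
      · obtain ⟨n, hn⟩ := h.exists_nat μ x h1 h4 h2
        exact ⟨n, by simp [hn]⟩
      · obtain ⟨m, hm⟩ := ih (μ + 2) ⁅e, x⁆
          (by rw [leibniz_lie, h.lie_eq, h1, lie_smul, smul_lie, ← add_smul, add_comm]) h4
          (by rwa [pow_succ, End.mul_apply] at h3)
        exact ⟨m - 2, by push_cast; rw [← hm]; ring⟩
  exact key N μ x hx hx0 (by rw [hN]; rfl)

end JacobsonMorozov

namespace E8.Model

open LieAlgebra Module JacobsonMorozov

/-- Every nilpotent element has, up to conjugacy, a dominant integral characteristic. -/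
theorem exists_equiv_isGood {e : Model} (he : IsNilpotent (ad ℂ Model e)) :
    ∃ (φ : Model ≃ₗ⁅ℂ⁆ Model) (x : Lattice), (∀ i, 0 ≤ form x (simple i).1) ∧
      IsGood (cart x) (φ e) := by
  obtain ⟨s, hs, h⟩ := exists_isGood he
  obtain ⟨φ, c, hc⟩ := exists_equiv_eq_torus hs
  replace h := h.map φ
  rw [hc] at h
  have h_int (α : Root) : ∃ m : ℤ, pairing c α.1 = m :=
    h.exists_int (lie_torus_vec c α.1) (vec_ne_zero α)
  choose f hf using h_int
  have hc' (k : Fin 8) : ∃ m : ℤ, c k = m := by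
    refine ⟨∑ i, fundamental k i * f (simple i), ?_⟩
    rw [← pairing_fundamental c k, pairing_eq_sum]
    push_cast
    simp [hf]
  choose x hx using hc'
  obtain rfl : c = fun i ↦ (x i : ℂ) := funext hx
  rw [torus_intCast] at h
  obtain ⟨ψ, y, hy, hy'⟩ := exists_equiv_dominant x
  replace h := h.map ψ
  rw [hy] at h
  exact ⟨φ.trans ψ, y, hy', h⟩

end E8.Model

namespace E8

open Module LieAlgebra

/-- The scalar product of two coordinate lists. -/
def dot : List ℕ → List ℕ → ℕ
  | a :: l, b :: m => a * b + dot l m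
  | _, _ => 0

theorem dot_nil_right (l : List ℕ) : dot l [] = 0 := by cases l <;> rfl

theorem dot_cons_right (l : List ℕ) (b : ℕ) (m : List ℕ) :
    dot l (b :: m) = l.headD 0 * b + dot l.tail m := by
  cases l with
  | nil => cases m <;> simp [dot]
  | cons a l => rfl

/-- The sum of the deficiencies `2 - (a + dot l m)`, where `(a, l)` runs over a list of affine
functions. -/
def deficiency (s : List (ℕ × List ℕ)) (m : List ℕ) : ℕ :=
  (s.map fun p ↦ 2 - (p.1 + dot p.2 m)).sum

/-- Substitution of a value for the first variable, dropping functions that are at least two. -/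
def substHead (b : ℕ) (s : List (ℕ × List ℕ)) : List (ℕ × List ℕ) :=
  (s.map fun p ↦ (p.1 + p.2.headD 0 * b, p.2.tail)).filter fun p ↦ p.1 < 2

theorem deficiency_substHead (b : ℕ) (s : List (ℕ × List ℕ)) (m : List ℕ) :
    deficiency (substHead b s) m = deficiency s (b :: m) := by
  induction s with
  | nil => rfl
  | cons p s ih =>
    simp only [deficiency, substHead, List.map_cons, List.sum_cons, List.filter_cons,
      dot_cons_right] at ih ⊢
    split_ifs with h
    · rw [List.map_cons, List.sum_cons, ih]
      simp only [add_assoc]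
    · rw [ih]
      simp only [decide_eq_true_eq] at h
      omega

theorem substHead_eq (b : ℕ) (hb : 2 ≤ b) (s : List (ℕ × List ℕ)) :
    substHead b s = substHead 2 s := by
  induction s with
  | nil => rfl
  | cons p s ih =>
    simp only [substHead, List.map_cons, List.filter_cons] at ih ⊢
    rw [ih]
    rcases Nat.eq_zero_or_pos (p.2.headD 0) with h | h
    · rw [h, zero_mul, zero_mul]
    · have : 2 ≤ p.2.headD 0 * b := by nlinarith
      rw [if_neg (by simp only [decide_eq_true_eq]; omega),
        if_neg (by simp only [decide_eq_true_eq]; omega)]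

theorem deficiency_le (s : List (ℕ × List ℕ)) (m : List ℕ) :
    deficiency s m ≤ deficiency s [] :=
  List.sum_le_sum fun p _ ↦ by rw [dot_nil_right]; omega

/-- A search for the lists with deficiency 76, comparing them with a given one. -/
def search : ℕ → List (ℕ × List ℕ) → Option (List ℕ) → Bool
  | 0, s, t => (deficiency s [] != 76) || t == some []
  | n + 1, s, t => decide (deficiency s [] < 76) ||
    [0, 1, 2].all fun b ↦ search n (substHead b s)
      (t.bind fun l ↦ if l.head? = some b ∧ b < 2 then some l.tail else none)

theorem eq_some_of_search {n : ℕ} {s : List (ℕ × List ℕ)} {t : Option (List ℕ)}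
    (h : search n s t = true) {m : List ℕ} (hm : m.length = n) (h76 : deficiency s m = 76) :
    t = some m := by
  induction n generalizing s t m with
  | zero =>
    obtain rfl := List.length_eq_zero_iff.mp hm
    simpa [search, h76] using h
  | succ n ih =>
    obtain ⟨b, m, rfl⟩ := List.exists_cons_of_length_eq_add_one hm
    have hle := deficiency_le s (b :: m)
    simp only [search, Bool.or_eq_true, decide_eq_true_eq, List.all_cons, List.all_nil,
      Bool.and_true, Bool.and_eq_true] at h
    rcases h with h | ⟨h0, h1, h2⟩
    · omega
    have hm' : m.length = n := by simpa using hm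
    have key (b : ℕ) (h : search n (substHead b s)
        (t.bind fun l ↦ if l.head? = some b ∧ b < 2 then some l.tail else none) = true)
        (h76 : deficiency s (b :: m) = 76) : t = some (b :: m) ∧ b < 2 := by
      have h3 := ih h hm' (by rw [deficiency_substHead, h76])
      obtain ⟨l, rfl, h4⟩ := Option.bind_eq_some_iff.mp h3
      split_ifs at h4 with h5
      obtain ⟨c, l, rfl⟩ : ∃ c l', l = c :: l' := by
        cases l with
        | nil => simp at h5
        | cons c l => exact ⟨c, l, rfl⟩
      simp at h4 h5
      simp [h4, h5]
    obtain rfl | rfl | hb : b = 0 ∨ b = 1 ∨ 2 ≤ b := by omega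
    · exact (key 0 h0 h76).1
    · exact (key 1 h1 h76).1
    · rw [← deficiency_substHead, substHead_eq b hb, deficiency_substHead] at h76
      exact absurd (key 2 h2 h76).2 (by omega)

theorem search_posTable :
    search 8 (posTable.map fun l ↦ (0, l)) (some [0, 0, 0, 0, 0, 1, 0, 1]) = true := by
  decide +kernel

/-- The labels of a lattice vector on the simple roots. -/
def labels (x : Lattice) : List ℕ := List.ofFn fun i ↦ (form x (simple i).1).toNat

theorem form_ofCoords {x : Lattice} (hx : ∀ i, 0 ≤ form x (simple i).1) {l : List ℕ}
    (hl : l.length = 8) : form x (ofCoords (l.map (Nat.cast : ℕ → ℤ))) = dot l (labels x) := by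
  have h (i : Fin 8) : ((form x (simple i).1).toNat : ℤ) = form (Pi.single i 1) x := by
    rw [Int.toNat_of_nonneg (hx i), form_comm, simple_val]
  obtain ⟨a, b, c, d, e, f, g, k, rfl⟩ : ∃ a b c d e f g k, l = [a, b, c, d, e, f, g, k] := by
    match l, hl with
    | [a, b, c, d, e, f, g, k], _ => exact ⟨a, b, c, d, e, f, g, k, rfl⟩
  rw [form_comm, Model.form_eq_sum]
  simp only [labels, List.ofFn_succ, dot, Nat.cast_add, Nat.cast_mul, h, Fin.sum_univ_eight, ofCoords]
  simp
  ring

/-- The characteristic of the nilpotent orbit with centralizer of dimension 84. -/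
def charVec : Lattice := ![8, 12, 16, 24, 20, 16, 11, 6]

theorem eq_charVec {x : Lattice} (hx : ∀ i, 0 ≤ form x (simple i).1)
    (h : deficiency (posTable.map fun l ↦ (0, l)) (labels x) = 76) : x = charVec := by
  have h1 := eq_some_of_search search_posTable (by simp [labels]) h
  simp only [Option.some.injEq] at h1
  refine eq_of_form_simple_eq fun i ↦ ?_
  have h2 : (form x (simple i).1).toNat = (labels x).getD i 0 := by
    rw [labels, List.getD_eq_getElem _ _ (by simp), List.getElem_ofFn]
  have h3 := hx i
  rw [← h1] at h2
  have h4 : ∀ i, form charVec (simple i).1 = ([0, 0, 0, 0, 0, 1, 0, 1].getD i 0 : ℕ) := by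
    decide +kernel
  have h5 := h4 i
  rw [form_comm, form_comm _ charVec]
  omega

theorem sum_root (f : Lattice → ℕ) : ∑ α : Root, f α.1 =
    (posList.map fun x ↦ f x + f (-x)).sum := by
  have hnd : (posList ++ posList.map (-·)).Nodup := by
    refine List.Nodup.append posList_nodup (posList_nodup.map neg_injective) fun x h1 h2 ↦ ?_
    obtain ⟨y, h3, rfl⟩ := List.mem_map.mp h2
    have h4 := nonneg_of_mem_posList h1
    have h5 := nonneg_of_mem_posList h3
    have h6 : y = 0 := le_antisymm (neg_nonneg.mp h4) h5
    have h7 := form_self_of_mem_posList h3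
    simp [h6, form_zero_right] at h7
  let j : Root ↪ Lattice := ⟨Subtype.val, Subtype.val_injective⟩
  have h1 : Finset.univ.map j =
      (posList ++ posList.map (-·)).toFinset := by
    ext x
    simp only [Finset.mem_map, Finset.mem_univ, true_and, List.mem_toFinset, List.mem_append]
    constructor
    · rintro ⟨α, rfl⟩
      change α.1 ∈ _ ∨ α.1 ∈ _
      refine (nonneg_or_nonpos α).imp mem_posList fun h ↦ ?_
      exact List.mem_map.mpr ⟨-α.1, mem_posList (α := -α) h, neg_neg _⟩
    · rintro (h | h)
      · exact ⟨⟨x, form_self_of_mem_posList h⟩, rfl⟩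
      · obtain ⟨y, hy, rfl⟩ := List.mem_map.mp h
        refine ⟨⟨-y, ?_⟩, rfl⟩
        rw [form_neg_left, form_neg_right, neg_neg, form_self_of_mem_posList hy]
  calc ∑ α : Root, f α.1 = ∑ x ∈ Finset.univ.map j, f x := by
        rw [Finset.sum_map]; rfl
    _ = _ := by
        rw [h1, List.sum_toFinset _ hnd, List.map_append, List.sum_append, List.map_map,
          List.sum_map_add]
        rfl

namespace Model

theorem finrank_eigenspace_cart (x : Lattice) (m : ℤ) :
    finrank ℂ ((ad ℂ Model (cart x)).eigenspace m) =
      (if m = 0 then 8 else 0) + (posList.map fun y ↦ (if form x y = m then 1 else 0) +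
        if form x y = -m then 1 else 0).sum := by
  classical
  have h1 : (ad ℂ Model (cart x)).eigenspace m =
      Submodule.span ℂ (Set.range fun a : {a : Idx // form x (weight a) = m} ↦ basis a.1) := by
    have h2 : (Set.range fun a : {a : Idx // form x (weight a) = m} ↦ basis a.1) =
        basis '' {a : Idx | form x (weight a) = m} := by
      rw [Set.image_eq_range]; rfl
    ext v
    rw [h2, Basis.mem_span_image, End.mem_eigenspace_iff, ad_apply, ← torus_intCast,
      lie_torus_eq_smul_iff]
    simp only [Set.subset_def, Finset.mem_coe, Finsupp.mem_support_iff, pairing_intCast,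
      Int.cast_inj, Set.mem_ofPred_eq]
    exact forall_congr' fun a ↦ by tauto
  have h2 : LinearIndependent ℂ fun a : {a : Idx // form x (weight a) = m} ↦ basis a.1 :=
    basis.linearIndependent.comp _ Subtype.val_injective
  rw [h1, finrank_span_eq_card h2,
    Fintype.card_subtype, Finset.card_filter, Fintype.sum_sum_type]
  refine congrArg₂ (· + ·) ?_ ?_
  · simp only [weight, form_zero_right, eq_comm]
    split_ifs <;> simp
  · refine (sum_root fun y ↦ if form x y = m then 1 else 0).trans ?_
    simp only [form_neg_right, neg_eq_iff_eq_neg]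

theorem eq_charVec_of_finrank {x : Lattice} (hx : ∀ i, 0 ≤ form x (simple i).1)
    (h : finrank ℂ ((ad ℂ Model (cart x)).eigenspace 0) +
      finrank ℂ ((ad ℂ Model (cart x)).eigenspace (-1)) = 84) : x = charVec := by
  refine eq_charVec hx ?_
  have h0 := finrank_eigenspace_cart x 0
  have h1 := finrank_eigenspace_cart x (-1)
  rw [Int.cast_zero] at h0
  rw [Int.cast_neg, Int.cast_one] at h1
  rw [h0, h1, if_pos rfl, if_neg (by decide), zero_add, add_assoc, ← List.sum_map_add] at h
  rw [deficiency, List.map_map]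
  rw [posList, List.map_map] at h
  have h2 : (76 : ℕ) + 8 = 84 := rfl
  rw [← h2, add_comm, Nat.add_right_cancel_iff] at h
  rw [← h]
  refine congrArg List.sum (List.map_congr_left fun l hl ↦ ?_)
  simp only [Function.comp_apply, zero_add]
  rw [form_ofCoords hx (posTable_spec l hl).1]
  clear h0 h1 h
  generalize dot l (labels x) = k
  rw [neg_zero, neg_neg]
  obtain _ | _ | k := k
  · simp
  · simp
  · rw [if_neg (by omega), if_neg (by omega), if_neg (by omega)]; omega

end Model

end E8

namespace JacobsonMorozov

open Module LieAlgebra Filter Topology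

variable {L : Type*} [LieRing L] [LieAlgebra ℂ L] [FiniteDimensional ℂ L]

theorem finite_not_surjective {V : Type*} [AddCommGroup V] [Module ℂ V] [FiniteDimensional ℂ V]
    (M : End ℂ V) : {t : ℂ | ¬ Function.Surjective ⇑((1 : End ℂ V) + t • M)}.Finite := by
  refine (M.finite_hasEigenvalue.preimage (f := fun t : ℂ ↦ -t⁻¹)
    (fun a _ b _ h ↦ by simpa using h)).subset fun t ht ↦ ?_
  rw [Set.mem_ofPred_eq, ← LinearMap.injective_iff_surjective, injective_iff_map_eq_zero] at ht
  push Not at ht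
  obtain ⟨v, hv, hv0⟩ := ht
  replace hv : v + t • M v = 0 := hv
  have ht : t ≠ 0 := by rintro rfl; simp at hv; exact hv0 hv
  refine End.hasEigenvalue_of_hasEigenvector (x := v) ⟨End.mem_eigenspace_iff.mpr ?_, hv0⟩
  rw [eq_comm, neg_smul, neg_eq_iff_eq_neg, inv_smul_eq_iff₀ ht, smul_neg, ← add_eq_zero_iff_eq_neg]
  exact hv

/-- Being surjective from degree zero onto degree two is a generic condition on a line. -/
theorem finite_not_surjOn {s e f : L} (hf : ⁅s, f⁆ = (2 : ℂ) • f)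
    (h : ⁅s, e⁆ = (2 : ℂ) • e)
    (he : ∀ z : L, ⁅s, z⁆ = (2 : ℂ) • z → ∃ w : L, ⁅s, w⁆ = 0 ∧ ⁅w, e⁆ = z) :
    {t : ℂ | ¬ ∀ z : L, ⁅s, z⁆ = (2 : ℂ) • z →
      ∃ w : L, ⁅s, w⁆ = 0 ∧ ⁅w, e + t • (f - e)⁆ = z}.Finite := by
  set V₀ := (ad ℂ L s).eigenspace 0
  set V₂ := (ad ℂ L s).eigenspace 2
  have mem₀ {w : L} : w ∈ V₀ ↔ ⁅s, w⁆ = 0 := by simp [V₀]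
  have mem₂ {w : L} : w ∈ V₂ ↔ ⁅s, w⁆ = (2 : ℂ) • w := by simp [V₂]
  have hmaps {x : L} (hx : ⁅s, x⁆ = (2 : ℂ) • x) : ∀ w ∈ V₀, (-ad ℂ L x) w ∈ V₂ := by
    intro w hw
    rw [mem₂, LinearMap.neg_apply, ad_apply, lie_skew, leibniz_lie, mem₀.mp hw, hx]
    simp
  have hfe : ⁅s, f - e⁆ = (2 : ℂ) • (f - e) := by rw [lie_sub, hf, h, smul_sub]
  let A (x : L) (hx : ⁅s, x⁆ = (2 : ℂ) • x) : V₀ →ₗ[ℂ] V₂ := (-ad ℂ L x).restrict (hmaps hx)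
  have hA (x hx) (w : V₀) : (A x hx w : L) = ⁅w.1, x⁆ := lie_skew _ _
  obtain ⟨R, hR⟩ := (A e h).exists_rightInverse_of_surjective (LinearMap.range_eq_top.mpr fun z ↦ by
    obtain ⟨w, h1, h2⟩ := he z (mem₂.mp z.2)
    exact ⟨⟨w, mem₀.mpr h1⟩, Subtype.ext (by rw [hA _ h, h2])⟩)
  refine (finite_not_surjective (A (f - e) hfe ∘ₗ R)).subset fun t ht hsurj ↦ ht fun z hz ↦ ?_
  obtain ⟨y, hy⟩ := hsurj ⟨z, mem₂.mpr hz⟩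
  refine ⟨R y, mem₀.mp (R y).2, ?_⟩
  have h1 := congrArg Subtype.val hy
  have h2 := congrArg Subtype.val (LinearMap.congr_fun hR y)
  simp only [LinearMap.comp_apply, hA, LinearMap.id_apply] at h2
  change y.1 + t • (A (f - e) hfe (R y) : L) = z at h1
  rw [hA _ hfe] at h1
  rw [lie_add, lie_smul, h2, h1]

/-- Two elements of degree two that are generic for the action of the subalgebra of degree zero
are conjugate. -/
theorem exists_equiv_of_surjOn {s e f : L} (h : ⁅s, e⁆ = (2 : ℂ) • e)
    (he : ∀ z : L, ⁅s, z⁆ = (2 : ℂ) • z → ∃ w : L, ⁅s, w⁆ = 0 ∧ ⁅w, e⁆ = z)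
    (h' : ⁅s, f⁆ = (2 : ℂ) • f)
    (hf : ∀ z : L, ⁅s, z⁆ = (2 : ℂ) • z → ∃ w : L, ⁅s, w⁆ = 0 ∧ ⁅w, f⁆ = z) :
    ∃ φ : L ≃ₗ⁅ℂ⁆ L, φ e = f := by
  obtain ⟨Φ, hΦ₁, hΦ⟩ := exists_exp_ad (L := L)
  set V₀ := (ad ℂ L s).eigenspace 0
  set V₂ := (ad ℂ L s).eigenspace 2
  have mem₀ {w : L} : w ∈ V₀ ↔ ⁅s, w⁆ = 0 := by simp [V₀]
  have mem₂ {w : L} : w ∈ V₂ ↔ ⁅s, w⁆ = (2 : ℂ) • w := by simp [V₂]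
  obtain ⟨Z, hZ⟩ := V₂.exists_isCompl
  have h0 : e + (0 : ℂ) • (f - e) = e := by simp
  have h1 : e + (1 : ℂ) • (f - e) = f := by simp
  have key := rel_of_eventually_rel (finite_not_surjOn h' h he)
    (fun t u ↦ ∃ φ : L ≃ₗ⁅ℂ⁆ L, φ (e + t • (f - e)) = e + u • (f - e))
    (fun t u ⟨φ, hφ⟩ ↦ ⟨φ.symm, by rw [← hφ, LieEquiv.symm_apply_apply]⟩)
    (fun t u v ⟨φ, hφ⟩ ⟨ψ, hψ⟩ ↦ ⟨φ.trans ψ, by rw [LieEquiv.trans_apply, hφ, hψ]⟩)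
    (fun t ht ↦ ?_) (x := 0) (y := 1) (by rw [Set.mem_ofPred_eq, not_not, h0]; exact he)
    (by rw [Set.mem_ofPred_eq, not_not, h1]; exact hf)
  · rwa [h0, h1] at key
  rw [Set.mem_ofPred_eq, not_not] at ht
  have h2 := hΦ V₀ Z (e + t • (f - e)) (fun v ↦ by
    obtain ⟨z, hz, u, hu, rfl⟩ := Submodule.mem_sup.mp (hZ.sup_eq_top ▸ Submodule.mem_top (x := v))
    obtain ⟨w, hw, hwz⟩ := ht z (mem₂.mp hz)
    exact ⟨w, mem₀.mpr hw, u, hu, by rw [hwz]⟩) (f - e)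
  have h3 : Tendsto (fun u : ℂ ↦ u - t) (𝓝 t) (𝓝 0) := by
    have : Continuous (fun u : ℂ ↦ u - t) := by fun_prop
    simpa using this.tendsto t
  have hmem (u : ℂ) : e + u • (f - e) ∈ V₂ :=
    add_mem (mem₂.mpr h) (V₂.smul_mem _ (sub_mem (mem₂.mpr h') (mem₂.mpr h)))
  filter_upwards [h3.eventually h2]
  rintro u ⟨w, hw, z, hz, hwz⟩ -
  have h4 : Φ w (e + t • (f - e) + z) = e + u • (f - e) := by rw [hwz]; module
  have h5 : ⁅w, s⁆ = 0 := by rw [← lie_skew, mem₀.mp hw, neg_zero]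
  have h6 : Φ w s = s := by rw [hΦ₁ _ _ (by simp [h5])]; simp [h5]
  have h7 : e + t • (f - e) + z ∈ V₂ := by
    rw [mem₂, ← (EquivLike.injective (Φ w)).eq_iff, LieEquiv.map_lie, h6, map_smul, h4]
    exact mem₂.mp (hmem u)
  have h8 : z = 0 := by
    have : z ∈ V₂ := by simpa using sub_mem h7 (hmem t)
    simpa using (Submodule.disjoint_def.mp hZ.disjoint) z this hz
  rw [h8, add_zero] at h4
  exact ⟨Φ w, h4⟩

end JacobsonMorozov

namespace E8

namespace Model

/-- An integral combination of the elements `cart x` (tagged `false`) and `vec x` (tagged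
`true`). -/
abbrev Combo : Type := List (ℤ × Bool × Lattice)

namespace Combo

/-- The element of the model described by a tagged lattice vector. -/
noncomputable def atom (t : Bool × Lattice) : Model := if t.1 then vec t.2 else cart t.2

/-- The element of the model described by a combination. -/
noncomputable def eval (l : Combo) : Model := (l.map fun t ↦ (t.1 : ℂ) • atom t.2).sum

/-- All the lattice vectors tagged `true` are roots. -/
def IsValid (l : Combo) : Prop := ∀ t ∈ l, t.2.1 = true → form t.2.2 t.2.2 = 2

instance (l : Combo) : Decidable l.IsValid := inferInstanceAs (Decidable (∀ t ∈ l, _ → _))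

/-- The bracket of two terms. -/
def lieTerm (s t : ℤ × Bool × Lattice) : ℤ × Bool × Lattice :=
  match s, t with
  | (c, true, x), (d, true, y) =>
    if x + y = 0 then (c * d * sgn x y, false, x) else (c * d * sgn x y, true, x + y)
  | (c, false, x), (d, true, y) => (c * d * form x y, true, y)
  | (c, true, x), (d, false, y) => (-(c * d * form y x), true, x)
  | (_, false, _), (_, false, _) => (0, false, 0)

/-- The bracket of two combinations. -/
def lie (l m : Combo) : Combo := l.flatMap fun s ↦ m.map (lieTerm s)

/-- Multiplication of a combination by an integer. -/
def smul (c : ℤ) (l : Combo) : Combo := l.map fun t ↦ (c * t.1, t.2)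

/-- The coefficient of a combination at a basis vector. -/
def coeff (l : Combo) : Fin 8 ⊕ Lattice → ℤ
  | .inl i => (l.map fun t ↦ if t.2.1 then 0 else t.1 * t.2.2 i).sum
  | .inr x => (l.map fun t ↦ if t.2.1 = true ∧ t.2.2 = x then t.1 else 0).sum

/-- A decidable criterion for a combination to evaluate to zero. -/
def IsNull (l : Combo) : Prop :=
  (∀ i, l.coeff (.inl i) = 0) ∧
    ∀ t ∈ l, t.2.1 = true → form t.2.2 t.2.2 = 2 → l.coeff (.inr t.2.2) = 0

instance (l : Combo) : Decidable l.IsNull := inferInstanceAs (Decidable (_ ∧ ∀ t ∈ l, _ → _ → _))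

theorem eval_nil : eval [] = 0 := rfl

theorem eval_cons (t : ℤ × Bool × Lattice) (l : Combo) :
    eval (t :: l) = (t.1 : ℂ) • atom t.2 + eval l := by simp [eval]

theorem eval_append (l m : Combo) : eval (l ++ m) = eval l + eval m := by simp [eval]

theorem eval_smul (c : ℤ) (l : Combo) : eval (smul c l) = (c : ℂ) • eval l := by
  induction l with
  | nil => simp [smul, eval_nil]
  | cons t l ih =>
    have : smul c (t :: l) = (c * t.1, t.2) :: smul c l := rfl
    rw [this, eval_cons, eval_cons, ih, smul_add, smul_smul, Int.cast_mul]

theorem lie_vec_vec {x y : Lattice} (hx : form x x = 2) (hy : form y y = 2) :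
    ⁅vec x, vec y⁆ = (sgn x y : ℂ) • if x + y = 0 then cart x else vec (x + y) := by
  set α : Root := ⟨x, hx⟩ with hα
  set β : Root := ⟨y, hy⟩ with hβ
  split_ifs with h
  · obtain rfl : y = -x := (neg_eq_of_add_eq_zero_right h).symm
    rw [lie_vec_neg α, sgn_neg_right, sgn_self α]
    simp [hα]
  · by_cases h1 : form x y = -1
    · exact lie_of_form_eq_neg_one (α := α) (β := β) h1
    · have h2 := neg_two_le_form α β
      have h3 : form x y ≠ -2 := fun h' ↦ h (add_eq_zero_of_form_eq_neg_two (α := α) (β := β) h')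
      simp only [hα, hβ] at h2
      rw [lie_of_form_nonneg (α := α) (β := β) (by simp only [hα, hβ]; omega),
        vec_of_ne fun h' ↦ h1 ((form_add_self_eq_two_iff α β).mp h'), smul_zero]

theorem lie_atom {s t : ℤ × Bool × Lattice} (hs : s.2.1 = true → form s.2.2 s.2.2 = 2)
    (ht : t.2.1 = true → form t.2.2 t.2.2 = 2) :
    ⁅(s.1 : ℂ) • atom s.2, (t.1 : ℂ) • atom t.2⁆ = ((lieTerm s t).1 : ℂ) • atom (lieTerm s t).2 := by
  obtain ⟨c, _ | _, x⟩ := s <;> obtain ⟨d, _ | _, y⟩ := t <;>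
    simp only [atom, lieTerm, smul_lie, lie_smul, smul_smul, if_true, Bool.false_eq_true, if_false]
  · simp [lie_cart_cart]
  · rw [lie_cart_vec, smul_smul]
    push_cast
    ring_nf
  · rw [← lie_skew, lie_cart_vec, smul_neg, smul_smul, ← neg_smul]
    push_cast
    ring_nf
  · rw [lie_vec_vec (hs rfl) (ht rfl)]
    by_cases h : x + y = 0
    · simp only [if_pos h, smul_smul, Bool.false_eq_true, if_false]
      push_cast
      ring_nf
    · simp only [if_neg h, smul_smul, if_true]
      push_cast
      ring_nf

theorem eval_lie {l m : Combo} (hl : l.IsValid) (hm : m.IsValid) :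
    ⁅eval l, eval m⁆ = eval (lie l m) := by
  induction l with
  | nil => simp [eval_nil, lie]
  | cons s l ih =>
    have h1 : lie (s :: l) m = m.map (lieTerm s) ++ lie l m := by simp [lie]
    rw [h1, eval_append, ← ih fun t ht ↦ hl t (List.mem_cons_of_mem _ ht), eval_cons, add_lie]
    congr 1
    have hs := hl s List.mem_cons_self
    clear h1 ih hl
    induction m with
    | nil => simp [eval_nil]
    | cons t m ih =>
      rw [List.map_cons, eval_cons, eval_cons, lie_add,
        ih fun t ht ↦ hm t (List.mem_cons_of_mem _ ht), lie_atom hs (hm t List.mem_cons_self)]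

theorem repr_eval_inl (l : Combo) (i : Fin 8) :
    basis.repr (eval l) (.inl i) = (l.coeff (.inl i) : ℂ) := by
  induction l with
  | nil => simp [eval_nil, coeff]
  | cons t l ih =>
    have h : coeff (t :: l) (.inl i) = (if t.2.1 then 0 else t.1 * t.2.2 i) + coeff l (.inl i) := by
      simp [coeff]
    rw [h, eval_cons, map_add, Finsupp.add_apply, ih, map_smul, Finsupp.smul_apply, Int.cast_add]
    congr 1
    obtain ⟨c, _ | _, x⟩ := t
    · simp [atom, cart, Finsupp.single_apply]
    · by_cases hx : form x x = 2
      · simp [atom, vec, hx]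
      · simp [atom, vec_of_ne hx]

theorem repr_eval_inr (l : Combo) (α : Root) :
    basis.repr (eval l) (.inr α) = (l.coeff (.inr α.1) : ℂ) := by
  induction l with
  | nil => simp [eval_nil, coeff]
  | cons t l ih =>
    have h : coeff (t :: l) (.inr α.1) =
        (if t.2.1 = true ∧ t.2.2 = α.1 then t.1 else 0) + coeff l (.inr α.1) := by
      simp [coeff]
    rw [h, eval_cons, map_add, Finsupp.add_apply, ih, map_smul, Finsupp.smul_apply, Int.cast_add]
    congr 1
    obtain ⟨c, _ | _, x⟩ := t
    · simp [atom, cart]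
    · by_cases hx : form x x = 2
      · have : vec x = basis (.inr ⟨x, hx⟩) := (basis_inr ⟨x, hx⟩).symm
        by_cases hxα : x = α.1
        · subst hxα
          simp [atom, ← basis_inr]
        · have h' : (Sum.inr ⟨x, hx⟩ : Idx) ≠ .inr α := fun h ↦
            hxα (congrArg Subtype.val (Sum.inr_injective h))
          simp [atom, this, Finsupp.single_eq_of_ne' h', hxα]
      · have : x ≠ α.1 := fun h ↦ hx (h ▸ α.2)
        simp [atom, vec_of_ne hx, this]

theorem IsNull.eval_eq_zero {l : Combo} (h : l.IsNull) : eval l = 0 := by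
  refine basis.repr.injective (Finsupp.ext fun a ↦ ?_)
  rw [map_zero, Finsupp.zero_apply]
  rcases a with i | α
  · rw [repr_eval_inl, h.1 i, Int.cast_zero]
  · rw [repr_eval_inr, Int.cast_eq_zero]
    by_cases hα : ∃ t ∈ l, t.2.1 = true ∧ t.2.2 = α.1
    · obtain ⟨t, ht, h1, h2⟩ := hα
      exact h2 ▸ h.2 t ht h1 (h2 ▸ α.2)
    · push Not at hα
      refine List.sum_eq_zero fun c hc ↦ ?_
      obtain ⟨t, ht, rfl⟩ := List.mem_map.mp hc
      exact if_neg fun hx ↦ hα t ht hx.1 hx.2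

/-- The coordinate functional attached to a basis vector. -/
theorem exists_coord (s : Fin 8 ⊕ Lattice) (hs : ∀ x, s = .inr x → form x x = 2) :
    ∃ f : Model →ₗ[ℂ] ℂ, ∀ l : Combo, f (eval l) = (l.coeff s : ℂ) := by
  rcases s with i | x
  · exact ⟨basis.coord (.inl i), fun l ↦ repr_eval_inl l i⟩
  · exact ⟨basis.coord (.inr ⟨x, hs x rfl⟩), fun l ↦ repr_eval_inr l ⟨x, hs x rfl⟩⟩

/-- The combination of root vectors with the given coefficients and coordinates. -/
def ofRoots (l : List (ℤ × List ℤ)) : Combo := l.map fun t ↦ (t.1, true, ofCoords t.2)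

/-- The Cartan element with the given coordinates. -/
def ofCartan (l : List ℤ) : Combo := [(1, false, ofCoords l)]

end Combo

open Combo

/-- A nilpotent element of type `A₃ + A₁`: a sum of root vectors. -/
def nilCombo : Combo := ofRoots [
  (1, [0, 0, 0, 0, 0, 1, 1, 1]), (1, [1, 1, 2, 3, 3, 2, 1, 0]), (1, [1, 2, 2, 3, 2, 1, 1, 1]),
  (1, [1, 2, 2, 3, 2, 2, 1, 0])]

/-- The simple coroots in the centralizer of `nilCombo`. -/
def kernelCartan : List (List ℤ) := [
  [1, 0, 0, 0, 0, 0, 0, 0], [0, 0, 1, 0, 0, 0, 0, 0], [0, 0, 0, 1, 0, 0, 0, 0],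
  [0, 0, 0, 0, 0, 0, 1, 0]]

/-- The nilpotent part of a basis of the centralizer of `nilCombo`. -/
def kernelRoots : List (List (ℤ × List ℤ)) := [
  [(1, [-1, 0, 0, 0, 0, 0, 0, 0])], [(1, [-1, 0, -1, 0, 0, 0, 0, 0])],
  [(1, [-1, 0, -1, -1, 0, 0, 0, 0])],
  [(-1, [0, 1, 1, 2, 1, 0, 0, 0]), (1, [-1, -1, -1, -1, -1, 0, 0, 0])],
  [(1, [0, 1, 1, 1, 1, 0, 0, 0]), (1, [-1, -1, -1, -2, -1, 0, 0, 0])],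
  [(1, [0, 0, 1, 1, 0, 0, 0, 0])], [(1, [0, 0, 1, 0, 0, 0, 0, 0])],
  [(-1, [0, 1, 0, 1, 1, 0, 0, 0]), (1, [-1, -1, -2, -2, -1, 0, 0, 0])],
  [(1, [0, 0, 0, 1, 0, 0, 0, 0])], [(1, [0, 0, 0, 0, 0, 0, -1, 0])],
  [(1, [0, 0, 0, 0, 0, 0, 1, 0])], [(1, [0, 0, 0, -1, 0, 0, 0, 0])],
  [(-1, [1, 1, 2, 2, 1, 0, 0, 0]), (1, [0, -1, 0, -1, -1, 0, 0, 0])],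
  [(1, [0, 0, -1, 0, 0, 0, 0, 0])], [(1, [0, 0, -1, -1, 0, 0, 0, 0])],
  [(1, [1, 1, 1, 2, 1, 0, 0, 0]), (1, [0, -1, -1, -1, -1, 0, 0, 0])],
  [(-1, [1, 1, 1, 1, 1, 0, 0, 0]), (1, [0, -1, -1, -2, -1, 0, 0, 0])],
  [(1, [1, 0, 1, 1, 0, 0, 0, 0])], [(1, [1, 0, 1, 0, 0, 0, 0, 0])],
  [(1, [1, 0, 0, 0, 0, 0, 0, 0])], [(1, [0, 1, 1, 2, 1, 1, 0, 0])],
  [(1, [0, 1, 1, 2, 1, 1, 1, 0])], [(1, [0, 1, 1, 1, 1, 1, 0, 0])],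
  [(1, [0, 1, 1, 1, 1, 1, 1, 0])], [(1, [0, 1, 0, 1, 1, 1, 0, 0])],
  [(1, [0, 1, 0, 1, 1, 1, 1, 0])],
  [(-1, [0, 0, 0, 0, 0, 1, 0, 0]), (1, [1, 2, 2, 3, 2, 1, 0, 0])],
  [(-1, [0, 0, 0, 0, 0, 1, 1, 0]), (1, [1, 2, 2, 3, 2, 1, 1, 0])],
  [(1, [1, 1, 2, 2, 1, 1, 0, 0])], [(1, [1, 1, 2, 2, 1, 1, 1, 0])],
  [(1, [1, 1, 1, 2, 1, 1, 0, 0])], [(1, [1, 1, 1, 2, 1, 1, 1, 0])],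
  [(1, [1, 1, 1, 1, 1, 1, 0, 0])], [(1, [1, 1, 1, 1, 1, 1, 1, 0])],
  [(-1, [0, 1, 1, 2, 2, 1, 1, 1]), (1, [0, 1, 1, 2, 2, 2, 1, 0])],
  [(1, [0, 0, 1, 1, 1, 1, 1, 1]), (1, [1, 2, 3, 4, 3, 2, 1, 0])],
  [(-1, [0, 0, 0, 1, 1, 1, 1, 1]), (1, [1, 2, 2, 4, 3, 2, 1, 0])],
  [(1, [0, 0, 0, 0, 1, 1, 1, 1]), (1, [1, 2, 2, 3, 3, 2, 1, 0])],
  [(1, [1, 2, 2, 3, 2, 2, 1, 0])],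
  [(-1, [1, 1, 2, 3, 2, 1, 1, 1]), (1, [1, 1, 2, 3, 2, 2, 1, 0])],
  [(-1, [1, 1, 2, 2, 2, 1, 1, 1]), (1, [1, 1, 2, 2, 2, 2, 1, 0])],
  [(-1, [1, 1, 1, 2, 2, 1, 1, 1]), (1, [1, 1, 1, 2, 2, 2, 1, 0])],
  [(-1, [1, 0, 1, 1, 1, 1, 1, 1]), (1, [2, 2, 3, 4, 3, 2, 1, 0])],
  [(1, [0, 1, 1, 2, 2, 2, 1, 1])], [(1, [0, 1, 1, 2, 2, 2, 2, 1])],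
  [(1, [1, 2, 3, 4, 3, 2, 1, 1])], [(1, [1, 2, 3, 4, 3, 2, 2, 1])],
  [(1, [1, 2, 2, 4, 3, 2, 1, 1])], [(1, [1, 2, 2, 4, 3, 2, 2, 1])],
  [(1, [1, 2, 2, 3, 3, 2, 1, 1])], [(1, [1, 2, 2, 3, 3, 2, 2, 1])],
  [(-1, [1, 1, 2, 3, 3, 2, 1, 1]), (1, [1, 2, 2, 3, 2, 2, 1, 1])],
  [(-1, [1, 1, 2, 3, 3, 2, 2, 1]), (1, [1, 2, 2, 3, 2, 2, 2, 1])],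
  [(1, [1, 1, 2, 3, 2, 2, 1, 1])], [(1, [1, 1, 2, 3, 2, 2, 2, 1])],
  [(1, [1, 1, 2, 2, 2, 2, 1, 1])], [(1, [1, 1, 2, 2, 2, 2, 2, 1])],
  [(1, [1, 1, 1, 2, 2, 2, 1, 1])], [(1, [1, 1, 1, 2, 2, 2, 2, 1])],
  [(1, [2, 2, 3, 4, 3, 2, 1, 1])], [(1, [2, 2, 3, 4, 3, 2, 2, 1])],
  [(1, [1, 3, 3, 5, 4, 3, 2, 1])], [(1, [1, 2, 3, 5, 4, 3, 2, 1])],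
  [(1, [1, 2, 3, 4, 4, 3, 2, 1])], [(1, [1, 2, 3, 4, 3, 3, 2, 1])],
  [(1, [1, 2, 2, 4, 4, 3, 2, 1])], [(1, [1, 2, 2, 4, 3, 3, 2, 1])],
  [(1, [1, 2, 2, 3, 3, 3, 2, 1])],
  [(1, [1, 1, 2, 3, 3, 3, 2, 1]), (1, [2, 3, 4, 6, 5, 3, 2, 1])],
  [(1, [2, 3, 4, 6, 4, 3, 2, 1])], [(1, [2, 3, 4, 5, 4, 3, 2, 1])],
  [(1, [2, 2, 4, 5, 4, 3, 2, 1])], [(1, [2, 3, 3, 5, 4, 3, 2, 1])],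
  [(1, [2, 2, 3, 5, 4, 3, 2, 1])], [(1, [2, 2, 3, 4, 4, 3, 2, 1])],
  [(1, [2, 2, 3, 4, 3, 3, 2, 1])], [(1, [2, 3, 4, 6, 5, 4, 2, 1])],
  [(1, [2, 3, 4, 6, 5, 4, 3, 1])], [(1, [2, 3, 4, 6, 5, 4, 3, 2])],
  [(1, [0, 0, 0, 0, 0, 1, 1, 1]), (1, [1, 1, 2, 3, 3, 2, 1, 0]), (1, [1, 2, 2, 3, 2, 1, 1, 1])]]

/-- A basis of the centralizer of `nilCombo`. -/
def kernelTable : List Combo := kernelCartan.map ofCartan ++ kernelRoots.map ofRoots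

/-- Basis vectors at which the entries of `kernelTable` have the identity as coefficient matrix up
to signs: the first four are simple coroots, the others are roots. -/
def pivotTable : List (Fin 8 ⊕ Lattice) :=
  [.inl 0, .inl 2, .inl 3, .inl 6] ++ kernelRoots.map fun l ↦ .inr (ofCoords (l.headD (0, [])).2)

/-- Entries `(p, q, c)` such that the bracket of the members `p` and `q` of `kernelTable` is `c`
times the next member of `kernelTable`. -/
def bracketTable : List (ℕ × ℕ × ℤ) := [
  (4, 23, 1), (10, 17, -1), (12, 15, -1), (13, 14, 1), (1, 4, 1), (0, 5, -1), (0, 6, -1),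
  (0, 7, -1), (0, 8, -1), (0, 9, -1), (0, 10, -1), (1, 11, -1), (1, 12, -1), (3, 13, -2),
  (3, 14, 2), (1, 15, 1), (1, 16, 1), (0, 17, 1), (0, 18, 1), (0, 19, 1), (0, 20, 1), (0, 21, 1),
  (0, 22, 1), (1, 23, -1), (0, 24, -1), (0, 25, -1), (0, 26, -1), (0, 27, -1), (1, 28, -1),
  (1, 29, -1), (3, 30, -1), (3, 31, 1), (1, 32, 1), (1, 33, 1), (0, 34, 1), (0, 35, 1),
  (0, 36, 1), (0, 37, 1), (0, 38, -1), (0, 39, -1), (1, 40, -1), (2, 41, -1), (24, 37, 1),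
  (2, 43, 1), (1, 44, 1), (0, 45, 1), (0, 46, 1), (0, 47, -1), (0, 48, -1), (0, 49, -1),
  (0, 50, -1), (1, 51, -1), (1, 52, -1), (2, 53, -1), (2, 54, -1), (3, 55, -1), (3, 56, 1),
  (2, 57, 1), (2, 58, 1), (1, 59, 1), (1, 60, 1), (0, 61, 1), (0, 62, 1), (0, 63, 1), (0, 64, 1),
  (0, 65, -1), (0, 66, -1), (0, 67, -1), (0, 68, -1), (1, 69, -1), (1, 70, -1), (2, 71, -1),
  (7, 78, -1), (2, 73, 1), (1, 74, 1), (1, 75, 1), (0, 76, 1), (0, 77, 1), (0, 78, 1),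
  (0, 79, 1), (3, 80, -1), (3, 81, 1), (38, 79, -1)]

/-- Elements of the Cartan subalgebra which `nilCombo` maps to single root vectors. -/
def preimageCartan : List (List ℤ) := [
  [0, 1, 0, 0, 2, 2, 0, 1], [0, 2, 0, 0, 4, 3, 0, 1], [0, 2, 0, 0, 3, 2, 0, 1],
  [0, 1, 0, 0, 1, 1, 0, 0]]

/-- Combinations of root vectors which `nilCombo` maps to single root vectors. -/
def preimageRoots : List (List (ℤ × List ℤ)) := [
  [(-1, [0, 0, 0, 0, 1, 0, 0, 0]), (1, [0, 1, 0, 0, 0, 0, 0, 0])],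
  [(-1, [0, 0, 0, 1, 1, 0, 0, 0]), (-1, [0, 1, 0, 1, 0, 0, 0, 0])],
  [(-1, [0, 0, 1, 1, 1, 0, 0, 0]), (-1, [0, 1, 1, 1, 0, 0, 0, 0])],
  [(-1, [0, 1, 0, 1, 1, 0, 0, 0])], [(-1, [0, 1, 1, 1, 1, 0, 0, 0])],
  [(-1, [1, 0, 1, 1, 1, 0, 0, 0]), (-1, [1, 1, 1, 1, 0, 0, 0, 0])],
  [(-1, [0, 1, 1, 2, 1, 0, 0, 0])], [(-1, [1, 1, 1, 1, 1, 0, 0, 0])],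
  [(1, [-1, 0, -1, -1, -1, 0, 0, 0]), (1, [-1, -1, -1, -1, 0, 0, 0, 0])],
  [(-1, [-1, 0, -1, -1, -1, 0, 0, 0])], [(-1, [1, 1, 1, 2, 1, 0, 0, 0])],
  [(-1, [0, 0, -1, -1, -1, 0, 0, 0]), (-1, [0, -1, -1, -1, 0, 0, 0, 0])],
  [(1, [0, 0, -1, -1, -1, 0, 0, 0])], [(-1, [1, 1, 2, 2, 1, 0, 0, 0])],
  [(1, [0, 0, 0, -1, -1, 0, 0, 0]), (1, [0, -1, 0, -1, 0, 0, 0, 0])],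
  [(-1, [0, 0, 0, -1, -1, 0, 0, 0])],
  [(1, [0, 0, 0, 0, -1, 0, 0, 0]), (-1, [0, -1, 0, 0, 0, 0, 0, 0])],
  [(-1, [0, 0, 0, 0, -1, 0, 0, 0])], [(1, [0, 1, 0, 0, 0, 0, 0, 0])],
  [(1, [0, 1, 0, 1, 0, 0, 0, 0])], [(-1, [0, 1, 1, 1, 0, 0, 0, 0])],
  [(1, [1, 1, 1, 1, 0, 0, 0, 0])]]

/-- Elements of weight zero which `nilCombo` maps to single root vectors. -/
def preimageTable : List Combo := preimageCartan.map ofCartan ++ preimageRoots.map ofRoots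

/-- The entry of `kernelTable` with the given index. -/
def kernelEntry (n : ℕ) : Combo := kernelTable.getD n []

/-- The entry of `pivotTable` with the given index. -/
def pivotEntry (n : ℕ) : Fin 8 ⊕ Lattice := pivotTable.getD n (.inl 0)

theorem isValid_nilCombo : nilCombo.IsValid := by decide +kernel

theorem kernelTable_spec : ∀ l ∈ kernelTable, l.IsValid ∧ (lie nilCombo l).IsNull := by
  decide +kernel

theorem coeff_kernelEntry : ∀ i < 84, (kernelEntry i).coeff (pivotEntry i) ≠ 0 ∧
    ∀ j < 84, j ≠ i → (kernelEntry j).coeff (pivotEntry i) = 0 := by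
  decide +kernel

theorem form_pivotEntry : ∀ i < 84, ∀ x, pivotEntry i = .inr x → form x x = 2 := by
  have h : ∀ i < 84, (pivotEntry i).elim (fun _ ↦ 2) (fun x ↦ form x x) = 2 := by decide +kernel
  intro i hi x hx
  simpa [hx] using h i hi

theorem lie_kernelEntry : ∀ i < 83, ∃ t ∈ bracketTable[i]?, t.1 < 84 ∧ t.2.1 < 84 ∧ t.2.2 ≠ 0 ∧
    (lie (kernelEntry t.1) (kernelEntry t.2.1) ++ smul (-t.2.2) (kernelEntry i)).IsNull := by
  decide +kernel

theorem coeff_lie_kernel : ∀ l ∈ kernelTable, ∀ m ∈ kernelTable,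
    (lie l m).coeff (.inr (ofCoords [0, 0, 0, 0, 0, 1, 1, 1])) = 0 := by
  decide +kernel

theorem form_charVec_nilCombo : ∀ t ∈ nilCombo, t.2.1 = true ∧ form charVec t.2.2 = 2 := by
  decide +kernel

theorem preimageTable_spec : ∀ l ∈ preimageTable, l.IsValid ∧
    (lie [(1, false, charVec)] l).IsNull := by
  decide +kernel

theorem form_charVec_posTable : ∀ l ∈ posTable,
    0 ≤ form charVec (ofCoords (l.map (Nat.cast : ℕ → ℤ))) ∧
      (form charVec (ofCoords (l.map (Nat.cast : ℕ → ℤ))) = 2 → ∃ w ∈ preimageTable,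
        (lie w nilCombo ++ [(-1, true, ofCoords (l.map (Nat.cast : ℕ → ℤ)))]).IsNull) := by
  decide +kernel

end Model

end E8

namespace E8.Model

open Combo LieAlgebra

/-- The nilpotent element of type `A₃ + A₁` described by `nilCombo`. -/
noncomputable def nilElt : Model := eval nilCombo

theorem lie_charVec_nilElt : ⁅cart charVec, nilElt⁆ = (2 : ℂ) • nilElt := by
  have h := form_charVec_nilCombo
  rw [nilElt]
  generalize nilCombo = l at h
  induction l with
  | nil => simp [eval_nil]
  | cons t l ih =>
    obtain ⟨h1, h2⟩ := h t List.mem_cons_self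
    rw [eval_cons, lie_add, smul_add, ih fun s hs ↦ h s (List.mem_cons_of_mem _ hs), atom, if_pos h1,
      lie_smul, lie_cart_vec, h2, smul_comm]
    norm_num

theorem form_charVec_of_nonneg {α : Root} (h : 0 ≤ α.1) : 0 ≤ form charVec α.1 ∧
    (form charVec α.1 = 2 → ∃ w ∈ preimageTable, (lie w nilCombo ++ [(-1, true, α.1)]).IsNull) := by
  obtain ⟨l, hl, h⟩ := List.mem_map.mp (mem_posList h)
  exact h ▸ form_charVec_posTable l hl

theorem exists_lie_nilElt_eq_vec {α : Root} (h : form charVec α.1 = 2) :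
    ∃ w : Model, ⁅cart charVec, w⁆ = 0 ∧ ⁅w, nilElt⁆ = vec α.1 := by
  have hα : 0 ≤ α.1 := by
    refine (nonneg_or_nonpos α).resolve_right fun h' ↦ ?_
    have := (form_charVec_of_nonneg (α := -α) h').1
    rw [Root.neg_val, form_neg_right, h] at this
    omega
  obtain ⟨w, hw, h0⟩ := (form_charVec_of_nonneg hα).2 h
  obtain ⟨hv, hw0⟩ := preimageTable_spec w hw
  refine ⟨eval w, ?_, ?_⟩
  · have h1 : cart charVec = eval [(1, false, charVec)] := by simp [eval_cons, eval_nil, atom]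
    rw [h1, eval_lie (by decide +kernel) hv, hw0.eval_eq_zero]
  · have := h0.eval_eq_zero
    rw [eval_append, ← eval_lie hv isValid_nilCombo, eval_cons, eval_nil] at this
    simpa [nilElt, atom, ← sub_eq_add_neg, sub_eq_zero] using this

theorem exists_lie_nilElt_eq {z : Model} (hz : ⁅cart charVec, z⁆ = (2 : ℂ) • z) :
    ∃ w : Model, ⁅cart charVec, w⁆ = 0 ∧ ⁅w, nilElt⁆ = z := by
  let V : Submodule ℂ Model := (LinearMap.ker (ad ℂ Model (cart charVec))).map
    (ad ℂ Model nilElt)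
  suffices z ∈ V by
    obtain ⟨w, hw, rfl⟩ := this
    exact ⟨-w, by rw [lie_neg, show ⁅cart charVec, w⁆ = 0 from hw, neg_zero],
      by rw [← lie_skew, lie_neg, neg_neg]; rfl⟩
  rw [← basis.linearCombination_repr z, Finsupp.linearCombination_apply]
  refine Submodule.sum_mem _ fun a _ ↦ ?_
  by_cases h0 : basis.repr z a = 0
  · simp [h0]
  · rw [← torus_intCast, lie_torus_eq_smul_iff] at hz
    have h2 := (hz a).resolve_right h0
    refine V.smul_mem _ ?_
    rcases a with i | α
    · simp [weight, pairing_zero] at h2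
    · rw [weight, pairing_intCast] at h2
      obtain ⟨w, hw, hw'⟩ := exists_lie_nilElt_eq_vec (α := α) (by exact_mod_cast h2)
      rw [basis_inr]
      exact ⟨-w, by simp [hw], by rw [ad_apply, lie_neg, lie_skew, hw']⟩

theorem ad_nilElt_kernelEntry {l : Combo} (hl : l ∈ kernelTable) : ⁅nilElt, eval l⁆ = 0 := by
  obtain ⟨h1, h2⟩ := kernelTable_spec l hl
  rw [nilElt, eval_lie isValid_nilCombo h1, h2.eval_eq_zero]

theorem kernelEntry_mem {n : ℕ} (h : n < 84) : kernelEntry n ∈ kernelTable := by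
  have : kernelTable.length = 84 := by decide +kernel
  rw [kernelEntry, List.getD_eq_getElem _ _ (this ▸ h)]
  exact List.getElem_mem _

theorem linearIndependent_kernelEntry :
    LinearIndependent ℂ fun i : Fin 84 ↦ eval (kernelEntry i) := by
  rw [Fintype.linearIndependent_iff]
  intro g hg i
  obtain ⟨f, hf⟩ := exists_coord (pivotEntry i) (form_pivotEntry i i.2)
  obtain ⟨h1, h2⟩ := coeff_kernelEntry i i.2
  have := congrArg f hg
  rw [map_sum, map_zero, Finset.sum_eq_single i] at this
  · rw [map_smul, hf, smul_eq_mul] at this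
    exact (mul_eq_zero.mp this).resolve_right (Int.cast_ne_zero.mpr h1)
  · intro j _ hj
    rw [map_smul, hf, h2 j j.2 fun h ↦ hj (Fin.ext h), Int.cast_zero, smul_zero]
  · simp

theorem span_kernelEntry
    (h : Module.finrank ℂ (LinearMap.ker (ad ℂ Model nilElt)) = 84) :
    Submodule.span ℂ (Set.range fun i : Fin 84 ↦ eval (kernelEntry i)) =
      LinearMap.ker (ad ℂ Model nilElt) := by
  refine Submodule.eq_of_le_of_finrank_eq ?_ ?_
  · rw [Submodule.span_le]
    rintro _ ⟨i, rfl⟩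
    exact ad_nilElt_kernelEntry (kernelEntry_mem i.2)
  · rw [finrank_span_eq_card linearIndependent_kernelEntry, h, Fintype.card_fin]

/-- The span of the brackets of elements of the centralizer of `nilElt`. -/
noncomputable def nilDerived : Submodule ℂ Model := Submodule.span ℂ
  {z | ∃ x : Model, ⁅nilElt, x⁆ = 0 ∧ ∃ y : Model, ⁅nilElt, y⁆ = 0 ∧ ⁅x, y⁆ = z}

theorem nilDerived_le : nilDerived ≤ LinearMap.ker (ad ℂ Model nilElt) := by
  rw [nilDerived, Submodule.span_le]
  rintro _ ⟨x, hx, y, hy, rfl⟩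
  change ⁅nilElt, ⁅x, y⁆⁆ = 0
  rw [leibniz_lie, hx, hy, zero_lie, lie_zero, add_zero]

theorem kernelEntry_mem_nilDerived {i : ℕ} (hi : i < 83) : eval (kernelEntry i) ∈ nilDerived := by
  obtain ⟨t, -, h1, h2, hc, h0⟩ := lie_kernelEntry i hi
  have h1 := kernelEntry_mem h1
  have h2 := kernelEntry_mem h2
  have := h0.eval_eq_zero
  rw [eval_append, ← eval_lie (kernelTable_spec _ h1).1 (kernelTable_spec _ h2).1, eval_smul,
    Int.cast_neg, neg_smul, ← sub_eq_add_neg, sub_eq_zero] at this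
  rw [← Submodule.smul_mem_iff _ (Int.cast_ne_zero (α := ℂ).mpr hc), ← this]
  exact Submodule.subset_span ⟨_, ad_nilElt_kernelEntry h1, _, ad_nilElt_kernelEntry h2, rfl⟩

theorem nilElt_notMem_nilDerived
    (h : Module.finrank ℂ (LinearMap.ker (ad ℂ Model nilElt)) = 84) :
    nilElt ∉ nilDerived := by
  obtain ⟨f, hf⟩ := exists_coord (.inr (ofCoords [0, 0, 0, 0, 0, 1, 1, 1])) (by
    rintro x ⟨⟩; decide +kernel)
  have hker : nilDerived ≤ LinearMap.ker f := by
    rw [nilDerived, Submodule.span_le]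
    rintro _ ⟨x, hx, y, hy, rfl⟩
    replace hx : x ∈ LinearMap.ker (ad ℂ Model nilElt) := hx
    replace hy : y ∈ LinearMap.ker (ad ℂ Model nilElt) := hy
    rw [← span_kernelEntry h] at hx hy
    change f ⁅x, y⁆ = 0
    induction hx, hy using Submodule.span_induction₂ with
    | mem_mem x y hx hy =>
      obtain ⟨i, rfl⟩ := hx
      obtain ⟨j, rfl⟩ := hy
      have hi := kernelEntry_mem i.2
      have hj := kernelEntry_mem j.2
      rw [eval_lie (kernelTable_spec _ hi).1 (kernelTable_spec _ hj).1, hf,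
        coeff_lie_kernel _ hi _ hj, Int.cast_zero]
    | zero_left => simp
    | zero_right => simp
    | add_left x y z _ _ _ h1 h2 => rw [add_lie, map_add, h1, h2, add_zero]
    | add_right x y z _ _ _ h1 h2 => rw [lie_add, map_add, h1, h2, add_zero]
    | smul_left r x y _ _ h => rw [smul_lie, map_smul, h, smul_zero]
    | smul_right r x y _ _ h => rw [lie_smul, map_smul, h, smul_zero]
  intro hmem
  have h0 : f nilElt = 0 := hker hmem
  have h1 : nilCombo.coeff (.inr (ofCoords [0, 0, 0, 0, 0, 1, 1, 1])) = 1 := by decide +kernel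
  rw [nilElt, hf, h1, Int.cast_one] at h0
  exact one_ne_zero h0

theorem nilDerived_spec
    (h : Module.finrank ℂ (LinearMap.ker (ad ℂ Model nilElt)) = 84) :
    Module.finrank ℂ nilDerived = 83 ∧ nilElt ∉ nilDerived ∧
      LinearMap.ker (ad ℂ Model nilElt) = nilDerived ⊔ Submodule.span ℂ {nilElt} := by
  have hmem := nilElt_notMem_nilDerived h
  have hE : nilElt ∈ LinearMap.ker (ad ℂ Model nilElt) := lie_self nilElt
  have : Module.Finite ℂ (LinearMap.ker (ad ℂ Model nilElt)) :=
    Module.finite_of_finrank_pos (by omega)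
  have h83 : 83 ≤ Module.finrank ℂ nilDerived := by
    have hli := linearIndependent_kernelEntry.comp Fin.castSucc (Fin.castSucc_injective 83)
    have := finrank_span_eq_card hli
    rw [Fintype.card_fin] at this
    rw [← this]
    have : Module.Finite ℂ nilDerived := Submodule.finiteDimensional_of_le nilDerived_le
    refine Submodule.finrank_mono (Submodule.span_le.mpr ?_)
    rintro _ ⟨i, rfl⟩
    exact kernelEntry_mem_nilDerived i.2
  have hlt : nilDerived < LinearMap.ker (ad ℂ Model nilElt) :=
    lt_of_le_of_ne nilDerived_le fun h' ↦ hmem (h' ▸ hE)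
  have h84 := Submodule.finrank_lt_finrank_of_lt hlt
  have hlt' : nilDerived < nilDerived ⊔ Submodule.span ℂ {nilElt} :=
    lt_of_le_of_ne le_sup_left fun h' ↦
      hmem (h' ▸ Submodule.mem_sup_right (Submodule.mem_span_singleton_self _))
  have hle : nilDerived ⊔ Submodule.span ℂ {nilElt} ≤
      LinearMap.ker (ad ℂ Model nilElt) :=
    sup_le nilDerived_le (by rwa [Submodule.span_singleton_le_iff_mem])
  have : Module.Finite ℂ ↥(nilDerived ⊔ Submodule.span ℂ {nilElt}) :=
    Submodule.finiteDimensional_of_le hle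
  have h85 := Submodule.finrank_lt_finrank_of_lt hlt'
  exact ⟨by omega, hmem, (Submodule.eq_of_le_of_finrank_le hle (by omega)).symm⟩

end E8.Model

open E8 E8.Model JacobsonMorozov in
theorem exists_equiv_eq_nilElt (e : LieAlgebra.e₈ ℂ)
    (hnil : IsNilpotent (LieAlgebra.ad ℂ (LieAlgebra.e₈ ℂ) e))
    (hdim : Module.finrank ℂ ↥(centralizer e) = 84) :
    ∃ φ : LieAlgebra.e₈ ℂ ≃ₗ⁅ℂ⁆ Model, φ e = nilElt := by
  have hnil' : IsNilpotent (LieAlgebra.ad ℂ Model (equivModel e)) := by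
    rw [← LieAlgebra.conj_ad_apply]
    exact hnil.map (equivModel.toLinearEquiv.conjAlgEquiv ℂ)
  obtain ⟨φ, x, hx, hgood⟩ := exists_equiv_isGood hnil'
  set ψ := equivModel.trans φ with hψ
  have hker : Module.finrank ℂ (LinearMap.ker (LieAlgebra.ad ℂ Model (ψ e))) = 84 := by
    rw [← hdim]
    refine finrank_map_eq_of_equiv ψ _ _ fun y ↦ ?_
    change ⁅ψ e, ψ y⁆ = 0 ↔ ⁅e, y⁆ = 0
    rw [← LieEquiv.map_lie]
    exact map_eq_zero_iff ψ (EquivLike.injective ψ)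
  obtain rfl := eq_charVec_of_finrank hx (hgood.finrank_eq.trans hker)
  obtain ⟨χ, hχ⟩ := exists_equiv_of_surjOn hgood.lie_eq (fun z hz ↦ by
    obtain ⟨w, hw, rfl⟩ := hgood.exists_lie_eq z hz
    exact ⟨-w, by rw [lie_neg, hw, neg_zero], by rw [neg_lie, lie_skew]⟩)
    lie_charVec_nilElt fun z hz ↦ exists_lie_nilElt_eq hz
  exact ⟨ψ.trans χ, hχ⟩

/-- In type E₈, for nilpotent `e` with `dim g_e = 84` one has `dim [g_e,g_e] = 83`,
`e ∉ [g_e,g_e]` and `g_e = [g_e,g_e] + ℂ·e`. -/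
theorem dim84_E8 (e : LieAlgebra.e₈ ℂ)
    (hnil : IsNilpotent (LieAlgebra.ad ℂ (LieAlgebra.e₈ ℂ) e))
    (hdim : Module.finrank ℂ ↥(centralizer e) = 84) :
    Module.finrank ℂ ↥(derived e) = 83 ∧ e ∉ derived e ∧
      centralizer e = derived e ⊔ Submodule.span ℂ {e} := by
  obtain ⟨φ, hφ⟩ := exists_equiv_eq_nilElt e hnil hdim
  have hC (y : LieAlgebra.e₈ ℂ) : ⁅E8.Model.nilElt, φ y⁆ = 0 ↔ ⁅e, y⁆ = 0 := by
    rw [← hφ, ← LieEquiv.map_lie]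
    exact map_eq_zero_iff φ (EquivLike.injective φ)
  have hker := JacobsonMorozov.map_eq_of_equiv φ (centralizer e)
    (LinearMap.ker (LieAlgebra.ad ℂ E8.Model E8.Model.nilElt)) hC
  have hder : (derived e).map φ.toLinearEquiv.toLinearMap = E8.Model.nilDerived := by
    rw [derived, E8.Model.nilDerived, Submodule.map_span]
    congr 1
    ext z
    constructor
    · rintro ⟨_, ⟨x, hx, y, hy, rfl⟩, rfl⟩
      exact ⟨φ x, (hC x).mpr hx, φ y, (hC y).mpr hy, (LieEquiv.map_lie φ x y).symm⟩
    · rintro ⟨x, hx, y, hy, rfl⟩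
      obtain ⟨x, rfl⟩ := EquivLike.surjective φ x
      obtain ⟨y, rfl⟩ := EquivLike.surjective φ y
      exact ⟨⁅x, y⁆, ⟨x, (hC x).mp hx, y, (hC y).mp hy, rfl⟩, LieEquiv.map_lie φ x y⟩
  have hspan : (Submodule.span ℂ {e}).map φ.toLinearEquiv.toLinearMap =
      Submodule.span ℂ {E8.Model.nilElt} := by
    rw [Submodule.map_span, Set.image_singleton, ← hφ]
    rfl
  obtain ⟨h1, h2, h3⟩ := E8.Model.nilDerived_spec <| by
    rw [← hker, LinearEquiv.finrank_map_eq, hdim]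
  refine ⟨?_, fun h ↦ h2 ?_, ?_⟩
  · rw [← h1, ← hder, LinearEquiv.finrank_map_eq]
  · rw [← hder, ← hφ]
    exact Submodule.mem_map_of_mem h
  · rw [← hker, ← hder, ← hspan, ← Submodule.map_sup] at h3
    exact Submodule.map_injective_of_injective φ.toLinearEquiv.injective h3
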